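/- arXiv:2506.03776 — 2 statements merged into one kernel-verified Lean document; each statement's English description precedes it below -/
import Mathlib

section
/- For every dimension n ≥ 2 and every s ∈ (0,1), no barycentric quantitative isoperimetric inequality holds for general sets: for every constant C > 0 there exists a bounded measurable set E ⊆ ℝⁿ of positive finite measure and finite fractional s-perimeter (a disjoint union of two balls, one of small radius, placed so that the barycenter lies outside E) with λ₀(E) = 2 and λ₀(E) > C·√(δ_s(E)). -/
open MeasureTheory Metric Bornology
open scoped ENNReal symmDiff

/-- The fractional `s`-perimeter of a set `E ⊆ ℝⁿ`:
`P_s(E) = ∫_E ∫_{Eᶜ} |x - y|^{-(n+s)} dx dy`. -/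
noncomputable def fracPer (n : ℕ) (s : ℝ) (E : Set (EuclideanSpace ℝ (Fin n))) : ℝ≥0∞ :=
  ∫⁻ x in E, ∫⁻ y in Eᶜ, ENNReal.ofReal (‖x - y‖ ^ (-((n : ℝ) + s)))

/-- The radius of the ball centered at the origin with the same volume as `E`. -/
noncomputable def matchRad (n : ℕ) (E : Set (EuclideanSpace ℝ (Fin n))) : ℝ :=
  ((volume E).toReal / (volume (ball (0 : EuclideanSpace ℝ (Fin n)) 1)).toReal) ^ ((1 : ℝ) / n)

/-- The `s`-isoperimetric deficit `δ_s(E) = (P_s(E) - P_s(B(m)))/P_s(B(m))`, where `B(m)` is the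
ball centered at the origin with `|B(m)| = |E|`. -/
noncomputable def sDeficit (n : ℕ) (s : ℝ) (E : Set (EuclideanSpace ℝ (Fin n))) : ℝ :=
  ((fracPer n s E).toReal
      - (fracPer n s (ball (0 : EuclideanSpace ℝ (Fin n)) (matchRad n E))).toReal)
    / (fracPer n s (ball (0 : EuclideanSpace ℝ (Fin n)) (matchRad n E))).toReal

/-- The barycenter `bar(E) = (1/|E|) ∫_E x dx`. -/
noncomputable def barycenter (n : ℕ) (E : Set (EuclideanSpace ℝ (Fin n))) :
    EuclideanSpace ℝ (Fin n) :=
  ((volume E).toReal)⁻¹ • ∫ x in E, x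

/-- The barycentric asymmetry `λ₀(E) = |E ∆ (bar(E) + B(m))| / |E|`. -/
noncomputable def barAsym (n : ℕ) (E : Set (EuclideanSpace ℝ (Fin n))) : ℝ :=
  (volume (E ∆ ball (barycenter n E) (matchRad n E))).toReal / (volume E).toReal

section

variable {n : ℕ}

lemma map_affine_volume (x : EuclideanSpace ℝ (Fin n)) {r : ℝ} (hr : 0 < r) :
    (volume : Measure (EuclideanSpace ℝ (Fin n))) =
      ENNReal.ofReal (r ^ n) • volume.map (fun y => x + r • y) := by
  have h1 : (volume.map (fun y : EuclideanSpace ℝ (Fin n) => x + r • y)) =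
      (volume.map (r • ·)).map (x + ·) := by
    rw [Measure.map_map (measurable_const_add x) (measurable_const_smul r)]
    rfl
  rw [h1, Measure.map_addHaar_smul volume hr.ne', Measure.map_smul, map_add_left_eq_self,
    smul_smul, ← ENNReal.ofReal_mul (by positivity)]
  simp only [finrank_euclideanSpace, Fintype.card_fin]
  rw [abs_of_nonneg (by positivity), mul_inv_cancel₀ (by positivity), ENNReal.ofReal_one, one_smul]

lemma measurableEmbedding_affine (x : EuclideanSpace ℝ (Fin n)) {r : ℝ} (hr : 0 < r) :
    MeasurableEmbedding (fun y : EuclideanSpace ℝ (Fin n) => x + r • y) :=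
  (measurableEmbedding_addLeft x).comp (measurableEmbedding_const_smul₀ hr.ne')

lemma setLIntegral_affine (x : EuclideanSpace ℝ (Fin n)) {r : ℝ} (hr : 0 < r)
    (f : EuclideanSpace ℝ (Fin n) → ℝ≥0∞) (S : Set (EuclideanSpace ℝ (Fin n))) :
    ∫⁻ y in S, f y =
      ENNReal.ofReal (r ^ n) * ∫⁻ y in (fun y => x + r • y) ⁻¹' S, f (x + r • y) := by
  have he := measurableEmbedding_affine x hr
  conv_lhs => rw [map_affine_volume x hr]
  rw [Measure.restrict_smul, lintegral_smul_measure, he.restrict_map, he.lintegral_map, smul_eq_mul]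

lemma preimage_affine_ball (x : EuclideanSpace ℝ (Fin n)) {r : ℝ} (hr : 0 < r) :
    (fun y => x + r • y) ⁻¹' ball x r = ball 0 1 := by
  ext y
  simp [mem_ball, dist_eq_norm, norm_smul, abs_of_pos hr, mul_lt_iff_lt_one_right hr]

lemma rpow_mul_norm_kernel {s : ℝ} (n : ℕ) {r t : ℝ} (hr : 0 < r) (ht : 0 ≤ t) :
    ENNReal.ofReal (r ^ n) * ENNReal.ofReal ((r * t) ^ (-((n : ℝ) + s))) =
      ENNReal.ofReal (r ^ (-s)) * ENNReal.ofReal (t ^ (-((n : ℝ) + s))) := by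
  rw [← ENNReal.ofReal_mul (by positivity), ← ENNReal.ofReal_mul (by positivity),
    Real.mul_rpow hr.le ht, ← mul_assoc, ← Real.rpow_natCast, ← Real.rpow_add hr]
  congr 3
  ring_nf

lemma fracPer_ball (s : ℝ) (x : EuclideanSpace ℝ (Fin n)) {r : ℝ} (hr : 0 < r) :
    fracPer n s (ball x r) = ENNReal.ofReal (r ^ ((n : ℝ) - s)) * fracPer n s (ball 0 1) := by
  unfold fracPer
  rw [setLIntegral_affine x hr, preimage_affine_ball x hr]
  have key (z : EuclideanSpace ℝ (Fin n)) :
      ∫⁻ y in (ball x r)ᶜ, ENNReal.ofReal (‖x + r • z - y‖ ^ (-((n : ℝ) + s))) =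
        ENNReal.ofReal (r ^ (-s)) *
          ∫⁻ y in (ball 0 1)ᶜ, ENNReal.ofReal (‖z - y‖ ^ (-((n : ℝ) + s))) := by
    rw [setLIntegral_affine x hr, Set.preimage_compl, preimage_affine_ball x hr,
      ← lintegral_const_mul' _ _ ENNReal.ofReal_ne_top,
      ← lintegral_const_mul' _ _ ENNReal.ofReal_ne_top]
    refine lintegral_congr fun y => ?_
    rw [add_sub_add_left_eq_sub, ← smul_sub, norm_smul, Real.norm_of_nonneg hr.le,
      rpow_mul_norm_kernel n hr (norm_nonneg _)]
  simp_rw [key]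
  rw [lintegral_const_mul' _ _ ENNReal.ofReal_ne_top, ← mul_assoc,
    ← ENNReal.ofReal_mul (by positivity), ← Real.rpow_natCast, ← Real.rpow_add hr, sub_eq_add_neg]

lemma lintegral_kernel_compl_ball_lt_top {s : ℝ} (hs : 0 < s) :
    ∫⁻ z in (ball (0 : EuclideanSpace ℝ (Fin n)) 1)ᶜ,
      ENNReal.ofReal (‖z‖ ^ (-((n : ℝ) + s))) < ⊤ := by
  have hfin := finite_integral_one_add_norm (E := EuclideanSpace ℝ (Fin n)) (μ := volume)
    (r := n + s) (by simpa using hs)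
  calc _ ≤ ∫⁻ z in (ball (0 : EuclideanSpace ℝ (Fin n)) 1)ᶜ, ENNReal.ofReal (2 ^ ((n : ℝ) + s)) *
          ENNReal.ofReal ((1 + ‖z‖) ^ (-((n : ℝ) + s))) := by
        refine setLIntegral_mono' measurableSet_ball.compl fun z hz => ?_
        have hz1 : 1 ≤ ‖z‖ := by simpa using hz
        rw [← ENNReal.ofReal_mul (by positivity)]
        refine ENNReal.ofReal_le_ofReal ?_
        have h := Real.rpow_le_rpow_of_nonpos (by positivity : 0 < (1 + ‖z‖) / 2)
          (by linarith : (1 + ‖z‖) / 2 ≤ ‖z‖) (by linarith [n.cast_nonneg (α := ℝ)] : -((n : ℝ) + s) ≤ 0)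
        refine h.trans_eq ?_
        rw [Real.div_rpow (by positivity) (by norm_num), Real.rpow_neg (by norm_num : (0 : ℝ) ≤ 2),
          div_inv_eq_mul, mul_comm]
    _ ≤ ∫⁻ z : EuclideanSpace ℝ (Fin n), ENNReal.ofReal (2 ^ ((n : ℝ) + s)) *
          ENNReal.ofReal ((1 + ‖z‖) ^ (-((n : ℝ) + s))) := setLIntegral_le_lintegral _ _
    _ < ⊤ := by
        rw [lintegral_const_mul' _ _ ENNReal.ofReal_ne_top]
        exact ENNReal.mul_lt_top ENNReal.ofReal_lt_top hfin

lemma lintegral_one_sub_norm_rpow_lt_top (hn : 1 ≤ n) {s : ℝ} (hs : s < 1) :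
    ∫⁻ x in ball (0 : EuclideanSpace ℝ (Fin n)) 1, ENNReal.ofReal ((1 - ‖x‖) ^ (-s)) < ⊤ := by
  have : Nonempty (Fin n) := ⟨⟨0, hn⟩⟩
  have h0 : IntegrableOn (fun y : ℝ => (1 - y) ^ (-s)) (Set.Ioo 0 1) := by
    have h := (intervalIntegral.intervalIntegrable_rpow' (a := 0) (b := 1)
      (by linarith : -1 < -s)).comp_sub_left 1
    simp only [sub_zero, sub_self] at h
    exact ((intervalIntegrable_iff_integrableOn_Ioc_of_le zero_le_one).1 h.symm).mono_set
      Set.Ioo_subset_Ioc_self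
  have h1 : IntegrableOn (fun x : EuclideanSpace ℝ (Fin n) => (1 - ‖x‖) ^ (-s)) (ball 0 1) := by
    refine (integrableOn_fun_norm_addHaar (E := EuclideanSpace ℝ (Fin n)) volume
      (f := fun y : ℝ => (1 - y) ^ (-s))).2 ?_
    refine h0.mono' (by fun_prop) ?_
    refine (ae_restrict_iff' measurableSet_Ioo).2 (ae_of_all _ fun y hy => ?_)
    have : 0 ≤ (1 - y) ^ (-s) := Real.rpow_nonneg (by linarith [hy.2]) _
    rw [smul_eq_mul, Real.norm_of_nonneg (mul_nonneg (pow_nonneg hy.1.le _) this)]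
    exact mul_le_of_le_one_left this (pow_le_one₀ hy.1.le hy.2.le)
  exact h1.lintegral_lt_top

lemma fracPer_unitBall_lt_top (hn : 1 ≤ n) {s : ℝ} (hs : s ∈ Set.Ioo (0 : ℝ) 1) :
    fracPer n s (ball 0 1) < ⊤ := by
  unfold fracPer
  set J := ∫⁻ z in (ball (0 : EuclideanSpace ℝ (Fin n)) 1)ᶜ,
    ENNReal.ofReal (‖z‖ ^ (-((n : ℝ) + s))) with hJ
  have hJt : J < ⊤ := lintegral_kernel_compl_ball_lt_top hs.1
  calc _ ≤ ∫⁻ x in ball (0 : EuclideanSpace ℝ (Fin n)) 1,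
          ENNReal.ofReal ((1 - ‖x‖) ^ (-s)) * J := by
        refine setLIntegral_mono' measurableSet_ball fun x hx => ?_
        have hd : 0 < 1 - ‖x‖ := by simpa using hx
        rw [setLIntegral_affine x hd, hJ, ← lintegral_const_mul' _ _ ENNReal.ofReal_ne_top,
          ← lintegral_const_mul' _ _ ENNReal.ofReal_ne_top]
        refine (lintegral_mono_set (t := (ball 0 1)ᶜ) fun z hz => ?_).trans_eq
          (lintegral_congr fun z => ?_)
        · simp only [Set.mem_preimage, Set.mem_compl_iff, mem_ball_zero_iff, not_lt] at hz ⊢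
          have := hz.trans (norm_add_le _ _)
          rw [norm_smul, Real.norm_of_nonneg hd.le] at this
          nlinarith
        · rw [norm_sub_rev, add_sub_cancel_left, norm_smul, Real.norm_of_nonneg hd.le,
            rpow_mul_norm_kernel n hd (norm_nonneg _)]
    _ = _ := lintegral_mul_const' _ _ hJt.ne
    _ < ⊤ := ENNReal.mul_lt_top (lintegral_one_sub_norm_rpow_lt_top hn hs.2) hJt

lemma fracPer_union_le (s : ℝ) (A B : Set (EuclideanSpace ℝ (Fin n))) :
    fracPer n s (A ∪ B) ≤ fracPer n s A + fracPer n s B := by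
  refine (lintegral_union_le _ _ _).trans (add_le_add ?_ ?_) <;>
    refine lintegral_mono fun x => lintegral_mono_set (Set.compl_subset_compl.2 ?_)
  exacts [Set.subset_union_left, Set.subset_union_right]

lemma volume_real_ball (x : EuclideanSpace ℝ (Fin n)) {r : ℝ} (hr : 0 < r) :
    (volume (ball x r)).toReal =
      r ^ n * (volume (ball (0 : EuclideanSpace ℝ (Fin n)) 1)).toReal := by
  rw [Measure.addHaar_ball_of_pos volume x hr, ENNReal.toReal_mul,
    ENNReal.toReal_ofReal (by positivity)]
  simp

lemma integrableOn_id_ball (x : EuclideanSpace ℝ (Fin n)) (r : ℝ) :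
    IntegrableOn (fun y => y) (ball x r) :=
  (continuous_id.locallyIntegrable.integrableOn_isCompact (isCompact_closedBall x r)).mono_set
    ball_subset_closedBall

lemma setIntegral_id_ball (x : EuclideanSpace ℝ (Fin n)) (r : ℝ) :
    ∫ y in ball x r, y = (volume (ball x r)).toReal • x := by
  have hmp : MeasurePreserving (fun y : EuclideanSpace ℝ (Fin n) => (2 : ℝ) • x - y) :=
    Measure.measurePreserving_sub_left volume _
  have hme : MeasurableEmbedding (fun y : EuclideanSpace ℝ (Fin n) => (2 : ℝ) • x - y) :=
    (MeasurableEquiv.subLeft ((2 : ℝ) • x)).measurableEmbedding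
  have h := hmp.setIntegral_preimage_emb hme (fun y => y) (ball x r)
  have hpre : (fun y : EuclideanSpace ℝ (Fin n) => (2 : ℝ) • x - y) ⁻¹' ball x r = ball x r := by
    ext y
    simp only [Set.mem_preimage, mem_ball, dist_eq_norm]
    rw [← norm_neg (y - x)]
    congr! 2
    rw [two_smul]
    abel
  have : IsFiniteMeasure (volume.restrict (ball x r)) := ⟨by simp [measure_ball_lt_top]⟩
  rw [hpre, integral_sub (integrable_const _) (integrableOn_id_ball x r), setIntegral_const] at h
  have h2 := sub_eq_iff_eq_add.1 h
  rw [← two_smul ℝ (∫ y in ball x r, y), smul_comm] at h2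
  exact (smul_right_injective _ (two_ne_zero (α := ℝ)) h2).symm

lemma volume_real_union_ball {x₁ x₂ : EuclideanSpace ℝ (Fin n)} {r₁ r₂ : ℝ} (h₁ : 0 < r₁)
    (h₂ : 0 < r₂) (hd : Disjoint (ball x₁ r₁) (ball x₂ r₂)) :
    (volume (ball x₁ r₁ ∪ ball x₂ r₂)).toReal =
      (r₁ ^ n + r₂ ^ n) * (volume (ball (0 : EuclideanSpace ℝ (Fin n)) 1)).toReal := by
  rw [measure_union hd measurableSet_ball,
    ENNReal.toReal_add measure_ball_lt_top.ne measure_ball_lt_top.ne, volume_real_ball _ h₁,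
    volume_real_ball _ h₂, add_mul]

lemma volume_real_unitBall_pos :
    0 < (volume (ball (0 : EuclideanSpace ℝ (Fin n)) 1)).toReal :=
  ENNReal.toReal_pos (measure_ball_pos _ _ one_pos).ne' measure_ball_lt_top.ne

lemma matchRad_union_ball {x₁ x₂ : EuclideanSpace ℝ (Fin n)} {r₁ r₂ : ℝ} (h₁ : 0 < r₁)
    (h₂ : 0 < r₂) (hd : Disjoint (ball x₁ r₁) (ball x₂ r₂)) :
    matchRad n (ball x₁ r₁ ∪ ball x₂ r₂) = (r₁ ^ n + r₂ ^ n) ^ ((1 : ℝ) / n) := by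
  rw [matchRad, volume_real_union_ball h₁ h₂ hd, mul_div_cancel_right₀ _ volume_real_unitBall_pos.ne']

lemma barycenter_union_ball {x₁ x₂ : EuclideanSpace ℝ (Fin n)} {r₁ r₂ : ℝ} (h₁ : 0 < r₁)
    (h₂ : 0 < r₂) (hd : Disjoint (ball x₁ r₁) (ball x₂ r₂)) :
    barycenter n (ball x₁ r₁ ∪ ball x₂ r₂) =
      (r₁ ^ n + r₂ ^ n)⁻¹ • (r₁ ^ n • x₁ + r₂ ^ n • x₂) := by
  have hv := (volume_real_unitBall_pos (n := n)).ne'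
  rw [barycenter, volume_real_union_ball h₁ h₂ hd, setIntegral_union hd measurableSet_ball
    (integrableOn_id_ball _ _) (integrableOn_id_ball _ _), setIntegral_id_ball, setIntegral_id_ball,
    volume_real_ball _ h₁, volume_real_ball _ h₂, mul_comm (r₁ ^ n), mul_comm (r₂ ^ n), mul_smul,
    mul_smul, ← smul_add, smul_smul, mul_inv, mul_assoc, inv_mul_cancel₀ hv, mul_one]

lemma barAsym_eq_two {E : Set (EuclideanSpace ℝ (Fin n))} (hE : (volume E).toReal ≠ 0)
    (hvol : (volume (ball (barycenter n E) (matchRad n E))).toReal = (volume E).toReal)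
    (hd : Disjoint E (ball (barycenter n E) (matchRad n E))) : barAsym n E = 2 := by
  have htop : volume E ≠ ⊤ := fun h => hE (by simp [h])
  rw [barAsym, hd.symmDiff_eq_sup, show E ⊔ ball (barycenter n E) (matchRad n E) =
      E ∪ ball (barycenter n E) (matchRad n E) from rfl, measure_union hd measurableSet_ball,
    ENNReal.toReal_add htop measure_ball_lt_top.ne, hvol]
  field_simp
  norm_num

end

/-- **No barycentric quantitative isoperimetric inequality for general sets.**
For every `n ≥ 2`, `s ∈ (0,1)` and every constant `C > 0` there is a bounded measurable set
`E ⊆ ℝⁿ` of positive finite measure and finite fractional `s`-perimeter — a disjoint union of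
two balls, one of small radius, placed so that the barycenter lies outside `E` — with
`λ₀(E) = 2` and `λ₀(E) > C √(δ_s(E))`. -/
theorem no_barycentric_inequality_general_sets
    (n : ℕ) (hn : 2 ≤ n) (s : ℝ) (hs : s ∈ Set.Ioo (0 : ℝ) 1) (C : ℝ) (hC : 0 < C) :
    ∃ (E : Set (EuclideanSpace ℝ (Fin n))) (x₁ x₂ : EuclideanSpace ℝ (Fin n)) (r₁ r₂ : ℝ),
      E = ball x₁ r₁ ∪ ball x₂ r₂ ∧
      0 < r₂ ∧ r₂ < r₁ ∧
      Disjoint (ball x₁ r₁) (ball x₂ r₂) ∧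
      IsBounded E ∧ MeasurableSet E ∧
      0 < volume E ∧ volume E < ⊤ ∧
      fracPer n s E < ⊤ ∧
      barycenter n E ∉ E ∧
      barAsym n E = 2 ∧
      C * Real.sqrt (sDeficit n s E) < barAsym n E := by
  obtain ⟨hs0, hs1⟩ := hs
  have hn0 : (n : ℝ) ≠ 0 := by positivity
  have hn2 : (2 : ℝ) ≤ n := by exact_mod_cast hn
  obtain ⟨ε, hε0, hε1, hεC⟩ : ∃ ε : ℝ, 0 < ε ∧ ε < 1 ∧ C ^ 2 * ε ≤ 1 := by
    refine ⟨1 / (C ^ 2 + 1), by positivity, ?_, ?_⟩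
    · rw [div_lt_one (by positivity)]
      nlinarith
    · rw [mul_one_div, div_le_one (by positivity)]
      linarith
  set q : ℝ := ε ^ n with hq
  have hq0 : 0 < q := by positivity
  have hq1 : q < 1 := pow_lt_one₀ hε0.le hε1 (by omega)
  set e : EuclideanSpace ℝ (Fin n) := EuclideanSpace.single ⟨0, by omega⟩ (1 : ℝ) with he
  have hne : ‖e‖ = 1 := by simp [he]
  set x₂ : EuclideanSpace ℝ (Fin n) := (4 * (1 + q) / q) • e with hx₂
  have hnx₂ : ‖x₂‖ = 4 * (1 + q) / q := by
    rw [hx₂, norm_smul, hne, mul_one, Real.norm_of_nonneg (by positivity)]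
  have hx₂4 : 4 ≤ 4 / q := by
    rw [le_div_iff₀ hq0]
    linarith
  have hd : Disjoint (ball (0 : EuclideanSpace ℝ (Fin n)) 1) (ball x₂ ε) := by
    refine ball_disjoint_ball ?_
    rw [dist_zero_left, hnx₂, mul_add, add_div, mul_one, mul_div_cancel_right₀ _ hq0.ne']
    linarith
  set E := ball (0 : EuclideanSpace ℝ (Fin n)) 1 ∪ ball x₂ ε with hE
  set R := matchRad n E with hR
  have hReq : R = (1 + q) ^ ((1 : ℝ) / n) := by
    rw [hR, hE, matchRad_union_ball one_pos hε0 hd, one_pow]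
  have hR1 : 1 ≤ R := hReq ▸ Real.one_le_rpow (by linarith) (by positivity)
  have hRn : R ^ n = 1 + q := by
    rw [hReq, one_div, Real.rpow_inv_natCast_pow (by positivity) (by omega)]
  have hR2 : R ≤ 2 := by
    have := le_self_pow₀ hR1 (by omega : n ≠ 0)
    linarith
  have hbar : barycenter n E = (4 : ℝ) • e := by
    rw [hE, barycenter_union_ball one_pos hε0 hd, smul_zero, zero_add, hx₂, smul_smul, smul_smul,
      one_pow, ← hq]
    congr 1
    field_simp
  have hvolE : (volume E).toReal =
      (1 + q) * (volume (ball (0 : EuclideanSpace ℝ (Fin n)) 1)).toReal := by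
    rw [hE, volume_real_union_ball one_pos hε0 hd, one_pow]
  have hvolE0 : 0 < (volume E).toReal := by
    rw [hvolE]
    exact mul_pos (by positivity) volume_real_unitBall_pos
  have hdE : Disjoint E (ball (barycenter n E) R) := by
    rw [hbar, hE, Set.disjoint_union_left]
    constructor
    · refine ball_disjoint_ball ?_
      rw [dist_zero_left, norm_smul, hne, Real.norm_of_nonneg (by norm_num)]
      linarith
    · refine ball_disjoint_ball ?_
      rw [dist_eq_norm, hx₂, ← sub_smul, norm_smul, hne, mul_one]
      have : 4 * (1 + q) / q - 4 = 4 / q := by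
        field_simp
        ring
      rw [this, Real.norm_of_nonneg (by positivity)]
      linarith
  have hasym : barAsym n E = 2 := by
    refine barAsym_eq_two hvolE0.ne' ?_ hdE
    rw [← hR, volume_real_ball _ (by linarith), hRn, hvolE]
  set P := fracPer n s (ball (0 : EuclideanSpace ℝ (Fin n)) 1) with hP
  have hPt : P < ⊤ := fracPer_unitBall_lt_top (by omega) ⟨hs0, hs1⟩
  have hPE : fracPer n s E ≤ P + ENNReal.ofReal (ε ^ ((n : ℝ) - s)) * P := by
    rw [hP, ← fracPer_ball s x₂ hε0]
    exact fracPer_union_le s _ _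
  have hbd : P + ENNReal.ofReal (ε ^ ((n : ℝ) - s)) * P < ⊤ :=
    ENNReal.add_lt_top.2 ⟨hPt, ENNReal.mul_lt_top ENNReal.ofReal_lt_top hPt⟩
  have hεs : ε ^ ((n : ℝ) - s) ≤ ε := by
    simpa using Real.rpow_le_rpow_of_exponent_ge hε0 hε1.le (by linarith : 1 ≤ (n : ℝ) - s)
  have hdef : sDeficit n s E ≤ ε := by
    have hPR : P.toReal ≤ (fracPer n s (ball (0 : EuclideanSpace ℝ (Fin n)) R)).toReal := by
      rw [fracPer_ball s 0 (by linarith : 0 < R), ENNReal.toReal_mul,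
        ENNReal.toReal_ofReal (by positivity)]
      exact le_mul_of_one_le_left ENNReal.toReal_nonneg (Real.one_le_rpow hR1 (by linarith))
    have hPE' : (fracPer n s E).toReal ≤ P.toReal + ε ^ ((n : ℝ) - s) * P.toReal := by
      have := ENNReal.toReal_mono hbd.ne hPE
      rwa [ENNReal.toReal_add hPt.ne (ENNReal.mul_lt_top ENNReal.ofReal_lt_top hPt).ne,
        ENNReal.toReal_mul, ENNReal.toReal_ofReal (by positivity)] at this
    have hP0 : 0 ≤ P.toReal := ENNReal.toReal_nonneg
    refine div_le_of_le_mul₀ ENNReal.toReal_nonneg hε0.le ?_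
    rw [← hR]
    have h1 := mul_le_mul_of_nonneg_right hεs hP0
    have h2 := mul_le_mul_of_nonneg_left hPR hε0.le
    linarith
  refine ⟨E, 0, x₂, 1, ε, hE, hε0, hε1, hd, isBounded_ball.union isBounded_ball,
    measurableSet_ball.union measurableSet_ball, (ENNReal.toReal_pos_iff.1 hvolE0).1,
    (ENNReal.toReal_pos_iff.1 hvolE0).2, hPE.trans_lt hbd,
    fun h => Set.disjoint_left.1 hdE h (mem_ball_self (by linarith)), hasym, ?_⟩
  rw [hasym]
  have h1 : C * √(sDeficit n s E) ≤ 1 := by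
    calc C * √(sDeficit n s E) ≤ C * √ε := by gcongr
      _ = √(C ^ 2 * ε) := by rw [Real.sqrt_mul (sq_nonneg C), Real.sqrt_sq hC.le]
      _ ≤ 1 := Real.sqrt_le_one.2 hεC
  linarith
end

section
/- For every dimension n ≥ 2 there exists a constant γ = γ(n) > 0 such that for every bounded convex set E ⊆ ℝⁿ with nonempty interior one has λ₀(E) ≤ γ·√(δ(E)), where δ(E) = (P(E) − P(B(m)))/P(B(m)) is the classical isoperimetric deficit computed with the De Giorgi perimeter P. -/
open MeasureTheory Metric Bornology
open scoped ENNReal symmDiff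

/-- The divergence `div φ (x) = ∑ i ∂_i φ_i (x)` of a vector field `φ : ℝⁿ → ℝⁿ`. -/
noncomputable def diverg (n : ℕ)
    (φ : EuclideanSpace ℝ (Fin n) → EuclideanSpace ℝ (Fin n))
    (x : EuclideanSpace ℝ (Fin n)) : ℝ :=
  ∑ i : Fin n, fderiv ℝ φ x (EuclideanSpace.single i (1 : ℝ)) i

/-- The De Giorgi perimeter of `E ⊆ ℝⁿ`: the total variation of the characteristic function
of `E`, i.e. `P(E) = sup { ∫_E div φ dx : φ ∈ C_c¹(ℝⁿ; ℝⁿ), ‖φ‖_∞ ≤ 1 }`. -/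
noncomputable def deGiorgiPer (n : ℕ) (E : Set (EuclideanSpace ℝ (Fin n))) : ℝ :=
  sSup {r : ℝ | ∃ φ : EuclideanSpace ℝ (Fin n) → EuclideanSpace ℝ (Fin n),
    ContDiff ℝ 1 φ ∧ HasCompactSupport φ ∧ (∀ x, ‖φ x‖ ≤ 1) ∧
    r = ∫ x in E, diverg n φ x}

/-- The classical isoperimetric deficit `δ(E) = (P(E) - P(B(m)))/P(B(m))`, computed with the
De Giorgi perimeter, where `B(m)` is the ball centered at the origin with `|B(m)| = |E|`. -/
noncomputable def deficit (n : ℕ) (E : Set (EuclideanSpace ℝ (Fin n))) : ℝ :=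
  (deGiorgiPer n E - deGiorgiPer n (ball (0 : EuclideanSpace ℝ (Fin n)) (matchRad n E)))
    / deGiorgiPer n (ball (0 : EuclideanSpace ℝ (Fin n)) (matchRad n E))

/-- Euclidean space of dimension `n`. -/
abbrev Euc (n : ℕ) := EuclideanSpace ℝ (Fin n)

/-- Insert the coordinate `t` at position `i`. -/
noncomputable def ins {m : ℕ} (i : Fin (m + 1)) (t : ℝ) (y : Euc m) : Euc (m + 1) :=
  WithLp.toLp 2 (i.insertNth (α := fun _ => ℝ) t (fun j => y j))

/-- Forget the coordinate at position `i`. -/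
noncomputable def dropCoord {m : ℕ} (i : Fin (m + 1)) : Euc (m + 1) →L[ℝ] Euc m :=
  LinearMap.toContinuousLinearMap
    { toFun := fun x => WithLp.toLp 2 (fun j => x (i.succAbove j))
      map_add' := fun x y => by ext j; simp
      map_smul' := fun c x => by ext j; simp }

/-- Insert the coordinate `0` at position `i`. -/
noncomputable def embCoord {m : ℕ} (i : Fin (m + 1)) : Euc m →L[ℝ] Euc (m + 1) :=
  LinearMap.toContinuousLinearMap
    { toFun := fun y => ins i 0 y
      map_add' := fun x y => by
        ext j
        refine Fin.succAboveCases i ?_ (fun k => ?_) j <;> simp [ins]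
      map_smul' := fun c x => by
        ext j
        refine Fin.succAboveCases i ?_ (fun k => ?_) j <;> simp [ins] }

section ins
variable {m : ℕ} (i : Fin (m + 1))

@[simp] lemma ins_same (t : ℝ) (y : Euc m) : ins i t y i = t := by simp [ins]

@[simp] lemma ins_succAbove (t : ℝ) (y : Euc m) (j : Fin m) : ins i t y (i.succAbove j) = y j := by
  simp [ins]

@[simp] lemma dropCoord_apply (x : Euc (m + 1)) (j : Fin m) :
    dropCoord i x j = x (i.succAbove j) := rfl

@[simp] lemma dropCoord_ins (t : ℝ) (y : Euc m) : dropCoord i (ins i t y) = y := by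
  ext j; simp

lemma embCoord_eq (y : Euc m) : embCoord i y = ins i 0 y := rfl

@[simp] lemma embCoord_same (y : Euc m) : embCoord i y i = 0 := by simp [embCoord_eq]

@[simp] lemma embCoord_succAbove (y : Euc m) (j : Fin m) :
    embCoord i y (i.succAbove j) = y j := by simp [embCoord_eq]

lemma ins_eq_add (t : ℝ) (y : Euc m) :
    ins i t y = t • EuclideanSpace.single i (1 : ℝ) + embCoord i y := by
  ext j
  refine Fin.succAboveCases i ?_ (fun k => ?_) j <;> simp

lemma ins_dropCoord (x : Euc (m + 1)) : ins i (x i) (dropCoord i x) = x := by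
  ext j
  refine Fin.succAboveCases i ?_ (fun k => ?_) j <;> simp

lemma continuous_ins : Continuous (fun p : ℝ × Euc m => ins i p.1 p.2) := by
  simp_rw [ins_eq_add]
  fun_prop

lemma ins_combo (a b s t : ℝ) (x y : Euc m) :
    a • ins i s x + b • ins i t y = ins i (a * s + b * t) (a • x + b • y) := by
  ext j
  refine Fin.succAboveCases i ?_ (fun k => ?_) j <;> simp

lemma norm_ins_sq (t : ℝ) (y : Euc m) : ‖ins i t y‖ ^ 2 = t ^ 2 + ‖y‖ ^ 2 := by
  rw [EuclideanSpace.norm_sq_eq, EuclideanSpace.norm_sq_eq, Fin.sum_univ_succAbove _ i]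
  simp

/-- `ins` as a measurable equivalence. -/
noncomputable def insEquiv : ℝ × Euc m ≃ᵐ Euc (m + 1) :=
  ((MeasurableEquiv.refl ℝ).prodCongr (MeasurableEquiv.toLp 2 (Fin m → ℝ)).symm).trans
    ((MeasurableEquiv.piFinSuccAbove (fun _ : Fin (m + 1) => ℝ) i).symm.trans
      (MeasurableEquiv.toLp 2 (Fin (m + 1) → ℝ)))

lemma insEquiv_apply (p : ℝ × Euc m) : insEquiv i p = ins i p.1 p.2 := rfl

lemma measurePreserving_insEquiv : MeasurePreserving (insEquiv i) volume volume := by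
  refine MeasurePreserving.trans (μb := volume) ?_ (MeasurePreserving.trans (μb := volume) ?_ ?_)
  · exact (MeasurePreserving.id volume).prod
      (EuclideanSpace.volume_preserving_symm_measurableEquiv_toLp (Fin m))
  · exact (volume_preserving_piFinSuccAbove (fun _ : Fin (m + 1) => ℝ) i).symm _
  · exact (EuclideanSpace.volume_preserving_symm_measurableEquiv_toLp (Fin (m + 1))).symm _

lemma integral_eq_integral_ins {F : Euc (m + 1) → ℝ} (hF : Integrable F) :
    ∫ x, F x = ∫ t, ∫ y, F (ins i t y) := by
  have h := (measurePreserving_insEquiv i).integral_comp (insEquiv i).measurableEmbedding F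
  have h2 := ((measurePreserving_insEquiv i).integrable_comp_emb
    (insEquiv i).measurableEmbedding).2 hF
  rw [← h]
  exact integral_prod _ h2

/-- The slice of a set by the hyperplane `x i = t`. -/
def slice (E : Set (Euc (m + 1))) (t : ℝ) : Set (Euc m) := {y | ins i t y ∈ E}

lemma mem_slice {E : Set (Euc (m + 1))} {t : ℝ} {y : Euc m} : y ∈ slice i E t ↔ ins i t y ∈ E :=
  Iff.rfl

lemma isOpen_slice {E : Set (Euc (m + 1))} (hE : IsOpen E) (t : ℝ) : IsOpen (slice i E t) :=
  hE.preimage ((continuous_ins i).comp (by fun_prop : Continuous fun y : Euc m => (t, y)))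

lemma convex_slice {E : Set (Euc (m + 1))} (hE : Convex ℝ E) (t : ℝ) :
    Convex ℝ (slice i E t) := by
  intro x hx y hy a b ha hb hab
  have := hE hx hy ha hb hab
  rw [ins_combo, ← add_mul, hab, one_mul] at this
  exact this

lemma slice_subset_ball {E : Set (Euc (m + 1))} {R : ℝ} (hE : E ⊆ ball 0 R) (t : ℝ) :
    slice i E t ⊆ ball 0 R := by
  intro y hy
  have h := hE hy
  rw [mem_ball_zero_iff] at h ⊢
  refine lt_of_le_of_lt ?_ h
  refine abs_le_of_sq_le_sq' ?_ (norm_nonneg _) |>.2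
  rw [norm_ins_sq]; nlinarith

lemma setIntegral_eq_integral_slice {E : Set (Euc (m + 1))} (hE : MeasurableSet E)
    {F : Euc (m + 1) → ℝ} (hF : IntegrableOn F E) :
    ∫ x in E, F x = ∫ t, ∫ y in slice i E t, F (ins i t y) := by
  rw [← integral_indicator hE, integral_eq_integral_ins i (hF.integrable_indicator hE)]
  congr 1; ext t
  rw [← integral_indicator]
  · rfl
  · exact ((continuous_ins i).comp (by fun_prop : Continuous fun y : Euc m => (t, y))).measurable hE

lemma integrable_slice {E : Set (Euc (m + 1))} (hE : MeasurableSet E)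
    {F : Euc (m + 1) → ℝ} (hF : IntegrableOn F E) :
    Integrable (fun t => ∫ y in slice i E t, F (ins i t y)) := by
  have h2 := ((measurePreserving_insEquiv i).integrable_comp_emb
    (insEquiv i).measurableEmbedding).2 (hF.integrable_indicator hE)
  have := Integrable.integral_prod_left h2
  refine this.congr (Filter.Eventually.of_forall fun t => ?_)
  simp only
  rw [← integral_indicator]
  · rfl
  · exact ((continuous_ins i).comp (by fun_prop : Continuous fun y : Euc m => (t, y))).measurable hE

/-- The volume of a slice. -/
noncomputable def sliceVol (E : Set (Euc (m + 1))) (t : ℝ) : ℝ := volume.real (slice i E t)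

lemma sliceVol_nonneg (E : Set (Euc (m + 1))) (t : ℝ) : 0 ≤ sliceVol i E t := measureReal_nonneg

lemma setIntegral_coord {E : Set (Euc (m + 1))} (hE : MeasurableSet E)
    {h : ℝ → ℝ} (hF : IntegrableOn (fun x : Euc (m + 1) => h (x i)) E) :
    ∫ x in E, h (x i) = ∫ t, h t * sliceVol i E t := by
  rw [setIntegral_eq_integral_slice i hE hF]
  congr 1; ext t
  simp [sliceVol, mul_comm]

lemma integrable_mul_sliceVol {E : Set (Euc (m + 1))} (hE : MeasurableSet E)
    {h : ℝ → ℝ} (hF : IntegrableOn (fun x : Euc (m + 1) => h (x i)) E) :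
    Integrable (fun t => h t * sliceVol i E t) := by
  refine (integrable_slice i hE hF).congr (Filter.Eventually.of_forall fun t => ?_)
  simp [sliceVol, mul_comm]

end ins

lemma isOpen_bounded_integrableOn {n : ℕ} {E : Set (Euc n)} (hb : IsBounded E)
    {F : Euc n → ℝ} (hF : Continuous F) : IntegrableOn F E :=
  (hF.continuousOn.integrableOn_compact (isCompact_of_isClosed_isBounded isClosed_closure
    hb.closure)).mono_set subset_closure

section div

lemma continuous_diverg {n : ℕ} {φ : Euc n → Euc n} (h : ContDiff ℝ 1 φ) :
    Continuous (diverg n φ) := by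
  unfold diverg
  refine continuous_finsetSum _ fun i _ => ?_
  have := h.continuous_fderiv (by norm_num)
  have h2 : Continuous fun x => fderiv ℝ φ x (EuclideanSpace.single i (1 : ℝ)) :=
    this.clm_apply continuous_const
  fun_prop

lemma diverg_add {n : ℕ} {φ ψ : Euc n → Euc n} {x : Euc n} (h : DifferentiableAt ℝ φ x)
    (h' : DifferentiableAt ℝ ψ x) :
    diverg n (fun x => φ x + ψ x) x = diverg n φ x + diverg n ψ x := by
  unfold diverg
  rw [fderiv_fun_add h h']
  simp [Finset.sum_add_distrib]

lemma diverg_sum {n : ℕ} {ι : Type*} (s : Finset ι) {φ : ι → Euc n → Euc n} {x : Euc n}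
    (h : ∀ j ∈ s, DifferentiableAt ℝ (φ j) x) :
    diverg n (fun x => ∑ j ∈ s, φ j x) x = ∑ j ∈ s, diverg n (φ j) x := by
  unfold diverg
  rw [fderiv_fun_sum h]
  simp only [sum_apply, WithLp.ofLp_sum, Finset.sum_apply]
  rw [Finset.sum_comm]

lemma diverg_const_smul {n : ℕ} {φ : Euc n → Euc n} {x : Euc n} (h : DifferentiableAt ℝ φ x)
    (c : ℝ) : diverg n (fun x => c • φ x) x = c * diverg n φ x := by
  unfold diverg
  rw [fderiv_fun_const_smul h]
  simp [Finset.mul_sum]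

lemma diverg_congr {n : ℕ} {φ ψ : Euc n → Euc n} {x : Euc n} (h : φ =ᶠ[nhds x] ψ) :
    diverg n φ x = diverg n ψ x := by
  unfold diverg
  rw [h.fderiv_eq]

variable {m : ℕ} (i : Fin (m + 1))

lemma hasFDerivAt_coord {n : ℕ} (i : Fin n) {a : ℝ → ℝ} {a' : ℝ} {x : Euc n}
    (h : HasDerivAt a a' (x i)) :
    HasFDerivAt (fun x : Euc n => a (x i)) (a' • EuclideanSpace.proj (𝕜 := ℝ) i) x :=
  h.comp_hasFDerivAt x (EuclideanSpace.proj (𝕜 := ℝ) i).hasFDerivAt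

lemma diverg_coord {n : ℕ} (i : Fin n) {a : ℝ → ℝ} {a' : ℝ} {x : Euc n}
    (h : HasDerivAt a a' (x i)) :
    diverg n (fun x => a (x i) • EuclideanSpace.single i (1 : ℝ)) x = a' := by
  unfold diverg
  rw [((hasFDerivAt_coord i h).smul_const _).fderiv]
  simp only [ContinuousLinearMap.smulRight_apply, smul_apply,
    PiLp.proj_apply, smul_eq_mul, PiLp.smul_apply]
  rw [Finset.sum_eq_single i]
  · simp
  · intro j _ hj; simp [hj]
  · simp

lemma diverg_emb {b : ℝ → ℝ} {Y : Euc m → Euc m} {x : Euc (m + 1)}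
    (hb : DifferentiableAt ℝ b (x i)) (hY : DifferentiableAt ℝ Y (dropCoord i x)) :
    diverg (m + 1) (fun x => b (x i) • embCoord i (Y (dropCoord i x))) x
      = b (x i) * diverg m Y (dropCoord i x) := by
  unfold diverg
  have h1 := hasFDerivAt_coord i hb.hasDerivAt
  have h2 : HasFDerivAt (fun x => embCoord i (Y (dropCoord i x)))
      ((embCoord i).comp ((fderiv ℝ Y (dropCoord i x)).comp (dropCoord i))) x :=
    (embCoord i).hasFDerivAt.comp x (hY.hasFDerivAt.comp x (dropCoord i).hasFDerivAt)
  rw [(h1.fun_smul h2).fderiv, Fin.sum_univ_succAbove _ i, Finset.mul_sum]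
  have h3 : ∀ j : Fin m, dropCoord i (EuclideanSpace.single (i.succAbove j) (1 : ℝ))
      = EuclideanSpace.single j (1 : ℝ) := by
    intro j; ext k
    simp
  simp [h3, (Fin.succAbove_ne i _).symm]

end div

/-- Admissible test fields in the definition of the De Giorgi perimeter. -/
structure IsAdm {n : ℕ} (φ : Euc n → Euc n) : Prop where
  contDiff : ContDiff ℝ 1 φ
  compact : HasCompactSupport φ
  bound : ∀ x, ‖φ x‖ ≤ 1

section flux

/-- The Jacobian matrix of a vector field. -/
noncomputable def jac {n : ℕ} (φ : Euc n → Euc n) (x : Euc n) : Fin n → Fin n → ℝ :=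
  fun k j => fderiv ℝ φ x (EuclideanSpace.single j (1 : ℝ)) k

lemma continuous_jac {n : ℕ} {φ : Euc n → Euc n} (h : ContDiff ℝ 1 φ) : Continuous (jac φ) := by
  unfold jac
  refine continuous_pi fun k => continuous_pi fun j => ?_
  have := h.continuous_fderiv (by norm_num)
  have h2 : Continuous fun x => fderiv ℝ φ x (EuclideanSpace.single j (1 : ℝ)) :=
    this.clm_apply continuous_const
  fun_prop

/-- The function `(t, M) ↦ det (1 + t M)`. -/
noncomputable def detOneAdd {n : ℕ} (p : ℝ × (Fin n → Fin n → ℝ)) : ℝ :=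
  Matrix.det (1 + p.1 • Matrix.of p.2)

lemma contDiff_detOneAdd {n : ℕ} : ContDiff ℝ 1 (detOneAdd (n := n)) := by
  unfold detOneAdd
  simp only [Matrix.det_apply, Matrix.add_apply, Matrix.smul_apply, Matrix.of_apply]
  fun_prop

lemma hasDerivAt_detOneAdd {n : ℕ} (M : Fin n → Fin n → ℝ) (t : ℝ) :
    HasDerivAt (fun t => detOneAdd (t, M)) (fderiv ℝ detOneAdd (t, M) (1, 0)) t := by
  have h1 : HasFDerivAt detOneAdd (fderiv ℝ detOneAdd (t, M)) (t, M) :=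
    (contDiff_detOneAdd.differentiable (by norm_num) _).hasFDerivAt
  have h2 : HasDerivAt (fun t : ℝ => (t, M)) ((1 : ℝ), (0 : Fin n → Fin n → ℝ)) t :=
    (hasDerivAt_id t).prodMk (hasDerivAt_const t M)
  exact h1.comp_hasDerivAt t h2

lemma fderiv_detOneAdd_zero {n : ℕ} (M : Fin n → Fin n → ℝ) :
    fderiv ℝ detOneAdd (0, M) (1, 0) = ∑ j, M j j := by
  refine (hasDerivAt_detOneAdd M 0).unique ?_
  have h1 : ∀ t : ℝ, detOneAdd (t, M) = 1 + Matrix.trace (Matrix.of M) * t +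
      (Matrix.det (1 + (Polynomial.X : Polynomial ℝ) •
        (Matrix.of M).map Polynomial.C)).divX.divX.eval t * t ^ 2 :=
    fun t => Matrix.det_one_add_smul t (Matrix.of M)
  simp_rw [h1]
  set q := (Matrix.det (1 + (Polynomial.X : Polynomial ℝ) •
        (Matrix.of M).map Polynomial.C)).divX.divX
  have h2 := (((hasDerivAt_id (0 : ℝ)).const_mul (Matrix.trace (Matrix.of M))).const_add 1).add
    ((q.hasDerivAt 0).mul (hasDerivAt_pow 2 (0 : ℝ)))
  refine h2.congr_deriv ?_
  simp [Matrix.trace]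

lemma det_fderiv_eq {n : ℕ} (φ : Euc n → Euc n) (x : Euc n) (t : ℝ) :
    (ContinuousLinearMap.id ℝ (Euc n) + t • fderiv ℝ φ x).det = detOneAdd (t, jac φ x) := by
  unfold ContinuousLinearMap.det detOneAdd
  rw [← LinearMap.det_toMatrix (EuclideanSpace.basisFun (Fin n) ℝ).toBasis]
  congr 1
  ext k j
  simp [LinearMap.toMatrix_apply, jac, Matrix.one_apply, PiLp.single_apply]

open scoped Pointwise in
lemma flux_le {n : ℕ} {E : Set (Euc n)} (hc : Convex ℝ E) (hb : IsBounded E) (ho : IsOpen E)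
    {r : ℝ} (hr : 0 < r) (hrE : closedBall 0 r ⊆ closure E) {φ : Euc n → Euc n} (hφ : IsAdm φ) :
    ∫ x in E, diverg n φ x ≤ n * volume.real E / r := by
  have hvol : volume E ≠ ∞ := hb.measure_lt_top.ne
  have hcl : volume (closure E) = volume E := by
    refine le_antisymm ?_ (measure_mono subset_closure)
    calc volume (closure E) ≤ volume (E ∪ frontier E) :=
          measure_mono (by rw [closure_eq_self_union_frontier])
      _ ≤ volume E + volume (frontier E) := measure_union_le _ _
      _ = volume E := by rw [hc.addHaar_frontier volume, add_zero]
  obtain ⟨K, hK⟩ := hφ.contDiff.lipschitzWith_of_hasCompactSupport hφ.compact (by norm_num)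
  have hdiff : Differentiable ℝ φ := hφ.contDiff.differentiable (by norm_num)
  set D : ℝ → ℝ := fun t => ∫ x in E, detOneAdd (t, jac φ x) with hD
  have hcontF : Continuous (fun p : ℝ × Euc n => detOneAdd (p.1, jac φ p.2)) :=
    contDiff_detOneAdd.continuous.comp
      (continuous_fst.prodMk ((continuous_jac hφ.contDiff).comp continuous_snd))
  have hcontF' : Continuous (fun p : ℝ × Euc n =>
      fderiv ℝ detOneAdd (p.1, jac φ p.2) ((1 : ℝ), (0 : Fin n → Fin n → ℝ))) := by
    have : Continuous (fun p : ℝ × Euc n => fderiv ℝ detOneAdd (p.1, jac φ p.2)) :=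
      (contDiff_detOneAdd.continuous_fderiv (by norm_num)).comp
        (continuous_fst.prodMk ((continuous_jac hφ.contDiff).comp continuous_snd))
    exact this.clm_apply continuous_const
  obtain ⟨C, hC⟩ := ((isCompact_Icc (a := (-1 : ℝ)) (b := 1)).prod
    (isCompact_of_isClosed_isBounded isClosed_closure hb.closure)).exists_bound_of_continuousOn
    hcontF'.continuousOn
  have hDderiv : HasDerivAt D (∫ x in E, diverg n φ x) 0 := by
    have := (hasDerivAt_integral_of_dominated_loc_of_deriv_le (μ := volume.restrict E)
      (F := fun t x => detOneAdd (t, jac φ x))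
      (F' := fun t x => fderiv ℝ detOneAdd (t, jac φ x) ((1 : ℝ), (0 : Fin n → Fin n → ℝ)))
      (x₀ := 0) (s := Set.Icc (-1) 1) (bound := fun _ => C)
      (Icc_mem_nhds (by norm_num) (by norm_num))
      (Filter.Eventually.of_forall fun t =>
        (hcontF.comp (Continuous.prodMk_right t)).aestronglyMeasurable)
      (isOpen_bounded_integrableOn hb (hcontF.comp (Continuous.prodMk_right 0)))
      (hcontF'.comp (Continuous.prodMk_right 0)).aestronglyMeasurable
      (by
        filter_upwards [ae_restrict_mem ho.measurableSet] with x hx t ht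
        exact hC (t, x) ⟨ht, subset_closure hx⟩)
      (integrableOn_const hvol)
      (Filter.Eventually.of_forall fun x t _ => hasDerivAt_detOneAdd _ t)).2
    refine this.congr_deriv ?_
    simp_rw [fderiv_detOneAdd_zero]
    rfl
  have hD0 : D 0 = volume.real E := by
    simp [hD, detOneAdd]
  set U : ℝ → ℝ := fun t => (1 + t / r) ^ n * volume.real E with hU
  have hUderiv : HasDerivAt U (n * volume.real E / r) 0 := by
    have h1 := ((((hasDerivAt_id (0 : ℝ)).div_const r).const_add 1).pow n).mul_const (volume.real E)
    refine h1.congr_deriv ?_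
    simp; ring
  have hle : ∀ᶠ t in nhdsWithin (0 : ℝ) (Set.Ioi 0), D t ≤ U t := by
    have hev : ∀ᶠ t in nhdsWithin (0 : ℝ) (Set.Ioi 0), t < 1 / ((K : ℝ) + 1) :=
      nhdsWithin_le_nhds (Iio_mem_nhds (by positivity))
    filter_upwards [hev, self_mem_nhdsWithin] with t ht1 ht0
    have ht0 : 0 < t := ht0
    set ψ : Euc n → Euc n := fun x => x + t • φ x with hψ
    have hψd : ∀ x ∈ E, HasFDerivWithinAt ψ
        (ContinuousLinearMap.id ℝ (Euc n) + t • fderiv ℝ φ x) E x := fun x _ =>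
      ((hasFDerivAt_id x).add ((hdiff x).hasFDerivAt.const_smul t)).hasFDerivWithinAt
    have hinj : Set.InjOn ψ E := by
      intro x _ y _ hxy
      have h1 : x - y = t • (φ y - φ x) := by
        have : x + t • φ x = y + t • φ y := hxy
        rw [smul_sub, sub_eq_sub_iff_add_eq_add, this, add_comm]
      have h2 : ‖x - y‖ ≤ t * (K * ‖x - y‖) := by
        calc ‖x - y‖ = t * ‖φ y - φ x‖ := by rw [h1, norm_smul, Real.norm_of_nonneg ht0.le]
          _ ≤ t * (K * ‖y - x‖) := by
            gcongr
            simpa [dist_eq_norm] using hK.dist_le_mul y x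
          _ = _ := by rw [norm_sub_rev]
      have h3 : t * K < 1 := by
        have hK0 : (0 : ℝ) ≤ K := K.2
        have : t * (K + 1) < 1 := by rwa [lt_div_iff₀ (by positivity)] at ht1
        nlinarith
      have h4 : ‖x - y‖ = 0 := by
        by_contra hne
        have : 0 < ‖x - y‖ := lt_of_le_of_ne (norm_nonneg _) (Ne.symm hne)
        nlinarith
      exact sub_eq_zero.1 (norm_eq_zero.1 h4)
    have himg : ψ '' E ⊆ (1 + t / r) • closure E := by
      rintro _ ⟨x, hx, rfl⟩
      rw [hc.closure.add_smul zero_le_one (by positivity), one_smul]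
      refine Set.add_mem_add (subset_closure hx) ⟨r • φ x, hrE ?_, ?_⟩
      · rw [mem_closedBall_zero_iff, norm_smul, Real.norm_of_nonneg hr.le]
        nlinarith [hφ.bound x]
      · simp only [smul_smul]
        congr 1; field_simp
    have hcv := lintegral_abs_det_fderiv_eq_addHaar_image volume ho.measurableSet hψd hinj
    have hm := measure_mono (μ := volume) himg
    rw [← hcv, Measure.addHaar_smul, hcl] at hm
    simp only [det_fderiv_eq] at hm
    have hintg : IntegrableOn (fun x => detOneAdd (t, jac φ x)) E :=
      isOpen_bounded_integrableOn hb (hcontF.comp (Continuous.prodMk_right t))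
    have h1 : D t ≤ ∫ x in E, |detOneAdd (t, jac φ x)| := by
      exact integral_mono hintg hintg.abs (fun x => le_abs_self _)
    refine h1.trans ?_
    rw [integral_eq_lintegral_of_nonneg_ae (Filter.Eventually.of_forall fun x => abs_nonneg _)
      hintg.abs.aestronglyMeasurable]
    refine (ENNReal.toReal_mono ?_ hm).trans ?_
    · exact ENNReal.mul_ne_top ENNReal.ofReal_ne_top hvol
    · rw [ENNReal.toReal_mul, ENNReal.toReal_ofReal (abs_nonneg _), abs_of_nonneg (by positivity)]
      simp [hU, Measure.real]
  have hD1 := hDderiv.tendsto_slope_zero_right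
  have hU1 := hUderiv.tendsto_slope_zero_right
  refine le_of_tendsto_of_tendsto hD1 hU1 ?_
  filter_upwards [hle, self_mem_nhdsWithin] with t ht ht0
  have ht0 : 0 < t := ht0
  simp only [zero_add, smul_eq_mul]
  have : U 0 = volume.real E := by simp [hU]
  rw [this, hD0]
  gcongr

end flux

section slices
variable {m : ℕ} (i : Fin (m + 1))

lemma mem_closure_slice {E : Set (Euc (m + 1))} (hc : Convex ℝ E) (ho : IsOpen E) {t : ℝ}
    (hne : (slice i E t).Nonempty) {y : Euc m} (hy : ins i t y ∈ closure E) :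
    y ∈ closure (slice i E t) := by
  obtain ⟨z, hz⟩ := hne
  have hsub : openSegment ℝ z y ⊆ slice i E t := by
    rintro _ ⟨a, b, ha, hb, hab, rfl⟩
    have h1 : ins i t z ∈ interior E := by rwa [ho.interior_eq]
    have := hc.openSegment_interior_closure_subset_interior h1 hy
      ⟨a, b, ha, hb, hab, rfl⟩
    rw [ins_combo, ← add_mul, hab, one_mul, ho.interior_eq] at this
    exact this
  have h2 := closure_mono hsub
  rw [closure_openSegment] at h2
  exact h2 (right_mem_segment ℝ z y)

lemma continuousAt_setIntegral_slice {E : Set (Euc (m + 1))} (hc : Convex ℝ E) (ho : IsOpen E)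
    (hb : IsBounded E) {t : ℝ} (hne : (slice i E t).Nonempty) {h : Euc m → ℝ}
    (hh : Continuous h) : ContinuousAt (fun s => ∫ y in slice i E s, h y) t := by
  obtain ⟨R, hR⟩ := hb.subset_ball 0
  have heq : (fun s => ∫ y in slice i E s, h y)
      = fun s => ∫ y, (slice i E s).indicator h y := by
    ext s; rw [integral_indicator (isOpen_slice i ho s).measurableSet]
  rw [heq]
  have hgood : ∀ᵐ y : Euc m, y ∉ frontier (slice i E t) :=
    measure_eq_zero_iff_ae_notMem.1 ((convex_slice i hc t).addHaar_frontier volume)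
  refine continuousAt_of_dominated (bound := (ball 0 R).indicator fun y => ‖h y‖) ?_ ?_ ?_ ?_
  · exact Filter.Eventually.of_forall fun s =>
      (hh.measurable.indicator (isOpen_slice i ho s).measurableSet).aestronglyMeasurable
  · refine Filter.Eventually.of_forall fun s => Filter.Eventually.of_forall fun y => ?_
    by_cases hy : y ∈ slice i E s
    · rw [Set.indicator_of_mem hy, Set.indicator_of_mem (slice_subset_ball i hR s hy)]
    · rw [Set.indicator_of_notMem hy, norm_zero]
      exact Set.indicator_nonneg (fun _ _ => norm_nonneg _) _
  · exact (isOpen_bounded_integrableOn isBounded_ball hh.norm).integrable_indicator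
      measurableSet_ball
  · filter_upwards [hgood] with y hy
    have hcont : Continuous fun s : ℝ => ins i s y :=
      (continuous_ins i).comp (Continuous.prodMk_left y)
    by_cases hyt : y ∈ slice i E t
    · have : ∀ᶠ s in nhds t, y ∈ slice i E s := hcont.continuousAt.eventually (ho.mem_nhds hyt)
      refine continuousAt_const (y := h y) |>.congr ?_
      filter_upwards [this] with s hs
      rw [Set.indicator_of_mem hs]
    · have hy2 : ins i t y ∉ closure E := fun hcl => hy
        ⟨mem_closure_slice i hc ho hne hcl, fun hi => hyt (interior_subset hi)⟩
      have : ∀ᶠ s in nhds t, ins i s y ∈ (closure E)ᶜ :=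
        hcont.continuousAt.eventually (isClosed_closure.isOpen_compl.mem_nhds hy2)
      refine continuousAt_const (y := (0 : ℝ)) |>.congr ?_
      filter_upwards [this] with s hs
      rw [Set.indicator_of_notMem]
      exact fun hmem => hs (subset_closure hmem)

lemma exists_Ioo_slice {E : Set (Euc (m + 1))} (hc : Convex ℝ E) (ho : IsOpen E)
    (hb : IsBounded E) (hne : E.Nonempty) :
    ∃ α β : ℝ, α < β ∧ ∀ t, (slice i E t).Nonempty ↔ t ∈ Set.Ioo α β := by
  set J : Set ℝ := {t | (slice i E t).Nonempty} with hJ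
  obtain ⟨R, hR⟩ := hb.subset_ball 0
  have hJne : J.Nonempty := by
    obtain ⟨x, hx⟩ := hne
    exact ⟨x i, dropCoord i x, by rw [mem_slice, ins_dropCoord]; exact hx⟩
  have hJconv : Convex ℝ J := by
    rintro s ⟨x, hx⟩ t ⟨y, hy⟩ a b ha hb hab
    refine ⟨a • x + b • y, ?_⟩
    have := hc hx hy ha hb hab
    rwa [ins_combo] at this
  have hJopen : IsOpen J := by
    have : J = ⋃ y : Euc m, {t | ins i t y ∈ E} := by
      ext t; simp [hJ, Set.Nonempty, mem_slice]
    rw [this]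
    exact isOpen_iUnion fun y => ho.preimage ((continuous_ins i).comp (Continuous.prodMk_left y))
  have hJb : J ⊆ Set.Icc (-R) R := by
    rintro t ⟨y, hy⟩
    have h1 := hR hy
    rw [mem_ball_zero_iff] at h1
    have h2 : |t| ≤ ‖ins i t y‖ := by
      refine abs_le_of_sq_le_sq ?_ (norm_nonneg _)
      rw [norm_ins_sq]; nlinarith [norm_nonneg y]
    exact abs_le.1 (h2.trans h1.le)
  have hbb : BddBelow J := ⟨-R, fun t ht => (hJb ht).1⟩
  have hba : BddAbove J := ⟨R, fun t ht => (hJb ht).2⟩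
  have hsub := IsConnected.Ioo_csInf_csSup_subset ⟨hJne, hJconv.isPreconnected⟩ hbb hba
  have hsup : J ⊆ Set.Ioo (sInf J) (sSup J) := by
    intro t ht
    obtain ⟨ε, hε, hball⟩ := Metric.isOpen_iff.1 hJopen t ht
    constructor
    · have : t - ε / 2 ∈ J := hball (by rw [mem_ball, Real.dist_eq, abs_lt]; constructor <;> linarith)
      linarith [csInf_le hbb this]
    · have : t + ε / 2 ∈ J := hball (by rw [mem_ball, Real.dist_eq, abs_lt]; constructor <;> linarith)
      linarith [le_csSup hba this]
  refine ⟨sInf J, sSup J, ?_, fun t => ⟨fun h => hsup h, fun h => hsub h⟩⟩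
  obtain ⟨t, ht⟩ := hJne
  exact (hsup ht).1.trans (hsup ht).2

lemma sliceVol_pos {E : Set (Euc (m + 1))} (ho : IsOpen E) (hb : IsBounded E) {t : ℝ}
    (hne : (slice i E t).Nonempty) : 0 < sliceVol i E t := by
  obtain ⟨R, hR⟩ := hb.subset_ball 0
  refine ENNReal.toReal_pos ((isOpen_slice i ho t).measure_pos _ hne).ne' ?_
  exact (isBounded_ball.subset (slice_subset_ball i hR t)).measure_lt_top.ne

lemma continuousAt_sliceVol {E : Set (Euc (m + 1))} (hc : Convex ℝ E) (ho : IsOpen E)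
    (hb : IsBounded E) {t : ℝ} (hne : (slice i E t).Nonempty) :
    ContinuousAt (sliceVol i E) t := by
  have := continuousAt_setIntegral_slice i hc ho hb hne (h := fun _ => (1 : ℝ)) continuous_const
  have h : sliceVol i E = fun s => volume.real (slice i E s) := rfl
  rw [h]
  simpa using this

open scoped Manifold ContDiff in
/-- Lift of nearly optimal fields on the slices to a field on the whole space. -/
lemma exists_sliced_field {E : Set (Euc (m + 1))} (hc : Convex ℝ E) (ho : IsOpen E)
    (hb : IsBounded E) {α β : ℝ} (hJ : ∀ t, (slice i E t).Nonempty ↔ t ∈ Set.Ioo α β)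
    {q : ℝ → ℝ} (hq : ContinuousOn q (Set.Ioo α β))
    (hiso : ∀ t ∈ Set.Ioo α β, ∀ ε > 0, ∃ φ : Euc m → Euc m, IsAdm φ ∧
      q t - ε ≤ ∫ y in slice i E t, diverg m φ y)
    {σ ρ w : ℝ → ℝ} (hσ : ContDiff ℝ 1 σ) (hρ : ContDiff ℝ 1 ρ) (hw : ContDiff ℝ 1 w)
    (hρ0 : ∀ t, 0 ≤ ρ t) (hσρ : ∀ t, σ t ^ 2 + ρ t ^ 2 ≤ 1)
    {α₁ β₁ : ℝ} (hK : Set.Icc α₁ β₁ ⊆ Set.Ioo α β) (hρK : ∀ t, t ∉ Set.Icc α₁ β₁ → ρ t = 0)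
    (hw0 : ∀ t ∈ Set.Ioo α β, 0 ≤ w t) {ε : ℝ} (hε : 0 < ε) :
    ∃ T : Euc (m + 1) → Euc (m + 1), ContDiff ℝ 1 T ∧ (∀ x, ‖T x‖ ≤ 1) ∧
      (∀ x, T x i = σ (x i)) ∧
      (∫ t, deriv (fun t => w t * σ t) t * sliceVol i E t) +
        (∫ t in Set.Icc α₁ β₁, w t * ρ t * q t) - ε
        ≤ ∫ x in E, diverg (m + 1) (fun x => w (x i) • T x) x := by
  set K := Set.Icc α₁ β₁ with hKdef
  have hKc : IsCompact K := isCompact_Icc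
  have hwρ : Continuous fun t => w t * ρ t := hw.continuous.mul hρ.continuous
  set I := ∫ t in K, w t * ρ t with hI
  have hI0 : 0 ≤ I := setIntegral_nonneg measurableSet_Icc fun t ht =>
    mul_nonneg (hw0 t (hK ht)) (hρ0 t)
  set ε₁ := ε / (I + 1) with hε₁
  have hε₁0 : 0 < ε₁ := by positivity
  have hch : ∀ t : ℝ, ∃ φ : Euc m → Euc m, t ∈ Set.Ioo α β → (IsAdm φ ∧
      q t - ε₁ / 2 ≤ ∫ y in slice i E t, diverg m φ y) := by
    intro t
    by_cases ht : t ∈ Set.Ioo α β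
    · obtain ⟨φ, h⟩ := hiso t ht (ε₁ / 2) (by positivity)
      exact ⟨φ, fun _ => h⟩
    · exact ⟨0, fun h => absurd h ht⟩
  choose φ hφ using hch
  set U : ℝ → Set ℝ := fun t => {s | q s - ε₁ < ∫ y in slice i E s, diverg m (φ t) y} with hU
  have hUn : ∀ t ∈ K, U t ∈ nhds t := by
    intro t ht
    have htJ := hK ht
    obtain ⟨hadm, hle⟩ := hφ t htJ
    have h1 : ContinuousAt q t := hq.continuousAt (isOpen_Ioo.mem_nhds htJ)
    have h2 := continuousAt_setIntegral_slice i hc ho hb ((hJ t).2 htJ)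
      (continuous_diverg hadm.contDiff)
    have h3 : ContinuousAt (fun s => q s - ε₁) t := h1.sub continuousAt_const
    exact h3.eventually_lt h2 (by linarith)
  obtain ⟨S, hSK, hScov⟩ := hKc.elim_nhds_subcover (fun t => interior (U t))
    (fun t ht => interior_mem_nhds.2 (hUn t ht))
  obtain ⟨f, hf⟩ := SmoothPartitionOfUnity.exists_isSubordinate 𝓘(ℝ, ℝ) (s := K)
    hKc.isClosed (fun j : S => interior (U j)) (fun j => isOpen_interior) (by
      intro t ht
      obtain ⟨j, hj, hjt⟩ := Set.mem_iUnion₂.1 (hScov ht)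
      exact Set.mem_iUnion.2 ⟨⟨j, hj⟩, hjt⟩)
  have hfs : ∀ j : S, ContDiff ℝ 1 (f j) := fun j =>
    ((f j).contMDiff.contDiff).of_le (by exact_mod_cast le_top)
  have hf0 : ∀ (j : S) t, 0 ≤ f j t := fun j t => f.nonneg j t
  have hf1 : ∀ t ∈ K, ∑ j : S, f j t = 1 := fun t ht => by
    rw [← finsum_eq_sum_of_fintype]; exact f.sum_eq_one ht
  have hfle : ∀ t, ∑ j : S, f j t ≤ 1 := fun t => by
    rw [← finsum_eq_sum_of_fintype]; exact f.sum_le_one t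
  have hfU : ∀ (j : S) t, f j t ≠ 0 → t ∈ U j := fun j t ht =>
    interior_subset (hf j (subset_closure ht))
  have hadm : ∀ j : S, IsAdm (φ j) := fun j => (hφ j (hK (hSK j j.2))).1
  have hTeq : ∀ x : Euc (m + 1), ins i (σ (x i)) (∑ j : S, (ρ (x i) * f j (x i)) • φ j (dropCoord i x))
      = σ (x i) • EuclideanSpace.single i (1 : ℝ) +
        ∑ j : S, (ρ (x i) * f j (x i)) • embCoord i (φ j (dropCoord i x)) := by
    intro x
    rw [ins_eq_add, map_sum]
    simp_rw [map_smul]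
  have hcoord : ContDiff ℝ 1 fun x : Euc (m + 1) => x i :=
    (EuclideanSpace.proj (𝕜 := ℝ) i).contDiff
  refine ⟨fun x => ins i (σ (x i)) (∑ j : S, (ρ (x i) * f j (x i)) • φ j (dropCoord i x)),
    ?_, ?_, ?_, ?_⟩
  · simp_rw [hTeq]
    refine ((hσ.comp hcoord).smul contDiff_const).add (ContDiff.sum fun j _ => ?_)
    exact ((hρ.comp hcoord).mul ((hfs j).comp hcoord)).smul
      ((embCoord i).contDiff.comp ((hadm j).contDiff.comp (dropCoord i).contDiff))
  · intro x
    refine abs_le_of_sq_le_sq' ?_ zero_le_one |>.2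
    rw [norm_ins_sq, one_pow]
    have h1 : ‖∑ j : S, (ρ (x i) * f j (x i)) • φ j (dropCoord i x)‖ ≤ ρ (x i) := by
      calc _ ≤ ∑ j : S, ‖(ρ (x i) * f j (x i)) • φ j (dropCoord i x)‖ := norm_sum_le _ _
        _ ≤ ∑ j : S, ρ (x i) * f j (x i) := by
          refine Finset.sum_le_sum fun j _ => ?_
          have h0 : 0 ≤ ρ (x i) * f j (x i) := mul_nonneg (hρ0 _) (hf0 j _)
          rw [norm_smul, Real.norm_of_nonneg h0]
          exact mul_le_of_le_one_right h0 ((hadm j).bound _)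
        _ = ρ (x i) * ∑ j : S, f j (x i) := by rw [Finset.mul_sum]
        _ ≤ ρ (x i) := mul_le_of_le_one_right (hρ0 _) (hfle _)
    have := hσρ (x i)
    nlinarith [norm_nonneg (∑ j : S, (ρ (x i) * f j (x i)) • φ j (dropCoord i x))]
  · intro x; simp
  · have hwσ : ContDiff ℝ 1 fun t => w t * σ t := hw.mul hσ
    have hdiv : ∀ x : Euc (m + 1), diverg (m + 1) (fun x => w (x i) •
        ins i (σ (x i)) (∑ j : S, (ρ (x i) * f j (x i)) • φ j (dropCoord i x))) x
        = deriv (fun t => w t * σ t) (x i) +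
          ∑ j : S, (w (x i) * ρ (x i) * f j (x i)) * diverg m (φ j) (dropCoord i x) := by
      intro x
      have hfun : (fun x : Euc (m + 1) => w (x i) •
          ins i (σ (x i)) (∑ j : S, (ρ (x i) * f j (x i)) • φ j (dropCoord i x)))
          = fun x => (w (x i) * σ (x i)) • EuclideanSpace.single i (1 : ℝ) +
          ∑ j : S, (w (x i) * ρ (x i) * f j (x i)) • embCoord i (φ j (dropCoord i x)) := by
        ext1 x
        rw [hTeq, smul_add, smul_smul, Finset.smul_sum]
        simp_rw [smul_smul, mul_assoc]
      have hd1 : Differentiable ℝ (fun x : Euc (m + 1) =>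
          (w (x i) * σ (x i)) • EuclideanSpace.single i (1 : ℝ)) :=
        (((hwσ.comp hcoord).smul contDiff_const).differentiable (by norm_num))
      have hb' : ∀ j : S, ContDiff ℝ 1 fun t => w t * ρ t * f j t := fun j =>
        (hw.mul hρ).mul (hfs j)
      have hd2 : ∀ j : S, Differentiable ℝ (fun x : Euc (m + 1) =>
          (w (x i) * ρ (x i) * f j (x i)) • embCoord i (φ j (dropCoord i x))) := fun j =>
        (((hb' j).comp hcoord).smul ((embCoord i).contDiff.comp
          ((hadm j).contDiff.comp (dropCoord i).contDiff))).differentiable (by norm_num)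
      rw [hfun, diverg_add (hd1 x)
        (DifferentiableAt.fun_sum fun j _ => hd2 j x), diverg_sum _ (fun j _ => hd2 j x),
        diverg_coord i (a := fun t => w t * σ t)
          ((hwσ.differentiable (by norm_num)) (x i)).hasDerivAt]
      congr 1
      refine Finset.sum_congr rfl fun j _ => ?_
      exact diverg_emb i (b := fun t => w t * ρ t * f j t)
        ((hb' j).differentiable (by norm_num) _)
        ((hadm j).contDiff.differentiable (by norm_num) _)
    simp_rw [hdiv]
    have hcA : Continuous fun x : Euc (m + 1) => deriv (fun t => w t * σ t) (x i) :=
      (hwσ.continuous_deriv (by norm_num)).comp hcoord.continuous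
    have hcB : Continuous fun x : Euc (m + 1) =>
        ∑ j : S, (w (x i) * ρ (x i) * f j (x i)) * diverg m (φ j) (dropCoord i x) := by
      refine continuous_finsetSum _ fun j _ => ?_
      have h1 := continuous_diverg (hadm j).contDiff
      have h2 := (hfs j).continuous
      have h3 := hw.continuous
      have h4 := hρ.continuous
      exact (((h3.comp hcoord.continuous).mul (h4.comp hcoord.continuous)).mul
        (h2.comp hcoord.continuous)).mul (h1.comp (dropCoord i).continuous)
    have hiA := isOpen_bounded_integrableOn hb hcA
    have hiB := isOpen_bounded_integrableOn hb hcB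
    rw [integral_add hiA hiB, setIntegral_coord i ho.measurableSet hiA,
      setIntegral_eq_integral_slice i ho.measurableSet hiB]
    have hG := integrable_slice i ho.measurableSet hiB
    set G : ℝ → ℝ := fun t => ∫ y in slice i E t,
      ∑ j : S, (w (ins i t y i) * ρ (ins i t y i) * f j (ins i t y i)) *
        diverg m (φ j) (dropCoord i (ins i t y)) with hGdef
    have hGeq : ∀ t, G t = ∑ j : S, (w t * ρ t * f j t) * ∫ y in slice i E t, diverg m (φ j) y := by
      intro t
      simp only [hGdef, ins_same, dropCoord_ins]
      rw [integral_finsetSum]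
      · simp_rw [integral_const_mul]
      · intro j _
        obtain ⟨R, hR⟩ := hb.subset_ball 0
        exact (isOpen_bounded_integrableOn (isBounded_ball.subset (slice_subset_ball i hR t))
          (continuous_diverg (hadm j).contDiff)).const_mul _
    have hG0 : ∀ t, t ∉ K → G t = 0 := by
      intro t ht
      rw [hGeq]; simp [hρK t ht]
    have hGle : ∀ t ∈ K, w t * ρ t * q t - ε₁ * (w t * ρ t) ≤ G t := by
      intro t ht
      have hwt : 0 ≤ w t * ρ t := mul_nonneg (hw0 t (hK ht)) (hρ0 t)
      rw [hGeq]
      calc w t * ρ t * q t - ε₁ * (w t * ρ t) = ∑ j : S, (w t * ρ t * f j t) * (q t - ε₁) := by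
            rw [← Finset.sum_mul, ← Finset.mul_sum, hf1 t ht]; ring
        _ ≤ _ := by
          refine Finset.sum_le_sum fun j _ => ?_
          by_cases h0 : f j t = 0
          · simp [h0]
          · exact mul_le_mul_of_nonneg_left (hfU j t h0).le (mul_nonneg hwt (hf0 j t))
    have hGK : ∫ t, G t = ∫ t in K, G t :=
      (setIntegral_eq_integral_of_forall_compl_eq_zero hG0).symm
    have hqi : IntegrableOn (fun t => w t * ρ t * q t) K :=
      (hwρ.continuousOn.mul (hq.mono hK)).integrableOn_compact hKc
    have hwi : IntegrableOn (fun t => ε₁ * (w t * ρ t)) K :=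
      (hwρ.continuousOn.integrableOn_compact hKc).const_mul _
    have h1 : ∫ t in K, (w t * ρ t * q t - ε₁ * (w t * ρ t)) ≤ ∫ t in K, G t :=
      setIntegral_mono_on (hqi.sub hwi) hG.integrableOn measurableSet_Icc hGle
    rw [integral_sub hqi hwi, integral_const_mul] at h1
    have h2 : ε₁ * I ≤ ε := by
      rw [hε₁, div_mul_eq_mul_div, div_le_iff₀ (by positivity)]
      nlinarith
    rw [hGK]
    linarith

end slices

section transport

lemma exists_transport {α β c : ℝ} {f g : ℝ → ℝ} (hαβ : α < β) (hf : Integrable f)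
    (hfc : ContinuousOn f (Set.Ioo α β)) (hfp : ∀ t ∈ Set.Ioo α β, 0 < f t)
    (hg : Continuous g) (hgp : ∀ s ∈ Set.Ioo (-1 : ℝ) 1, 0 < g s) (heven : ∀ s, g (-s) = g s)
    (hc : 0 < c) (hmass : ∫ t in α..β, f t = c * ∫ s in (-1)..1, g s) :
    ∃ τ τ' : ℝ → ℝ, Continuous τ ∧ ContinuousOn τ' (Set.Ioo α β) ∧
      (∀ t ∈ Set.Ioo α β, τ t ∈ Set.Ioo (-1 : ℝ) 1 ∧ 0 < τ' t ∧ HasDerivAt τ (τ' t) t ∧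
        c * g (τ t) * τ' t = f t) ∧ (∃ t₀ ∈ Set.Ioo α β, τ t₀ = 0) ∧
      ∫ t in α..β, τ t * f t = 0 := by
  set G : ℝ → ℝ := fun s => ∫ u in (-1)..s, g u with hG
  have hgi : ∀ a b, IntervalIntegrable g volume a b := fun a b => hg.intervalIntegrable a b
  have hGd : ∀ s, HasDerivAt G (g s) s := fun s =>
    intervalIntegral.integral_hasDerivAt_right (hgi _ _)
      hg.aestronglyMeasurable.stronglyMeasurableAtFilter hg.continuousAt
  have hGc : Continuous G := continuous_iff_continuousAt.2 fun s => (hGd s).continuousAt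
  have hGmono : StrictMonoOn G (Set.Icc (-1) 1) := by
    refine strictMonoOn_of_deriv_pos (convex_Icc _ _) hGc.continuousOn fun s hs => ?_
    rw [interior_Icc] at hs
    rw [(hGd s).deriv]; exact hgp s hs
  have hGm1 : G (-1) = 0 := by simp [hG]
  set κ : ℝ → ℝ := fun s => max (-1) (min s 1) with hκ
  have hκc : Continuous κ := by fun_prop
  have hκm : Monotone κ := fun s t h => max_le_max le_rfl (min_le_min h le_rfl)
  have hκI : ∀ s, κ s ∈ Set.Icc (-1 : ℝ) 1 := fun s => ⟨le_max_left _ _,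
    max_le (by norm_num) (min_le_right _ _)⟩
  have hκid : ∀ s ∈ Set.Icc (-1 : ℝ) 1, κ s = s := fun s hs => by
    simp only [hκ]; rw [min_eq_left hs.2, max_eq_right hs.1]
  have hκ2 : Monotone fun s => s - κ s := by
    intro s t h
    simp only [hκ]
    rcases max_cases (-1 : ℝ) (min s 1) with h1 | h1 <;> rcases max_cases (-1 : ℝ) (min t 1) with h2 | h2 <;>
    rcases min_cases s 1 with h3 | h3 <;> rcases min_cases t 1 with h4 | h4 <;> linarith
  set H : ℝ → ℝ := fun s => G (κ s) + (s - κ s) with hH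
  have hHc : Continuous H := by fun_prop
  have hHm : StrictMono H := by
    intro s t h
    rcases (hκm h.le).lt_or_eq with h1 | h1
    · have := hGmono (hκI s) (hκI t) h1
      have h2 := hκ2 h.le
      simp only [hH] at *; linarith
    · simp only [hH, h1]; linarith
  have hHid : ∀ s ∈ Set.Icc (-1 : ℝ) 1, H s = G s := fun s hs => by
    simp only [hH]; rw [hκid s hs]; ring
  have hG0 : ∀ s ∈ Set.Icc (-1 : ℝ) 1, 0 ≤ G s ∧ G s ≤ G 1 := fun s hs => by
    rw [← hGm1]
    exact ⟨hGmono.monotoneOn ⟨le_rfl, by norm_num⟩ hs hs.1,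
      hGmono.monotoneOn hs ⟨by norm_num, le_rfl⟩ hs.2⟩
  have hHs : Function.Surjective H := by
    refine hHc.surjective ?_ ?_
    · refine Filter.tendsto_atTop_mono (f := fun s => s + (-1)) (fun s => ?_)
        (Filter.tendsto_atTop_add_const_right _ _ Filter.tendsto_id)
      have := (hG0 _ (hκI s)).1; have := (hκI s).2
      simp only [hH]; linarith
    · refine Filter.tendsto_atBot_mono (g := H) (f := fun s => s + (G 1 + 1)) (fun s => ?_)
        (Filter.tendsto_atBot_add_const_right _ _ Filter.tendsto_id)
      have := (hG0 _ (hκI s)).2; have := (hκI s).1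
      simp only [hH]; linarith
  set S : ℝ → ℝ := fun y => (hHm.orderIsoOfSurjective H hHs).symm y with hS
  have hSc : Continuous S := (hHm.orderIsoOfSurjective H hHs).symm.continuous
  have hHS : ∀ y, H (S y) = y := fun y => (hHm.orderIsoOfSurjective H hHs).apply_symm_apply y
  have hSH : ∀ y, S (H y) = y := fun y => (hHm.orderIsoOfSurjective H hHs).symm_apply_apply y
  have hSm : StrictMono S := (hHm.orderIsoOfSurjective H hHs).symm.strictMono
  have hS0 : S 0 = -1 := by
    have := hSH (-1); rwa [hHid _ ⟨le_rfl, by norm_num⟩, hGm1] at this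
  have hS1 : S (G 1) = 1 := by
    have := hSH 1; rwa [hHid _ ⟨by norm_num, le_rfl⟩] at this
  have hSI : ∀ y ∈ Set.Ioo 0 (G 1), S y ∈ Set.Ioo (-1 : ℝ) 1 := fun y hy => by
    constructor
    · rw [← hS0]; exact hSm hy.1
    · rw [← hS1]; exact hSm hy.2
  have hSd : ∀ y ∈ Set.Ioo 0 (G 1), HasDerivAt S (g (S y))⁻¹ y := by
    intro y hy
    have hI := hSI y hy
    refine HasDerivAt.of_local_left_inverse (f := H) hSc.continuousAt ?_ (hgp _ hI).ne'
      (Filter.Eventually.of_forall hHS)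
    refine (hGd (S y)).congr_of_eventuallyEq ?_
    filter_upwards [isOpen_Ioo.mem_nhds hI] with s hs
    exact hHid s ⟨hs.1.le, hs.2.le⟩
  set F : ℝ → ℝ := fun t => ∫ s in α..t, f s with hF
  have hfi : ∀ a b, IntervalIntegrable f volume a b := fun a b => hf.intervalIntegrable
  have hFd : ∀ t ∈ Set.Ioo α β, HasDerivAt F (f t) t := fun t ht =>
    intervalIntegral.integral_hasDerivAt_right (hfi _ _)
      hf.aestronglyMeasurable.stronglyMeasurableAtFilter (hfc.continuousAt (isOpen_Ioo.mem_nhds ht))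
  have hFc : Continuous F := intervalIntegral.continuous_primitive hfi α
  have hFβ : F β = c * G 1 := hmass
  have hF0 : F α = 0 := by simp [hF]
  have hFI : ∀ t ∈ Set.Ioo α β, F t / c ∈ Set.Ioo 0 (G 1) := by
    intro t ht
    have h1 : 0 < F t := intervalIntegral.intervalIntegral_pos_of_pos_on (hfi _ _)
      (fun s hs => hfp s ⟨hs.1, hs.2.trans ht.2⟩) ht.1
    have h2 : 0 < ∫ s in t..β, f s := intervalIntegral.intervalIntegral_pos_of_pos_on (hfi _ _)
      (fun s hs => hfp s ⟨ht.1.trans hs.1, hs.2⟩) ht.2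
    have h3 : F t + ∫ s in t..β, f s = F β :=
      intervalIntegral.integral_add_adjacent_intervals (hfi _ _) (hfi _ _)
    refine ⟨by positivity, ?_⟩
    rw [div_lt_iff₀ hc]; linarith
  have hτc : Continuous fun t => S (F t / c) := hSc.comp (hFc.div_const c)
  have hτI : ∀ t ∈ Set.Ioo α β, S (F t / c) ∈ Set.Ioo (-1 : ℝ) 1 := fun t ht => hSI _ (hFI t ht)
  have hτd : ∀ t ∈ Set.Ioo α β, HasDerivAt (fun t => S (F t / c)) (f t / (c * g (S (F t / c)))) t := by
    intro t ht
    have h1 := (hSd _ (hFI t ht)).comp t ((hFd t ht).div_const c)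
    refine h1.congr_deriv ?_
    have := (hgp _ (hτI t ht)).ne'
    field_simp
  refine ⟨fun t => S (F t / c), fun t => f t / (c * g (S (F t / c))), hτc, ?_, ?_, ?_, ?_⟩
  · refine hfc.div (continuous_const.mul (hg.comp hτc)).continuousOn fun t ht => ?_
    exact (mul_pos hc (hgp _ (hτI t ht))).ne'
  · intro t ht
    have h1 := mul_pos hc (hgp _ (hτI t ht))
    exact ⟨hτI t ht, div_pos (hfp t ht) h1, hτd t ht, mul_div_cancel₀ _ h1.ne'⟩
  · have h1 : (0 : ℝ) ∈ Set.Ioo (S (F α / c)) (S (F β / c)) := by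
      rw [hF0, hFβ, zero_div, mul_div_cancel_left₀ _ hc.ne', hS0, hS1]; norm_num
    obtain ⟨t, ht, h⟩ := intermediate_value_Ioo hαβ.le hτc.continuousOn h1
    exact ⟨t, ht, h⟩
  · set L : ℝ → ℝ := fun s => ∫ u in (0 : ℝ)..s, u * g u with hL
    have hug : Continuous fun u => u * g u := continuous_id.mul hg
    have hLd : ∀ s, HasDerivAt L (s * g s) s := fun s =>
      intervalIntegral.integral_hasDerivAt_right (hug.intervalIntegrable _ _)
        hug.aestronglyMeasurable.stronglyMeasurableAtFilter hug.continuousAt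
    have hLc : Continuous L := continuous_iff_continuousAt.2 fun s => (hLd s).continuousAt
    have h := intervalIntegral.integral_eq_sub_of_hasDerivAt_of_le (a := α) (b := β)
      (f := fun t => c * L (S (F t / c))) (f' := fun t => S (F t / c) * f t) hαβ.le
      (continuous_const.mul (hLc.comp hτc)).continuousOn (fun t ht => by
        have h1 := ((hLd (S (F t / c))).comp t (hτd t ht)).const_mul c
        refine h1.congr_deriv ?_
        have := (hgp _ (hτI t ht)).ne'
        field_simp) ((hfi α β).continuousOn_mul hτc.continuousOn)
    rw [h, hF0, hFβ, zero_div, mul_div_cancel_left₀ _ hc.ne', hS0, hS1]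
    have h2 : L (-1) = L 1 := by
      have := intervalIntegral.integral_comp_neg (a := 0) (b := 1) (fun u => u * g u)
      simp only [heven, neg_mul, intervalIntegral.integral_neg, neg_zero] at this
      simp only [hL]
      rw [intervalIntegral.integral_symm (-1) 0, ← this]; ring
    rw [h2]; ring

end transport

section scaling
variable {n : ℕ}

/-- The preimage of `E` under `y ↦ b + a • y`. -/
def affPre (a : ℝ) (b : Euc n) (E : Set (Euc n)) : Set (Euc n) := {y | b + a • y ∈ E}

lemma isOpen_affPre {a : ℝ} {b : Euc n} {E : Set (Euc n)} (ho : IsOpen E) :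
    IsOpen (affPre a b E) :=
  ho.preimage (by fun_prop : Continuous fun y : Euc n => b + a • y)

lemma convex_affPre {a : ℝ} {b : Euc n} {E : Set (Euc n)} (hc : Convex ℝ E) :
    Convex ℝ (affPre a b E) := by
  intro x hx y hy s t hs ht hst
  have := hc hx hy hs ht hst
  have h2 : b + a • (s • x + t • y) = s • (b + a • x) + t • (b + a • y) := by
    calc b + a • (s • x + t • y) = (s + t) • b + a • (s • x + t • y) := by rw [hst, one_smul]
      _ = _ := by module
  change b + a • (s • x + t • y) ∈ E
  rwa [h2]

lemma isBounded_affPre {a : ℝ} (ha : 0 < a) {b : Euc n} {E : Set (Euc n)} (hb : IsBounded E) :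
    IsBounded (affPre a b E) := by
  obtain ⟨R, hR⟩ := hb.subset_ball b
  refine (isBounded_ball (x := (0 : Euc n)) (r := R / a)).subset fun y hy => ?_
  have := hR hy
  rw [mem_ball, dist_eq_norm, add_sub_cancel_left, norm_smul, Real.norm_of_nonneg ha.le] at this
  rw [mem_ball_zero_iff, lt_div_iff₀ ha]; linarith

lemma setIntegral_affPre {a : ℝ} (ha : 0 < a) {b : Euc n} {E : Set (Euc n)}
    (hE : MeasurableSet E) (F : Euc n → ℝ) :
    ∫ y in affPre a b E, F (b + a • y) = (a ^ n)⁻¹ * ∫ x in E, F x := by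
  have hm : MeasurableSet (affPre a b E) :=
    (by fun_prop : Continuous fun y : Euc n => b + a • y).measurable hE
  rw [← integral_indicator hm, ← integral_indicator hE]
  have h1 : (affPre a b E).indicator (fun y => F (b + a • y))
      = fun y => (fun z => E.indicator F (b + z)) (a • y) := by
    ext y
    by_cases hy : b + a • y ∈ E
    · rw [Set.indicator_of_mem (show y ∈ affPre a b E from hy)]
      simp [hy]
    · rw [Set.indicator_of_notMem (show y ∉ affPre a b E from hy)]
      simp [hy]
  rw [h1, Measure.integral_comp_smul, integral_add_left_eq_self]
  rw [finrank_euclideanSpace_fin, abs_of_nonneg (by positivity), smul_eq_mul]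

lemma volume_affPre {a : ℝ} (ha : 0 < a) {b : Euc n} {E : Set (Euc n)} (hE : MeasurableSet E) :
    volume.real (affPre a b E) = (a ^ n)⁻¹ * volume.real E := by
  simpa using setIntegral_affPre ha (b := b) hE (fun _ => (1 : ℝ))

lemma exists_scaled_field {a : ℝ} (ha : 0 < a) (b : Euc n) {E : Set (Euc n)}
    (hE : MeasurableSet E) {φ : Euc n → Euc n} (hφ : IsAdm φ) :
    ∃ ψ : Euc n → Euc n, IsAdm ψ ∧
      ∫ x in E, diverg n ψ x = a ^ n / a * ∫ y in affPre a b E, diverg n φ y := by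
  have hd : ∀ x, HasFDerivAt (fun x : Euc n => a⁻¹ • (x - b))
      (a⁻¹ • ContinuousLinearMap.id ℝ (Euc n)) x := fun x =>
    ((hasFDerivAt_id x).sub_const b).const_smul a⁻¹
  refine ⟨fun x => φ (a⁻¹ • (x - b)), ⟨?_, ?_, fun x => hφ.bound _⟩, ?_⟩
  · exact hφ.contDiff.comp ((contDiff_id.sub contDiff_const).const_smul a⁻¹)
  · have h := hφ.compact.comp_homeomorph
      ((Homeomorph.subRight b).trans (Homeomorph.smulOfNeZero a⁻¹ (inv_ne_zero ha.ne')))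
    exact h
  · have hdiv : ∀ x, diverg n (fun x => φ (a⁻¹ • (x - b))) x
        = a⁻¹ * diverg n φ (a⁻¹ • (x - b)) := by
      intro x
      have h1 := ((hφ.contDiff.differentiable (by norm_num) (a⁻¹ • (x - b))).hasFDerivAt.comp x
        (hd x))
      unfold diverg
      rw [Finset.mul_sum]
      refine Finset.sum_congr rfl fun i _ => ?_
      have h2 : fderiv ℝ (fun x => φ (a⁻¹ • (x - b))) x = _ := h1.fderiv
      rw [h2]
      simp
    simp_rw [hdiv]
    have := setIntegral_affPre ha (b := b) hE (fun x => a⁻¹ * diverg n φ (a⁻¹ • (x - b)))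
    simp only [add_sub_cancel_left, inv_smul_smul₀ ha.ne'] at this
    rw [integral_const_mul] at this
    have ha2 : a ^ n ≠ 0 := by positivity
    field_simp at this ⊢
    linarith

end scaling

/-- The volume of the unit ball. -/
noncomputable def om (n : ℕ) : ℝ := volume.real (ball (0 : Euc n) 1)

lemma om_pos (n : ℕ) : 0 < om n :=
  ENNReal.toReal_pos (measure_ball_pos _ _ one_pos).ne' measure_ball_lt_top.ne

lemma volume_ball_eq (n : ℕ) (x : Euc n) {r : ℝ} (hr : 0 < r) :
    volume.real (ball x r) = om n * r ^ n := by
  simp only [om, measureReal_def]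
  rw [Measure.addHaar_ball_of_pos _ _ hr, finrank_euclideanSpace_fin, ENNReal.toReal_mul,
    ENNReal.toReal_ofReal (by positivity), mul_comm]

/-- Convex sets of volume `om n` have (nearly) at least the perimeter of the unit ball. -/
def IsoIneq (n : ℕ) : Prop :=
  ∀ A : Set (Euc n), Convex ℝ A → IsOpen A → IsBounded A → volume.real A = om n → ∀ ε > 0,
    ∃ φ : Euc n → Euc n, IsAdm φ ∧ n * om n - ε ≤ ∫ x in A, diverg n φ x

lemma IsoIneq.scaled {n : ℕ} (h : IsoIneq n) {A : Set (Euc n)} (hc : Convex ℝ A) (ho : IsOpen A)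
    (hb : IsBounded A) {a : ℝ} (ha : 0 < a) (hv : volume.real A = om n * a ^ n) {ε : ℝ}
    (hε : 0 < ε) :
    ∃ φ : Euc n → Euc n, IsAdm φ ∧ n * volume.real A / a - ε ≤ ∫ x in A, diverg n φ x := by
  have han : 0 < a ^ n := by positivity
  obtain ⟨φ, hφ, hle⟩ := h (affPre a 0 A) (convex_affPre hc) (isOpen_affPre ho)
    (isBounded_affPre ha hb) (by rw [volume_affPre ha ho.measurableSet, hv]; field_simp)
    (ε * a / a ^ n) (by positivity)
  obtain ⟨ψ, hψ, heq⟩ := exists_scaled_field ha 0 ho.measurableSet hφ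
  refine ⟨ψ, hψ, ?_⟩
  rw [heq, hv]
  calc n * (om n * a ^ n) / a - ε = a ^ n / a * (n * om n - ε * a / a ^ n) := by field_simp
    _ ≤ _ := by gcongr

lemma sliceVol_ball {m : ℕ} (i : Fin (m + 1)) {t : ℝ} (ht : t ∈ Set.Ioo (-1 : ℝ) 1) :
    sliceVol i (ball 0 1) t = om m * Real.sqrt (1 - t ^ 2) ^ m := by
  have h0 : 0 < 1 - t ^ 2 := by nlinarith [ht.1, ht.2]
  rw [← volume_ball_eq m 0 (Real.sqrt_pos.2 h0), sliceVol]
  congr 1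
  ext y
  rw [mem_slice, mem_ball_zero_iff, mem_ball_zero_iff, Real.lt_sqrt (norm_nonneg _),
    ← sq_lt_one_iff₀ (norm_nonneg _), norm_ins_sq]
  constructor <;> intro h <;> linarith

lemma sliceVol_eq_zero {m : ℕ} {i : Fin (m + 1)} {E : Set (Euc (m + 1))} {t : ℝ}
    (h : ¬ (slice i E t).Nonempty) : sliceVol i E t = 0 := by
  rw [Set.not_nonempty_iff_eq_empty] at h
  simp [sliceVol, h]

lemma volume_eq_integral_sliceVol {m : ℕ} (i : Fin (m + 1)) {E : Set (Euc (m + 1))}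
    (ho : IsOpen E) (hb : IsBounded E) : volume.real E = ∫ t, sliceVol i E t := by
  have h := setIntegral_coord i (h := fun _ => (1 : ℝ)) ho.measurableSet
    (isOpen_bounded_integrableOn hb continuous_const)
  simpa using h

lemma integrable_sliceVol {m : ℕ} (i : Fin (m + 1)) {E : Set (Euc (m + 1))}
    (ho : IsOpen E) (hb : IsBounded E) : Integrable (sliceVol i E) := by
  have h := integrable_mul_sliceVol i (h := fun _ => (1 : ℝ)) ho.measurableSet
    (isOpen_bounded_integrableOn hb continuous_const)
  simpa using h

lemma om_succ (m : ℕ) :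
    om (m + 1) = ∫ s in (-1)..1, om m * Real.sqrt (1 - s ^ 2) ^ m := by
  have h := volume_eq_integral_sliceVol (0 : Fin (m + 1)) (E := ball 0 1) isOpen_ball isBounded_ball
  rw [om, h, intervalIntegral.integral_of_le (by norm_num), integral_Ioc_eq_integral_Ioo]
  rw [← setIntegral_eq_integral_of_forall_compl_eq_zero (s := Set.Ioo (-1 : ℝ) 1)]
  · exact setIntegral_congr_fun measurableSet_Ioo fun t ht => sliceVol_ball _ ht
  · intro t ht
    refine sliceVol_eq_zero ?_
    rintro ⟨y, hy⟩
    rw [mem_slice, mem_ball_zero_iff, ← sq_lt_one_iff₀ (norm_nonneg _), norm_ins_sq] at hy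
    refine ht ⟨?_, ?_⟩ <;> nlinarith [norm_nonneg y]

section profile

lemma exists_profile {α β : ℝ} {f τ τ' : ℝ → ℝ} (hf : Integrable f)
    (hf0 : ∀ t, t ∉ Set.Ioo α β → f t = 0) (hτ' : ContinuousOn τ' (Set.Ioo α β))
    (hτ : ∀ t ∈ Set.Ioo α β, τ t ∈ Set.Ioo (-1 : ℝ) 1 ∧ 0 < τ' t ∧ HasDerivAt τ (τ' t) t)
    {t₀ : ℝ} (ht₀ : t₀ ∈ Set.Ioo α β) (hτ0 : τ t₀ = 0) {ε : ℝ} (hε : 0 < ε) :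
    ∃ (σ θ : ℝ → ℝ) (α₁ β₁ : ℝ) (K : Set ℝ), ContDiff ℝ 1 σ ∧ ContDiff ℝ 1 θ ∧
      (∀ t, 0 ≤ θ t ∧ θ t ≤ 1) ∧ Set.Icc α₁ β₁ ⊆ Set.Ioo α β ∧
      (∀ t, t ∉ Set.Icc α₁ β₁ → θ t = 0) ∧ (∀ t, |σ t| < 1) ∧
      (∀ t, HasDerivAt σ (θ t * τ' t) t) ∧ (∀ t ∈ Set.Ioo α β, σ t ^ 2 ≤ τ t ^ 2) ∧
      MeasurableSet K ∧ K ⊆ Set.Ioo α β ∧ (∀ t ∈ K, θ t = 1 ∧ σ t = τ t) ∧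
      ∫ t in Kᶜ, f t ≤ ε := by
  have hfi : ∀ a b, IntervalIntegrable f volume a b := fun a b => hf.intervalIntegrable
  set P : ℝ → ℝ := fun x => ∫ t in α..x, f t with hP
  have hPc : Continuous P := intervalIntegral.continuous_primitive hfi α
  have htot : ∫ t, f t = P β := by
    rw [hP]
    simp only
    rw [intervalIntegral.integral_of_le (ht₀.1.trans ht₀.2).le, integral_Ioc_eq_integral_Ioo]
    exact (setIntegral_eq_integral_of_forall_compl_eq_zero hf0).symm
  obtain ⟨η, hη0, hη1, hη2, hη3⟩ : ∃ η > 0, η < t₀ - α ∧ η < β - t₀ ∧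
      P β - (P (β - η) - P (α + η)) < ε := by
    have hc : Continuous fun η => P β - (P (β - η) - P (α + η)) := by fun_prop
    have h0 : P β - (P (β - 0) - P (α + 0)) < ε := by simpa [hP] using hε
    have h1 : ∀ᶠ η in nhdsWithin (0 : ℝ) (Set.Ioi 0), P β - (P (β - η) - P (α + η)) < ε :=
      (hc.continuousAt.eventually (gt_mem_nhds h0)).filter_mono nhdsWithin_le_nhds
    have h2 : ∀ᶠ η in nhdsWithin (0 : ℝ) (Set.Ioi 0), η < t₀ - α :=
      (gt_mem_nhds (sub_pos.2 ht₀.1)).filter_mono nhdsWithin_le_nhds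
    have h3 : ∀ᶠ η in nhdsWithin (0 : ℝ) (Set.Ioi 0), η < β - t₀ :=
      (gt_mem_nhds (sub_pos.2 ht₀.2)).filter_mono nhdsWithin_le_nhds
    obtain ⟨η, h⟩ := (((h1.and h2).and h3).and self_mem_nhdsWithin).exists
    exact ⟨η, h.2, h.1.1.2, h.1.2, h.1.1.1⟩
  set c : ℝ := (α + β) / 2 with hc
  set ℓ : ℝ := (β - α) / 2 with hℓ
  let θ : ContDiffBump c := ⟨ℓ - η, ℓ - η / 2, by rw [hℓ]; linarith, by linarith⟩
  have hin : θ.rIn = ℓ - η := rfl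
  have hout : θ.rOut = ℓ - η / 2 := rfl
  have hθd : ContDiff ℝ 1 θ := θ.contDiff
  have hθ0 : ∀ t, t ∉ Set.Icc (α + η / 2) (β - η / 2) → θ t = 0 := by
    intro t ht
    refine θ.zero_of_le_dist ?_
    rw [hout, Real.dist_eq, hc, hℓ]
    by_contra h
    push Not at h
    rw [abs_lt] at h
    exact ht ⟨by linarith [h.1], by linarith [h.2]⟩
  have hθ1 : ∀ t ∈ Set.Icc (α + η) (β - η), θ t = 1 := by
    intro t ht
    refine θ.one_of_mem_closedBall ?_
    rw [mem_closedBall, hin, Real.dist_eq, abs_le, hc, hℓ]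
    constructor <;> linarith [ht.1, ht.2]
  have hKJ : Set.Icc (α + η / 2) (β - η / 2) ⊆ Set.Ioo α β := fun t ht =>
    ⟨by linarith [ht.1], by linarith [ht.2]⟩
  have hK0J : Set.Icc (α + η) (β - η) ⊆ Set.Ioo α β := fun t ht =>
    ⟨by linarith [ht.1], by linarith [ht.2]⟩
  have hcont : Continuous fun t => θ t * τ' t := by
    rw [continuous_iff_continuousAt]
    intro t
    by_cases ht : t ∈ Set.Ioo α β
    · exact hθd.continuous.continuousAt.mul (hτ'.continuousAt (isOpen_Ioo.mem_nhds ht))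
    · have h1 : t ∈ (Set.Icc (α + η / 2) (β - η / 2))ᶜ := fun h => ht (hKJ h)
      refine (continuousAt_const (y := (0 : ℝ))).congr ?_
      filter_upwards [isClosed_Icc.isOpen_compl.mem_nhds h1] with s hs
      rw [hθ0 s hs, zero_mul]
  have hnn : ∀ t, 0 ≤ θ t * τ' t := by
    intro t
    by_cases ht : t ∈ Set.Ioo α β
    · exact mul_nonneg θ.nonneg (hτ t ht).2.1.le
    · rw [hθ0 t fun h => ht (hKJ h), zero_mul]
  set σ : ℝ → ℝ := fun t => ∫ s in t₀..t, θ s * τ' s with hσ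
  have hσd : ∀ t, HasDerivAt σ (θ t * τ' t) t := fun t =>
    intervalIntegral.integral_hasDerivAt_right (hcont.intervalIntegrable _ _)
      hcont.aestronglyMeasurable.stronglyMeasurableAtFilter hcont.continuousAt
  have hσ0 : σ t₀ = 0 := by simp [hσ]
  have hσm : Monotone σ := monotone_of_deriv_nonneg (fun t => (hσd t).differentiableAt)
    fun t => by rw [(hσd t).deriv]; exact hnn t
  have hdm : MonotoneOn (fun t => τ t - σ t) (Set.Ioo α β) := by
    have hd : ∀ t ∈ Set.Ioo α β, HasDerivAt (fun t => τ t - σ t) (τ' t - θ t * τ' t) t :=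
      fun t ht => (hτ t ht).2.2.sub (hσd t)
    refine monotoneOn_of_deriv_nonneg (convex_Ioo _ _)
      (fun t ht => (hd t ht).continuousAt.continuousWithinAt)
      (fun t ht => (hd t (interior_subset ht)).differentiableAt.differentiableWithinAt)
      fun t ht => ?_
    rw [(hd t (interior_subset ht)).deriv]
    have := (hτ t (interior_subset ht)).2.1
    nlinarith [θ.le_one (x := t)]
  have hhi : ∀ t ∈ Set.Ioo α β, t₀ ≤ t → 0 ≤ σ t ∧ σ t ≤ τ t := by
    intro t ht h
    have h1 := hσm h
    have h2 := hdm ht₀ ht h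
    simp only [hτ0, hσ0] at h1 h2
    exact ⟨h1, by linarith⟩
  have hlo : ∀ t ∈ Set.Ioo α β, t ≤ t₀ → σ t ≤ 0 ∧ τ t ≤ σ t := by
    intro t ht h
    have h1 := hσm h
    have h2 := hdm ht ht₀ h
    simp only [hτ0, hσ0] at h1 h2
    exact ⟨h1, by linarith⟩
  have hzero : ∀ a b : ℝ, (∀ s ∈ Set.uIoc a b, s ∉ Set.Icc (α + η / 2) (β - η / 2)) →
      σ b = σ a := by
    intro a b h
    have h1 := intervalIntegral.integral_interval_sub_left (hcont.intervalIntegrable t₀ b)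
      (hcont.intervalIntegrable (μ := volume) t₀ a)
    have h2 : ∫ s in a..b, θ s * τ' s = 0 :=
      intervalIntegral.integral_zero_ae (Filter.Eventually.of_forall fun s hs => by
        rw [hθ0 s (h s hs), zero_mul])
    simp only [hσ]; linarith
  have hβ1 : β - η / 2 ∈ Set.Ioo α β := ⟨by linarith, by linarith⟩
  have hα1 : α + η / 2 ∈ Set.Ioo α β := ⟨by linarith, by linarith⟩
  have hσlt : ∀ t, σ t < 1 := by
    intro t
    have h1 : σ t ≤ σ (β - η / 2) := by
      rcases le_total t (β - η / 2) with h | h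
      · exact hσm h
      · refine (hzero _ _ fun s hs hs2 => ?_).le
        rw [Set.uIoc_of_le h] at hs
        exact absurd hs2.2 (not_le.2 hs.1)
    have := (hhi _ hβ1 (by linarith)).2
    linarith [(hτ _ hβ1).1.2]
  have hσgt : ∀ t, -1 < σ t := by
    intro t
    have h1 : σ (α + η / 4) ≤ σ t := by
      rcases le_total (α + η / 4) t with h | h
      · exact hσm h
      · refine (hzero _ _ fun s hs hs2 => ?_).le
        rw [Set.uIoc_of_le h] at hs
        linarith [hs.2, hs2.1]
    have h4 : α + η / 4 ∈ Set.Ioo α β := ⟨by linarith, by linarith⟩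
    have := (hlo _ h4 (by linarith)).2
    linarith [(hτ _ h4).1.1]
  refine ⟨σ, θ, α + η / 2, β - η / 2, Set.Icc (α + η) (β - η), ?_, hθd,
    fun t => ⟨θ.nonneg, θ.le_one⟩, hKJ, hθ0, fun t => abs_lt.2 ⟨hσgt t, hσlt t⟩, hσd, ?_,
    measurableSet_Icc, hK0J, fun t ht => ⟨hθ1 t ht, ?_⟩, ?_⟩
  · rw [contDiff_one_iff_deriv]
    refine ⟨fun t => (hσd t).differentiableAt, ?_⟩
    have : deriv σ = fun t => θ t * τ' t := funext fun t => (hσd t).deriv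
    rw [this]; exact hcont
  · intro t ht
    rcases le_total t₀ t with h | h
    · have := hhi t ht h; nlinarith
    · have := hlo t ht h; nlinarith
  · have hd : ∀ s ∈ Set.Icc (α + η) (β - η), HasDerivWithinAt (fun t => τ t - σ t) 0
        (Set.Icc (α + η) (β - η)) s := by
      intro s hs
      have := ((hτ s (hK0J hs)).2.2.sub (hσd s)).hasDerivWithinAt (s := Set.Icc (α + η) (β - η))
      refine this.congr_deriv ?_
      rw [hθ1 s hs]; ring
    have h1 := (convex_Icc (α + η) (β - η)).norm_image_sub_le_of_norm_hasDerivWithin_le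
      (C := 0) hd (fun s _ => by simp) (x := t₀) (y := t) ⟨by linarith, by linarith⟩ ht
    rw [zero_mul, hτ0, hσ0] at h1
    have := norm_le_zero_iff.1 h1
    linarith
  · have h1 := integral_add_compl (μ := volume) (s := Set.Icc (α + η) (β - η)) measurableSet_Icc hf
    have h2 : ∫ t in Set.Icc (α + η) (β - η), f t = P (β - η) - P (α + η) := by
      rw [integral_Icc_eq_integral_Ioc, ← intervalIntegral.integral_of_le (by linarith)]
      exact (intervalIntegral.integral_interval_sub_left (hfi _ _) (hfi _ _)).symm
    linarith

end profile

lemma amgm_bound {m : ℕ} {p z : ℝ} (hp : 0 < p) (hz : 0 < z) (h : p * z ^ m = 1) :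
    (m + 1 : ℝ) + (Real.sqrt p - 1) ^ 2 ≤ p + m * z := by
  have h1 : Real.log p + m * Real.log z = 0 := by
    rw [← Real.log_pow, ← Real.log_mul hp.ne' (by positivity), h, Real.log_one]
  have h2 := Real.log_le_sub_one_of_pos hz
  have h3 := Real.log_le_sub_one_of_pos (Real.sqrt_pos.2 hp)
  rw [Real.log_sqrt hp.le] at h3
  have h4 := mul_le_mul_of_nonneg_left h2 (Nat.cast_nonneg (α := ℝ) m)
  nlinarith [Real.sq_sqrt hp.le]

lemma cutoff_bound {m θ p : ℝ} (hm : 0 ≤ m) (h0 : 0 ≤ θ) (h1 : θ ≤ 1) (hp : 0 ≤ p) :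
    (m + 1) + (Real.sqrt (θ * p) - 1) ^ 2
      ≤ θ * ((m + 1) + (Real.sqrt p - 1) ^ 2) + (m + 2) := by
  rw [Real.sqrt_mul h0]
  obtain ⟨a, ha, rfl⟩ : ∃ a : ℝ, 0 ≤ a ∧ θ = a ^ 2 :=
    ⟨Real.sqrt θ, Real.sqrt_nonneg _, (Real.sq_sqrt h0).symm⟩
  obtain ⟨b, hb, rfl⟩ : ∃ b : ℝ, 0 ≤ b ∧ p = b ^ 2 :=
    ⟨Real.sqrt p, Real.sqrt_nonneg _, (Real.sq_sqrt hp).symm⟩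
  rw [Real.sqrt_sq ha, Real.sqrt_sq hb]
  have h2 : a ≤ 1 := by nlinarith
  have h3 : 0 ≤ a * b * (1 - a) := mul_nonneg (mul_nonneg ha hb) (by linarith)
  have h4 : 0 ≤ a ^ 2 * m := by positivity
  nlinarith [sq_nonneg a]

lemma exists_direction_field {m : ℕ} (i : Fin (m + 1)) (hiso : IsoIneq m) {E : Set (Euc (m + 1))}
    (hc : Convex ℝ E) (ho : IsOpen E) (hb : IsBounded E) (hv : volume.real E = om (m + 1))
    {ε : ℝ} (hε : 0 < ε) :
    ∃ σ : ℝ → ℝ, ContDiff ℝ 1 σ ∧ (∀ t, |σ t| < 1) ∧ (∀ t, 0 ≤ deriv σ t) ∧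
      |∫ x in E, σ (x i)| ≤ ε ∧
      ∀ (w : ℝ → ℝ) (W : ℝ), ContDiff ℝ 1 w → (∀ x ∈ E, 0 ≤ w (x i) ∧ w (x i) ≤ W) →
        ∃ T : Euc (m + 1) → Euc (m + 1), ContDiff ℝ 1 T ∧ (∀ x, ‖T x‖ ≤ 1) ∧
          (∀ x, T x i = σ (x i)) ∧
          (∫ x in E, (w (x i) * ((m + 1 : ℝ) + (Real.sqrt (deriv σ (x i)) - 1) ^ 2)
            + deriv w (x i) * σ (x i))) - ε * (W + 1)
            ≤ ∫ x in E, diverg (m + 1) (fun x => w (x i) • T x) x := by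
  have hne : E.Nonempty := by
    rw [Set.nonempty_iff_ne_empty]
    rintro rfl
    have := om_pos (m + 1)
    simp at hv; linarith
  obtain ⟨α, β, hαβ, hJ⟩ := exists_Ioo_slice i hc ho hb hne
  set f := sliceVol i E with hf
  have hfi : Integrable f := integrable_sliceVol i ho hb
  have hfp : ∀ t ∈ Set.Ioo α β, 0 < f t := fun t ht => sliceVol_pos i ho hb ((hJ t).2 ht)
  have hf0 : ∀ t, t ∉ Set.Ioo α β → f t = 0 := fun t ht =>
    sliceVol_eq_zero fun h => ht ((hJ t).1 h)
  have hfn : ∀ t, 0 ≤ f t := sliceVol_nonneg i E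
  have hfc : ContinuousOn f (Set.Ioo α β) := fun t ht =>
    (continuousAt_sliceVol i hc ho hb ((hJ t).2 ht)).continuousWithinAt
  have homm := om_pos m
  set g : ℝ → ℝ := fun s => om m * Real.sqrt (1 - s ^ 2) ^ m with hg
  have hsq : ∀ s ∈ Set.Ioo (-1 : ℝ) 1, 0 < Real.sqrt (1 - s ^ 2) := fun s hs =>
    Real.sqrt_pos.2 (by nlinarith [hs.1, hs.2])
  have hmass : ∫ t in α..β, f t = 1 * ∫ s in (-1)..1, g s := by
    rw [one_mul, ← om_succ, ← hv, volume_eq_integral_sliceVol i ho hb,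
      intervalIntegral.integral_of_le hαβ.le, integral_Ioc_eq_integral_Ioo]
    exact setIntegral_eq_integral_of_forall_compl_eq_zero hf0
  obtain ⟨τ, τ', hτc, hτ'c, hτ, ⟨t₀, ht₀, hτ0⟩, hτint⟩ := exists_transport hαβ hfi hfc hfp
    (g := g) (by fun_prop) (fun s hs => mul_pos homm (pow_pos (hsq s hs) _))
    (fun s => by simp [hg]) one_pos hmass
  set ε' := ε / (m + 2) with hε'
  have hm0 : (0 : ℝ) ≤ m := Nat.cast_nonneg m
  have hε'0 : 0 < ε' := by positivity
  have hε'm : (m + 2) * ε' = ε := by rw [hε']; field_simp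
  obtain ⟨σ, θ, α₁, β₁, K, hσC, hθC, hθ01, hsub, hθ0, hσ1, hσd, hστ, hKm, hKJ, hK, hKint⟩ :=
    exists_profile hfi hf0 hτ'c (fun t ht => ⟨(hτ t ht).1, (hτ t ht).2.1, (hτ t ht).2.2.1⟩)
      ht₀ hτ0 hε'0
  have hσ' : ∀ t, deriv σ t = θ t * τ' t := fun t => (hσd t).deriv
  have hσ'0 : ∀ t, 0 ≤ deriv σ t := by
    intro t
    rw [hσ']
    by_cases ht : t ∈ Set.Ioo α β
    · exact mul_nonneg (hθ01 t).1 (hτ t ht).2.1.le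
    · rw [hθ0 t fun h => ht (hsub h), zero_mul]
  have hcoord : Continuous fun x : Euc (m + 1) => x i :=
    (EuclideanSpace.proj (𝕜 := ℝ) i).continuous
  have hintg : ∀ h : ℝ → ℝ, Continuous h → IntegrableOn (fun x : Euc (m + 1) => h (x i)) E :=
    fun h hh => isOpen_bounded_integrableOn hb (hh.comp hcoord)
  have hfint : ∀ h : ℝ → ℝ, Continuous h → Integrable fun t => h t * f t := fun h hh =>
    integrable_mul_sliceVol i ho.measurableSet (hintg h hh)
  refine ⟨σ, hσC, hσ1, hσ'0, ?_, ?_⟩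
  · rw [setIntegral_coord i ho.measurableSet (hintg σ hσC.continuous)]
    rw [intervalIntegral.integral_of_le hαβ.le, integral_Ioc_eq_integral_Ioo] at hτint
    rw [← setIntegral_eq_integral_of_forall_compl_eq_zero (s := Set.Ioo α β)
      (fun t ht => by rw [← hf, hf0 t ht, mul_zero])]
    have h1 : ∫ t in Set.Ioo α β, (σ t - τ t) * f t = ∫ t in Set.Ioo α β, σ t * f t := by
      simp_rw [sub_mul]
      rw [integral_sub (hfint σ hσC.continuous).integrableOn (hfint τ hτc).integrableOn, hτint,
        sub_zero]
    rw [← hf, ← h1, ← Real.norm_eq_abs]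
    have h2 : Integrable (Kᶜ.indicator fun t => 2 * f t) := (hfi.const_mul 2).indicator hKm.compl
    calc _ ≤ ∫ t in Set.Ioo α β, Kᶜ.indicator (fun t => 2 * f t) t := by
          refine norm_integral_le_of_norm_le h2.integrableOn ?_
          filter_upwards [ae_restrict_mem measurableSet_Ioo] with t ht
          by_cases htK : t ∈ K
          · rw [(hK t htK).2]; simp [htK]
          · rw [Set.indicator_of_mem (show t ∈ Kᶜ from htK), norm_mul, Real.norm_of_nonneg (hfn t)]
            refine mul_le_mul_of_nonneg_right ?_ (hfn t)
            have h3 := abs_lt.1 (hσ1 t)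
            have h4 := (hτ t ht).1
            rw [Real.norm_eq_abs, abs_le]
            constructor <;> linarith [h4.1, h4.2]
      _ ≤ ∫ t, Kᶜ.indicator (fun t => 2 * f t) t := setIntegral_le_integral h2
          (Filter.Eventually.of_forall fun t =>
            Set.indicator_nonneg (fun s _ => mul_nonneg zero_le_two (hfn s)) t)
      _ = 2 * ∫ t in Kᶜ, f t := by rw [integral_indicator hKm.compl, integral_const_mul]
      _ ≤ ε := by nlinarith
  · intro w W hw hwW
    have hwJ : ∀ t ∈ Set.Ioo α β, 0 ≤ w t ∧ w t ≤ W := by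
      intro t ht
      obtain ⟨y, hy⟩ := (hJ t).2 ht
      simpa using hwW _ hy
    set r : ℝ → ℝ := fun t => (f t / om m) ^ ((m : ℝ)⁻¹) with hr
    have hr0 : ∀ t ∈ Set.Ioo α β, 0 < r t := fun t ht =>
      Real.rpow_pos_of_pos (div_pos (hfp t ht) homm) _
    have hfr : ∀ t ∈ Set.Ioo α β, f t = om m * r t ^ m := by
      intro t ht
      rcases Nat.eq_zero_or_pos m with h0 | h0
      · subst h0
        have : slice i E t = ball 0 1 := by
          obtain ⟨y, hy⟩ := (hJ t).2 ht
          ext z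
          rw [Subsingleton.elim z 0]
          rw [Subsingleton.elim y 0] at hy
          simp [hy]
        simp [hf, sliceVol, this, om]
      · rw [hr]
        simp only
        rw [Real.rpow_inv_natCast_pow (div_pos (hfp t ht) homm).le h0.ne']
        field_simp
    have hrc : ContinuousOn r (Set.Ioo α β) :=
      (hfc.div_const _).rpow_const fun t ht => Or.inl (div_pos (hfp t ht) homm).ne'
    set q : ℝ → ℝ := fun t => m * f t / r t with hq
    have hqc : ContinuousOn q (Set.Ioo α β) :=
      (continuousOn_const.mul hfc).div hrc fun t ht => (hr0 t ht).ne'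
    have hslice : ∀ t ∈ Set.Ioo α β, ∀ δ > 0, ∃ φ : Euc m → Euc m, IsAdm φ ∧
        q t - δ ≤ ∫ y in slice i E t, diverg m φ y := by
      intro t ht δ hδ
      obtain ⟨R, hR⟩ := hb.subset_ball 0
      exact hiso.scaled (convex_slice i hc t) (isOpen_slice i ho t)
        (isBounded_ball.subset (slice_subset_ball i hR t)) (hr0 t ht) (hfr t ht) hδ
    have hσsq : ∀ t, 0 < 1 - σ t ^ 2 := fun t => by
      have := (sq_lt_one_iff_abs_lt_one (σ t)).2 (hσ1 t); linarith
    set ρ : ℝ → ℝ := fun t => Real.sqrt (1 - σ t ^ 2) * θ t with hρ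
    have hρC : ContDiff ℝ 1 ρ :=
      ((contDiff_const.sub (hσC.pow 2)).sqrt fun t => (hσsq t).ne').mul hθC
    have hρ0 : ∀ t, 0 ≤ ρ t := fun t => mul_nonneg (Real.sqrt_nonneg _) (hθ01 t).1
    obtain ⟨T, hTC, hT1, hTi, hTle⟩ := exists_sliced_field i hc ho hb hJ hqc hslice hσC hρC hw hρ0
      (fun t => by
        have h1 := Real.sq_sqrt (hσsq t).le
        have h2 : θ t ^ 2 ≤ 1 := pow_le_one₀ (hθ01 t).1 (hθ01 t).2
        have h3 : ρ t ^ 2 = (1 - σ t ^ 2) * θ t ^ 2 := by rw [hρ]; simp only; rw [mul_pow, h1]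
        nlinarith [hσsq t])
      hsub (fun t ht => by rw [hρ]; simp only; rw [hθ0 t ht, mul_zero])
      (fun t ht => (hwJ t ht).1) hε
    refine ⟨T, hTC, hT1, hTi, le_trans ?_ hTle⟩
    have hσ'c : Continuous (deriv σ) := hσC.continuous_deriv (by norm_num)
    have hw'c : Continuous (deriv w) := hw.continuous_deriv (by norm_num)
    set H : ℝ → ℝ := fun t => w t * ((m + 1 : ℝ) + (Real.sqrt (deriv σ t) - 1) ^ 2)
            + deriv w t * σ t with hH
    have hHc : Continuous H := by
      have := hw.continuous; have := hσC.continuous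
      rw [hH]; fun_prop
    have hIH := setIntegral_coord i ho.measurableSet (hintg H hHc)
    rw [show (∫ x in E, (w (x i) * ((m + 1 : ℝ) + (Real.sqrt (deriv σ (x i)) - 1) ^ 2)
            + deriv w (x i) * σ (x i))) = ∫ x in E, H (x i) from rfl, hIH]
    have hi1 : Integrable fun t => deriv (fun t => w t * σ t) t * f t :=
      hfint _ ((hw.mul hσC).continuous_deriv (by norm_num))
    have hi2 : Integrable ((Set.Icc α₁ β₁).indicator fun t => w t * ρ t * q t) :=
      (((hw.continuous.mul hρC.continuous).continuousOn.mul (hqc.mono hsub)).integrableOn_compact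
        isCompact_Icc).integrable_indicator measurableSet_Icc
    have hi3 : Integrable (Kᶜ.indicator fun t => (m + 2) * W * f t) :=
      (hfi.const_mul _).indicator hKm.compl
    have hmain : ∫ t, (H t * f t - Kᶜ.indicator (fun t => (m + 2) * W * f t) t)
        ≤ ∫ t, (deriv (fun t => w t * σ t) t * f t +
          (Set.Icc α₁ β₁).indicator (fun t => w t * ρ t * q t) t) := by
      refine integral_mono ((hfint H hHc).sub hi3) (hi1.add hi2) fun t => ?_
      simp only
      by_cases ht : t ∈ Set.Ioo α β
      · have hd : deriv (fun t => w t * σ t) t = deriv w t * σ t + w t * (θ t * τ' t) := by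
          rw [← hσ']
          exact ((hw.differentiable (by norm_num) t).hasDerivAt.mul
            (hσd t).differentiableAt.hasDerivAt).deriv
        have hind : (Set.Icc α₁ β₁).indicator (fun t => w t * ρ t * q t) t = w t * ρ t * q t := by
          by_cases h : t ∈ Set.Icc α₁ β₁
          · rw [Set.indicator_of_mem h]
          · rw [Set.indicator_of_notMem h, hρ]; simp only; rw [hθ0 t h]; ring
        rw [hd, hind]
        obtain ⟨hτ1, hτ'0, -, hgτ⟩ := hτ t ht
        have hr1 := hr0 t ht
        have hs1 := hsq _ hτ1
        have hsσ : Real.sqrt (1 - τ t ^ 2) ≤ Real.sqrt (1 - σ t ^ 2) :=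
          Real.sqrt_le_sqrt (by linarith [hστ t ht])
        obtain ⟨hw0, hw1⟩ := hwJ t ht
        have hf1 := hfp t ht
        have hz : τ' t * (Real.sqrt (1 - τ t ^ 2) / r t) ^ m = 1 := by
          rw [one_mul, hfr t ht, hg] at hgτ
          simp only at hgτ
          have h5 : Real.sqrt (1 - τ t ^ 2) ^ m * τ' t = r t ^ m := by
            have := homm.ne'
            exact mul_left_cancel₀ this (by linarith)
          rw [div_pow]
          have : r t ^ m ≠ 0 := by positivity
          field_simp
          linarith
        have ham := amgm_bound hτ'0 (div_pos hs1 hr1) hz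
        have hρq : θ t * (m * (Real.sqrt (1 - τ t ^ 2) / r t)) * f t ≤ ρ t * q t := by
          have : ρ t * q t = Real.sqrt (1 - σ t ^ 2) * (θ t * (m * (1 / r t)) * f t) := by
            rw [hρ, hq]; simp only; ring
          rw [this]
          have h6 : 0 ≤ θ t * (m * (1 / r t)) * f t := by
            have := (hθ01 t).1; positivity
          calc _ = Real.sqrt (1 - τ t ^ 2) * (θ t * (m * (1 / r t)) * f t) := by ring
            _ ≤ _ := mul_le_mul_of_nonneg_right hsσ h6
        have hkey : w t * (((m + 1 : ℝ) + (Real.sqrt (deriv σ t) - 1) ^ 2) * f t)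
            - Kᶜ.indicator (fun t => (m + 2) * W * f t) t
            ≤ w t * (θ t * ((m + 1 : ℝ) + (Real.sqrt (τ' t) - 1) ^ 2) * f t) := by
          rw [hσ']
          by_cases htK : t ∈ K
          · rw [(hK t htK).1]; simp [htK]
          · rw [Set.indicator_of_mem (show t ∈ Kᶜ from htK)]
            obtain ⟨h7, h8⟩ := hθ01 t
            have h9 : ((m + 1 : ℝ) + (Real.sqrt (θ t * τ' t) - 1) ^ 2)
                ≤ θ t * ((m + 1 : ℝ) + (Real.sqrt (τ' t) - 1) ^ 2) + (m + 2) := cutoff_bound hm0 h7 h8 hτ'0.le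
            have h10 := mul_le_mul_of_nonneg_left (mul_le_mul_of_nonneg_right h9 hf1.le) hw0
            have h11 : w t * ((m + 2) * f t) ≤ W * ((m + 2) * f t) :=
              mul_le_mul_of_nonneg_right hw1 (by positivity)
            linarith
        have hkey2 : w t * (θ t * ((m + 1 : ℝ) + (Real.sqrt (τ' t) - 1) ^ 2) * f t)
            ≤ w t * (θ t * τ' t * f t + ρ t * q t) := by
          refine mul_le_mul_of_nonneg_left ?_ hw0
          have := mul_le_mul_of_nonneg_left ham (mul_nonneg (hθ01 t).1 hf1.le)
          linarith
        simp only [hH]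
        linarith
      · have h1 : t ∉ Set.Icc α₁ β₁ := fun h => ht (hsub h)
        rw [hf0 t ht, Set.indicator_of_notMem h1]
        by_cases htK : t ∈ K
        · simp [htK]
        · rw [Set.indicator_of_mem (show t ∈ Kᶜ from htK), hf0 t ht]; simp
    rw [integral_sub (hfint H hHc) hi3, integral_add hi1 hi2, integral_indicator measurableSet_Icc,
      integral_indicator hKm.compl, integral_const_mul] at hmain
    have hW0 : 0 ≤ W := (hwJ t₀ ht₀).1.trans (hwJ t₀ ht₀).2
    have : (m + 2) * W * ∫ t in Kᶜ, f t ≤ (m + 2) * W * ε' :=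
      mul_le_mul_of_nonneg_left hKint (by positivity)
    rw [← hf]
    have h20 : (m + 2) * W * ε' = ε * W := by rw [← hε'm]; ring
    linarith

lemma exists_cutoff_field {n : ℕ} {E : Set (Euc n)} (ho : IsOpen E) {R M : ℝ} (hR : 0 < R)
    (hM : 0 < M) (hER : E ⊆ ball 0 R) {Φ : Euc n → Euc n} (hΦ : ContDiff ℝ 1 Φ)
    (hb : ∀ x, ‖x‖ ≤ R + 1 → ‖Φ x‖ ≤ M) :
    ∃ φ : Euc n → Euc n, IsAdm φ ∧ ∫ x in E, diverg n φ x = M⁻¹ * ∫ x in E, diverg n Φ x := by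
  let χ : ContDiffBump (0 : Euc n) := ⟨R, R + 1, hR, by linarith⟩
  refine ⟨fun x => M⁻¹ • (χ x • Φ x), ⟨?_, ?_, ?_⟩, ?_⟩
  · exact (χ.contDiff.smul hΦ).const_smul _
  · have h1 : HasCompactSupport fun x => χ x • Φ x := χ.hasCompactSupport.smul_right
    exact HasCompactSupport.smul_left (f := fun _ => M⁻¹) h1
  · intro x
    rw [norm_smul, norm_smul, Real.norm_of_nonneg (inv_nonneg.2 hM.le),
      Real.norm_of_nonneg χ.nonneg, inv_mul_le_iff₀ hM, mul_one]
    by_cases hx : ‖x‖ ≤ R + 1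
    · calc χ x * ‖Φ x‖ ≤ 1 * M := mul_le_mul χ.le_one (hb x hx) (norm_nonneg _) zero_le_one
        _ = M := one_mul M
    · rw [χ.zero_of_le_dist (by rw [dist_zero_right]; exact (not_le.1 hx).le), zero_mul]
      exact hM.le
  · rw [← integral_const_mul]
    refine setIntegral_congr_fun ho.measurableSet fun x hx => ?_
    have h1 : (fun x => M⁻¹ • (χ x • Φ x)) =ᶠ[nhds x] fun x => M⁻¹ • Φ x := by
      filter_upwards [isOpen_ball.mem_nhds (hER hx)] with y hy
      rw [χ.one_of_mem_closedBall (ball_subset_closedBall hy), one_smul]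
    rw [diverg_congr h1, diverg_const_smul (hΦ.differentiable (by norm_num) x)]

lemma exists_pos_subset_ball {n : ℕ} {E : Set (Euc n)} (hb : IsBounded E) :
    ∃ R > 0, E ⊆ ball 0 R := by
  obtain ⟨R, hR⟩ := hb.subset_ball 0
  exact ⟨max R 1, by positivity, hR.trans (ball_subset_ball (le_max_left _ _))⟩

lemma isoIneq_zero : IsoIneq 0 := by
  intro A _ _ _ _ ε hε
  refine ⟨0, ⟨contDiff_const, HasCompactSupport.zero, fun x => by simp⟩, ?_⟩
  simp [diverg, hε.le]

lemma IsoIneq.succ {m : ℕ} (h : IsoIneq m) : IsoIneq (m + 1) := by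
  intro A hc ho hb hv ε hε
  obtain ⟨σ, hσC, -, -, -, hB⟩ := exists_direction_field 0 h hc ho hb hv (half_pos hε)
  obtain ⟨T, hTC, hT1, -, hle⟩ := hB (fun _ => 1) 1 contDiff_const (fun _ _ => by norm_num)
  obtain ⟨R, hR, hAR⟩ := exists_pos_subset_ball hb
  obtain ⟨φ, hφ, heq⟩ := exists_cutoff_field ho hR one_pos hAR hTC fun x _ => hT1 x
  refine ⟨φ, hφ, ?_⟩
  simp only [one_smul, deriv_const, zero_mul, add_zero, one_mul] at hle
  rw [heq, inv_one, one_mul]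
  have hσ' : Continuous (deriv σ) := hσC.continuous_deriv (by norm_num)
  have h1 : ∫ x in A, (m + 1 : ℝ) ≤
      ∫ x in A, ((m + 1 : ℝ) + (Real.sqrt (deriv σ (x 0)) - 1) ^ 2) := by
    refine setIntegral_mono (isOpen_bounded_integrableOn hb continuous_const)
      (isOpen_bounded_integrableOn hb ?_) fun x => ?_
    · fun_prop
    · simp only; nlinarith [sq_nonneg (Real.sqrt (deriv σ (x 0)) - 1)]
  rw [setIntegral_const, smul_eq_mul, hv] at h1
  push_cast
  linarith

lemma isoIneq (n : ℕ) : IsoIneq n := by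
  induction n with
  | zero => exact isoIneq_zero
  | succ m ih => exact ih.succ

section oneDim
variable {m : ℕ} (i : Fin (m + 1)) {E : Set (Euc (m + 1))}

lemma sliceVol_cone (hc : Convex ℝ E) (ho : IsOpen E) (hb : IsBounded E) {s t a : ℝ}
    (ht : (slice i E t).Nonempty) (ha : 0 < a) (ha1 : a ≤ 1) :
    a ^ m * sliceVol i E s ≤ sliceVol i E (a * s + (1 - a) * t) := by
  obtain ⟨z, hz⟩ := ht
  have hsub : slice i E s ⊆ affPre a ((1 - a) • z) (slice i E (a * s + (1 - a) * t)) := by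
    intro y hy
    have := hc hy hz ha.le (sub_nonneg.2 ha1) (by ring)
    rw [ins_combo, add_comm (a • y)] at this
    exact this
  obtain ⟨R, hR⟩ := hb.subset_ball 0
  have hbd : ∀ u, IsBounded (slice i E u) := fun u => isBounded_ball.subset (slice_subset_ball i hR u)
  have h1 := measureReal_mono (μ := volume) hsub (isBounded_affPre ha (hbd _)).measure_lt_top.ne
  rw [volume_affPre ha (isOpen_slice i ho _).measurableSet] at h1
  have h2 : 0 < a ^ m := by positivity
  have h3 := mul_le_mul_of_nonneg_left h1 h2.le
  rwa [mul_inv_cancel_left₀ h2.ne'] at h3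

lemma sliceVol_between (hc : Convex ℝ E) (ho : IsOpen E) (hb : IsBounded E) {s t u : ℝ}
    (hs : (slice i E s).Nonempty) (ht : (slice i E t).Nonempty) (hsu : s ≤ u) (hut : u ≤ t) :
    (1 / 2) ^ m * min (sliceVol i E s) (sliceVol i E t) ≤ sliceVol i E u := by
  by_cases h : u ≤ (s + t) / 2
  swap
  · rcases hsu.eq_or_lt with rfl | hsu
    · have h1 : ((1 : ℝ) / 2) ^ m ≤ 1 := pow_le_one₀ (by norm_num) (by norm_num)
      calc _ ≤ 1 * min (sliceVol i E s) (sliceVol i E t) := mul_le_mul_of_nonneg_right h1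
            (le_min (sliceVol_nonneg i E _) (sliceVol_nonneg i E _))
        _ ≤ _ := by rw [one_mul]; exact min_le_left _ _
    · push Not at h
      have hst : 0 < t - s := by linarith
      have h2 := sliceVol_cone i hc ho hb (s := t) hs (a := (u - s) / (t - s))
        (div_pos (by linarith) hst) ((div_le_one hst).2 (by linarith))
      rw [show (u - s) / (t - s) * t + (1 - (u - s) / (t - s)) * s = u by field_simp; ring] at h2
      refine le_trans (mul_le_mul ?_ (min_le_right _ _) (le_min (sliceVol_nonneg i E _)
        (sliceVol_nonneg i E _)) (by positivity)) h2
      refine pow_le_pow_left₀ (by norm_num) ?_ _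
      rw [div_le_div_iff₀ (by norm_num) hst]; linarith
  · rcases hut.eq_or_lt with rfl | hut
    · have h1 : ((1 : ℝ) / 2) ^ m ≤ 1 := pow_le_one₀ (by norm_num) (by norm_num)
      calc _ ≤ 1 * min (sliceVol i E s) (sliceVol i E u) := mul_le_mul_of_nonneg_right h1
            (le_min (sliceVol_nonneg i E _) (sliceVol_nonneg i E _))
        _ ≤ _ := by rw [one_mul]; exact min_le_right _ _
    · have hst : 0 < t - s := by linarith
      have h2 := sliceVol_cone i hc ho hb (s := s) ht (a := (t - u) / (t - s))
        (div_pos (by linarith) hst) ((div_le_one hst).2 (by linarith))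
      rw [show (t - u) / (t - s) * s + (1 - (t - u) / (t - s)) * t = u by field_simp; ring] at h2
      refine le_trans (mul_le_mul ?_ (min_le_left _ _) (le_min (sliceVol_nonneg i E _)
        (sliceVol_nonneg i E _)) (by positivity)) h2
      refine pow_le_pow_left₀ (by norm_num) ?_ _
      rw [div_le_div_iff₀ (by norm_num) hst]; linarith

lemma exists_almost_max (ho : IsOpen E) (hb : IsBounded E) (hne : E.Nonempty) :
    ∃ t₀, (slice i E t₀).Nonempty ∧ ∀ t, sliceVol i E t ≤ 2 * sliceVol i E t₀ := by
  obtain ⟨R, hR⟩ := hb.subset_ball 0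
  have hbdd : BddAbove (Set.range (sliceVol i E)) := by
    refine ⟨volume.real (ball (0 : Euc m) R), ?_⟩
    rintro _ ⟨t, rfl⟩
    exact measureReal_mono (slice_subset_ball i hR t) measure_ball_lt_top.ne
  obtain ⟨x, hx⟩ := hne
  have hx' : (slice i E (x i)).Nonempty := ⟨dropCoord i x, by rwa [mem_slice, ins_dropCoord]⟩
  have hpos := sliceVol_pos i ho hb hx'
  set S := sSup (Set.range (sliceVol i E)) with hS
  have hSpos : 0 < S := hpos.trans_le (le_csSup hbdd ⟨_, rfl⟩)
  obtain ⟨_, ⟨t₀, rfl⟩, ht₀⟩ := exists_lt_of_lt_csSup (Set.range_nonempty (sliceVol i E))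
    (show S / 2 < sSup _ from half_lt_self hSpos)
  refine ⟨t₀, ?_, fun t => ?_⟩
  · by_contra h
    rw [sliceVol_eq_zero h] at ht₀; linarith
  · have := le_csSup hbdd ⟨t, rfl⟩
    linarith

end oneDim

section estimates
variable {m : ℕ} (i : Fin (m + 1)) {E : Set (Euc (m + 1))}

lemma profile_estimate (hc : Convex ℝ E) (ho : IsOpen E) (hb : IsBounded E)
    (hv : volume.real E = om (m + 1)) (hbar : ∫ x in E, x i = 0) {σ : ℝ → ℝ}
    (hσC : ContDiff ℝ 1 σ) (hσ1 : ∀ t, |σ t| < 1) (hσ' : ∀ t, 0 ≤ deriv σ t) {ε : ℝ}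
    (hσε : |∫ x in E, σ (x i)| ≤ ε) {Q : ℝ}
    (hQ : ∫ x in E, |deriv σ (x i) - 1| ≤ Q) (hQ1 : Q ≤ om (m + 1) / 2) :
    (∀ x ∈ E, |x i| ≤ 2 ^ (m + 4)) ∧
      ∫ x in E, |σ (x i) - x i| ≤ ε + 2 ^ (2 * m + 6) * Q := by
  have hom := om_pos (m + 1)
  have hne : E.Nonempty := by
    rw [Set.nonempty_iff_ne_empty]
    rintro rfl
    simp at hv; linarith
  obtain ⟨α, β, hαβ, hJ⟩ := exists_Ioo_slice i hc ho hb hne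
  obtain ⟨t₀, ht₀, hmax⟩ := exists_almost_max i ho hb hne
  have ht₀J := (hJ t₀).1 ht₀
  set f := sliceVol i E with hf
  have hfi : Integrable f := integrable_sliceVol i ho hb
  have hfp : ∀ t ∈ Set.Ioo α β, 0 < f t := fun t ht => sliceVol_pos i ho hb ((hJ t).2 ht)
  have hf0 : ∀ t, t ∉ Set.Ioo α β → f t = 0 := fun t ht =>
    sliceVol_eq_zero fun h => ht ((hJ t).1 h)
  have hfn : ∀ t, 0 ≤ f t := sliceVol_nonneg i E
  have hmass : ∫ t, f t = om (m + 1) := by rw [← hv, volume_eq_integral_sliceVol i ho hb]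
  have hcoord : Continuous fun x : Euc (m + 1) => x i :=
    (EuclideanSpace.proj (𝕜 := ℝ) i).continuous
  have hintg : ∀ h : ℝ → ℝ, Continuous h → IntegrableOn (fun x : Euc (m + 1) => h (x i)) E :=
    fun h hh => isOpen_bounded_integrableOn hb (hh.comp hcoord)
  have hfint : ∀ h : ℝ → ℝ, Continuous h → Integrable fun t => h t * f t := fun h hh =>
    integrable_mul_sliceVol i ho.measurableSet (hintg h hh)
  have hconv : ∀ h : ℝ → ℝ, Continuous h → ∫ x in E, h (x i) = ∫ t, h t * f t := fun h hh =>
    setIntegral_coord i ho.measurableSet (hintg h hh)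
  have hσ'c : Continuous (deriv σ) := hσC.continuous_deriv (by norm_num)
  set ℓ := β - α with hℓ
  have hℓ0 : 0 < ℓ := sub_pos.2 hαβ
  -- a lower bound for the slices in the middle half
  have hft₀ : f t₀ * ℓ ≤ 2 ^ (m + 1) * om (m + 1) := by
    have h1 : ∫ t in Set.Ioo ((t₀ + α) / 2) ((t₀ + β) / 2), (1 / 2 : ℝ) ^ m * f t₀ ≤
        ∫ t in Set.Ioo ((t₀ + α) / 2) ((t₀ + β) / 2), f t := by
      refine setIntegral_mono_on (integrableOn_const (by simp)) hfi.integrableOn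
        measurableSet_Ioo fun u hu => ?_
      have hu2 : (slice i E (2 * u - t₀)).Nonempty :=
        (hJ _).2 ⟨by linarith [hu.1], by linarith [hu.2]⟩
      have := sliceVol_cone i hc ho hb (s := t₀) hu2 (a := 1 / 2) (by norm_num) (by norm_num)
      rwa [show (1 : ℝ) / 2 * t₀ + (1 - 1 / 2) * (2 * u - t₀) = u by ring] at this
    have h2 : ∫ t in Set.Ioo ((t₀ + α) / 2) ((t₀ + β) / 2), f t ≤ om (m + 1) := by
      rw [← hmass]
      exact setIntegral_le_integral hfi (Filter.Eventually.of_forall hfn)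
    rw [setIntegral_const, smul_eq_mul, Real.volume_real_Ioo_of_le (by linarith)] at h1
    have h3 : ((1 : ℝ) / 2) ^ m * 2 ^ m = 1 := by rw [← mul_pow]; norm_num
    have h4 : (ℓ / 2 * ((1 / 2 : ℝ) ^ m * f t₀)) * 2 ^ (m + 1) ≤ om (m + 1) * 2 ^ (m + 1) := by
      refine mul_le_mul_of_nonneg_right ?_ (by positivity)
      calc _ = ((t₀ + β) / 2 - (t₀ + α) / 2) * ((1 / 2 : ℝ) ^ m * f t₀) := by rw [hℓ]; ring
        _ ≤ _ := h1.trans h2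
    calc f t₀ * ℓ = (ℓ / 2 * ((1 / 2 : ℝ) ^ m * f t₀)) * 2 ^ (m + 1) := by
          rw [pow_succ]; linear_combination (-(f t₀ * ℓ)) * h3
      _ ≤ _ := by linarith
  have hσ'int : ∫ t, deriv σ t * f t ≤ 2 * f t₀ * 2 := by
    have h1 : ∫ t, deriv σ t * f t = ∫ t in Set.Ioo α β, deriv σ t * f t :=
      (setIntegral_eq_integral_of_forall_compl_eq_zero fun t ht => by rw [hf0 t ht, mul_zero]).symm
    have h2 : ∫ t in Set.Ioo α β, deriv σ t = σ β - σ α := by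
      rw [← integral_Ioc_eq_integral_Ioo, ← intervalIntegral.integral_of_le hαβ.le]
      exact intervalIntegral.integral_deriv_eq_sub
        (fun t _ => hσC.differentiable (by norm_num) t) (hσ'c.intervalIntegrable _ _)
    have hI : IntegrableOn (deriv σ) (Set.Ioo α β) :=
      (hσ'c.continuousOn.integrableOn_compact isCompact_Icc).mono_set Set.Ioo_subset_Icc_self
    have h3 : ∫ t in Set.Ioo α β, deriv σ t * f t ≤ ∫ t in Set.Ioo α β, deriv σ t * (2 * f t₀) :=
      setIntegral_mono (hfint _ hσ'c).integrableOn (hI.mul_const _)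
        fun t => mul_le_mul_of_nonneg_left (hmax t) (hσ' t)
    rw [integral_mul_const, h2] at h3
    have h4 := abs_lt.1 (hσ1 α)
    have h5 := abs_lt.1 (hσ1 β)
    have h6 : (σ β - σ α) * (2 * f t₀) ≤ 2 * (2 * f t₀) :=
      mul_le_mul_of_nonneg_right (by linarith) (by linarith [hfn t₀])
    linarith
  have hQabs : ∫ t, |deriv σ t - 1| * f t ≤ Q := by
    rw [← hconv (fun t => |deriv σ t - 1|) (by fun_prop)]; exact hQ
  have hℓle : ℓ ≤ 2 ^ (m + 4) := by
    have h1 : ∫ t, f t ≤ ∫ t, (deriv σ t * f t + |deriv σ t - 1| * f t) := by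
      refine integral_mono hfi ((hfint _ hσ'c).add
        (hfint (fun t => |deriv σ t - 1|) (by fun_prop))) fun t => ?_
      simp only
      nlinarith [hfn t, neg_abs_le (deriv σ t - 1)]
    rw [integral_add (hfint _ hσ'c) (hfint (fun t => |deriv σ t - 1|) (by fun_prop)), hmass] at h1
    have h2 : om (m + 1) ≤ 8 * f t₀ := by linarith
    have h3 : om (m + 1) * ℓ ≤ om (m + 1) * 2 ^ (m + 4) := by
      calc om (m + 1) * ℓ ≤ 8 * f t₀ * ℓ := mul_le_mul_of_nonneg_right h2 hℓ0.le
        _ ≤ 8 * (2 ^ (m + 1) * om (m + 1)) := by linarith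
        _ = om (m + 1) * 2 ^ (m + 4) := by ring
    exact le_of_mul_le_mul_left h3 hom
  have hbar' : ∫ t, t * f t = 0 := by rw [← hconv (fun t => t) continuous_id]; exact hbar
  have hpos : ∀ h : ℝ → ℝ, Continuous h → (∀ t ∈ Set.Ioo α β, 0 < h t) → 0 < ∫ t, h t * f t := by
    intro h hh hp
    rw [← setIntegral_eq_integral_of_forall_compl_eq_zero (s := Set.Ioo α β)
      (fun t ht => by rw [hf0 t ht, mul_zero]), ← integral_Ioc_eq_integral_Ioo,
      ← intervalIntegral.integral_of_le hαβ.le]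
    exact intervalIntegral.intervalIntegral_pos_of_pos_on (hfint h hh).intervalIntegrable
      (fun t ht => mul_pos (hp t ht) (hfp t ht)) hαβ
  have hα0 : α < 0 := by
    by_contra h
    push Not at h
    linarith [hpos (fun t => t) continuous_id fun t ht => h.trans_lt ht.1]
  have hβ0 : 0 < β := by
    by_contra h
    push Not at h
    have h1 := hpos (fun t => -t) continuous_neg fun t ht => by linarith [ht.2]
    simp only [neg_mul, integral_neg] at h1
    linarith
  refine ⟨fun x hx => ?_, ?_⟩
  · have h1 := (hJ (x i)).1 ⟨dropCoord i x, by rwa [mem_slice, ins_dropCoord]⟩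
    rw [abs_le]
    constructor <;> linarith [h1.1, h1.2]
  set g : ℝ → ℝ := fun t => σ t - t with hg
  have hgc : Continuous g := hσC.continuous.sub continuous_id
  have hgd : ∀ t, HasDerivAt g (deriv σ t - 1) t := fun t =>
    (hσC.differentiable (by norm_num) t).hasDerivAt.sub (hasDerivAt_id t)
  have hg'c : Continuous fun t => deriv σ t - 1 := hσ'c.sub continuous_const
  have hQ0 : 0 ≤ Q := (integral_nonneg fun t => mul_nonneg (abs_nonneg _) (hfn t)).trans hQabs
  -- pointwise oscillation
  have hosc : ∀ t ∈ Set.Ioo α β, |g t - g t₀| * f t ≤ 2 ^ (m + 1) * Q := by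
    intro t ht
    have hftc : g t - g t₀ = ∫ u in t₀..t, (deriv σ u - 1) :=
      (intervalIntegral.integral_eq_sub_of_hasDerivAt (fun u _ => hgd u)
        (hg'c.intervalIntegrable _ _)).symm
    have hlow : ∀ u ∈ Set.uIoc t₀ t, f t ≤ 2 ^ (m + 1) * f u := by
      intro u hu
      have h3 : ((1 : ℝ) / 2) ^ m * 2 ^ m = 1 := by rw [← mul_pow]; norm_num
      have h4 : (1 / 2) ^ m * (f t / 2) ≤ f u := by
        have hmin : f t / 2 ≤ f t := by linarith [hfn t]
        have hmin2 : f t / 2 ≤ f t₀ := by linarith [hmax t]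
        rcases le_total t₀ t with h | h
        · rw [Set.uIoc_of_le h] at hu
          refine le_trans ?_ (sliceVol_between i hc ho hb ht₀ ((hJ t).2 ht) hu.1.le hu.2)
          exact mul_le_mul_of_nonneg_left (le_min hmin2 hmin) (by positivity)
        · rw [Set.uIoc_of_ge h] at hu
          refine le_trans ?_ (sliceVol_between i hc ho hb ((hJ t).2 ht) ht₀ hu.1.le hu.2)
          exact mul_le_mul_of_nonneg_left (le_min hmin hmin2) (by positivity)
      calc f t = 2 ^ (m + 1) * ((1 / 2) ^ m * (f t / 2)) := by
            rw [pow_succ]; linear_combination (-(f t)) * h3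
        _ ≤ _ := mul_le_mul_of_nonneg_left h4 (by positivity)
    have h5 : |g t - g t₀| ≤ ∫ u in Set.uIoc t₀ t, |deriv σ u - 1| := by
      rw [hftc]
      have := intervalIntegral.norm_integral_le_integral_norm_uIoc (a := t₀) (b := t)
        (f := fun u => deriv σ u - 1) (μ := volume)
      simpa only [Real.norm_eq_abs] using this
    have hmeas : MeasurableSet (Set.uIoc t₀ t) := measurableSet_uIoc
    have hiu : IntegrableOn (fun u => |deriv σ u - 1|) (Set.uIoc t₀ t) :=
      (hg'c.abs.intervalIntegrable t₀ t).def'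
    calc |g t - g t₀| * f t ≤ (∫ u in Set.uIoc t₀ t, |deriv σ u - 1|) * f t :=
          mul_le_mul_of_nonneg_right h5 (hfn t)
      _ = ∫ u in Set.uIoc t₀ t, |deriv σ u - 1| * f t := by rw [integral_mul_const]
      _ ≤ ∫ u in Set.uIoc t₀ t, 2 ^ (m + 1) * (|deriv σ u - 1| * f u) := by
          refine setIntegral_mono_on (hiu.mul_const _)
            ((hfint _ hg'c.abs).const_mul _).integrableOn hmeas fun u hu => ?_
          have := mul_le_mul_of_nonneg_left (hlow u hu) (abs_nonneg (deriv σ u - 1))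
          linarith
      _ = 2 ^ (m + 1) * ∫ u in Set.uIoc t₀ t, |deriv σ u - 1| * f u := by rw [integral_const_mul]
      _ ≤ 2 ^ (m + 1) * ∫ u, |deriv σ u - 1| * f u := by
          refine mul_le_mul_of_nonneg_left (setIntegral_le_integral (hfint _ hg'c.abs)
            (Filter.Eventually.of_forall fun u => mul_nonneg (abs_nonneg _) (hfn u))) (by positivity)
      _ ≤ _ := mul_le_mul_of_nonneg_left hQabs (by positivity)
  have hI1 : ∫ t, |g t - g t₀| * f t ≤ 2 ^ (2 * m + 5) * Q := by
    have hcg : Continuous fun t => |g t - g t₀| := (hgc.sub continuous_const).abs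
    rw [← setIntegral_eq_integral_of_forall_compl_eq_zero (s := Set.Ioo α β)
      (fun t ht => by rw [hf0 t ht, mul_zero])]
    calc ∫ t in Set.Ioo α β, |g t - g t₀| * f t ≤ ∫ t in Set.Ioo α β, 2 ^ (m + 1) * Q :=
          setIntegral_mono_on (hfint _ hcg).integrableOn (integrableOn_const (by simp))
            measurableSet_Ioo hosc
      _ = ℓ * (2 ^ (m + 1) * Q) := by
          rw [setIntegral_const, smul_eq_mul, Real.volume_real_Ioo_of_le hαβ.le]
      _ ≤ 2 ^ (m + 4) * (2 ^ (m + 1) * Q) := mul_le_mul_of_nonneg_right hℓle (by positivity)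
      _ = _ := by ring
  have hI2 : |g t₀| * om (m + 1) ≤ ε + 2 ^ (2 * m + 5) * Q := by
    have hgint : ∫ t, g t * f t = ∫ x in E, σ (x i) := by
      rw [hconv σ hσC.continuous]
      simp only [hg, sub_mul]
      rw [integral_sub (hfint σ hσC.continuous) (hfint (fun t => t) continuous_id), hbar', sub_zero]
    have h1 : g t₀ * om (m + 1) = (∫ t, g t * f t) - ∫ t, (g t - g t₀) * f t := by
      rw [← integral_sub (hfint g hgc) (hfint (fun t => g t - g t₀) (hgc.sub continuous_const)), ← hmass,
        ← integral_const_mul]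
      congr 1; ext t; ring
    have h2 : |∫ t, (g t - g t₀) * f t| ≤ ∫ t, |g t - g t₀| * f t := by
      refine (abs_integral_le_integral_abs).trans_eq ?_
      congr 1; ext t; rw [abs_mul, abs_of_nonneg (hfn t)]
    calc |g t₀| * om (m + 1) = |g t₀ * om (m + 1)| := by rw [abs_mul, abs_of_pos hom]
      _ ≤ |∫ t, g t * f t| + |∫ t, (g t - g t₀) * f t| := by rw [h1]; exact abs_sub _ _
      _ ≤ _ := by rw [hgint]; linarith
  rw [hconv (fun t => |σ t - t|) hgc.abs]
  have hcg : Continuous fun t => |g t - g t₀| := (hgc.sub continuous_const).abs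
  calc ∫ t, |g t| * f t ≤ ∫ t, (|g t - g t₀| * f t + |g t₀| * f t) := by
        refine integral_mono (hfint _ hgc.abs) ((hfint _ hcg).add (hfi.const_mul _)) fun t => ?_
        have : |g t| ≤ |g t - g t₀| + |g t₀| := by
          have := abs_add_le (g t - g t₀) (g t₀); rwa [sub_add_cancel] at this
        simp only
        nlinarith [hfn t]
    _ = (∫ t, |g t - g t₀| * f t) + |g t₀| * om (m + 1) := by
        rw [integral_add (hfint _ hcg) (hfi.const_mul _), integral_const_mul, hmass]
    _ ≤ 2 ^ (2 * m + 5) * Q + (ε + 2 ^ (2 * m + 5) * Q) := add_le_add hI1 hI2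
    _ = _ := by ring

end estimates

lemma diverg_smul_id {n : ℕ} {f : ℝ → ℝ} {f' : ℝ} {x : Euc n}
    (h : HasDerivAt f f' (‖x‖ ^ 2)) :
    diverg n (fun x => f (‖x‖ ^ 2) • x) x = n * f (‖x‖ ^ 2) + 2 * f' * ‖x‖ ^ 2 := by
  have h1 : HasFDerivAt (fun x : Euc n => ‖x‖ ^ 2) (2 • innerSL ℝ x) x :=
    (hasStrictFDerivAt_norm_sq x).hasFDerivAt
  have h2 := (h.comp_hasFDerivAt x h1).smul (hasFDerivAt_id x)
  unfold diverg
  have h3 : fderiv ℝ (fun x : Euc n => f (‖x‖ ^ 2) • x) x = _ := h2.fderiv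
  rw [h3]
  have : ∀ i : Fin n, (f (‖x‖ ^ 2) + (2 * f') * (x i * x i)) = (f (‖x‖ ^ 2) + (2 * f') * (x i) ^ 2) :=
    fun i => by ring
  rw [EuclideanSpace.real_norm_sq_eq, Finset.mul_sum]
  rw [← EuclideanSpace.real_norm_sq_eq]
  simp [Finset.sum_add_distrib, EuclideanSpace.inner_single_right]
  refine Finset.sum_congr rfl fun i _ => ?_
  ring

lemma exists_radial_field (n : ℕ) {R η : ℝ} (hR : 0 < R) (hη : 0 < η) :
    ∃ K : Euc n → Euc n, ContDiff ℝ 1 K ∧ (∀ x, 0 ≤ diverg n K x) ∧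
      (∀ x, 1 ≤ ‖x‖ → 1 ≤ diverg n K x) ∧
      ∀ x, ‖x‖ ≤ R + 1 → ‖K x‖ ≤ (R + 1) * (R + 2) * (max (‖x‖ - 1) 0 + η) := by
  set p : ℝ → ℝ := fun u => ((u - 1) + √((u - 1) ^ 2 + η ^ 2)) / 2 with hp
  have hq : ∀ u : ℝ, 0 < (u - 1) ^ 2 + η ^ 2 := fun u => by positivity
  have habs : ∀ u : ℝ, |u - 1| ≤ √((u - 1) ^ 2 + η ^ 2) := fun u =>
    Real.abs_le_sqrt (by nlinarith)
  have hle : ∀ u : ℝ, √((u - 1) ^ 2 + η ^ 2) ≤ |u - 1| + η := fun u => by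
    apply Real.sqrt_le_iff.2
    refine ⟨by positivity, ?_⟩
    nlinarith [sq_abs (u - 1), mul_nonneg (abs_nonneg (u - 1)) hη.le]
  have hp0 : ∀ u, 0 ≤ p u := fun u => by
    have := (abs_le.1 (habs u)).1
    simp only [hp]; linarith
  have hpC : ContDiff ℝ 1 p := by
    have h1 : ContDiff ℝ 1 fun u : ℝ => √((u - 1) ^ 2 + η ^ 2) :=
      ContDiff.sqrt (by fun_prop) fun u => (hq u).ne'
    exact ((contDiff_id.sub contDiff_const).add h1).div_const 2
  have hpd : ∀ u, HasDerivAt p ((1 + (u - 1) / √((u - 1) ^ 2 + η ^ 2)) / 2) u := fun u => by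
    have h1 : HasDerivAt (fun u : ℝ => u - 1) 1 u := (hasDerivAt_id u).sub_const 1
    have h2 := ((h1.pow 2).add_const (η ^ 2)).sqrt (hq u).ne'
    have h3 := (h1.add h2).div_const 2
    refine h3.congr_deriv ?_
    have := (Real.sqrt_pos.2 (hq u)).ne'
    simp only [Pi.pow_apply]
    field_simp
    simp
    ring
  have hd0 : ∀ u, 0 ≤ (1 + (u - 1) / √((u - 1) ^ 2 + η ^ 2)) / 2 := fun u => by
    have h1 := Real.sqrt_pos.2 (hq u)
    have h2 : -1 ≤ (u - 1) / √((u - 1) ^ 2 + η ^ 2) := by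
      rw [le_div_iff₀ h1]
      linarith [(abs_le.1 (habs u)).1]
    linarith
  refine ⟨fun x => p (‖x‖ ^ 2) • x, (hpC.comp (contDiff_norm_sq ℝ)).smul contDiff_id, ?_, ?_, ?_⟩
  · intro x
    rw [diverg_smul_id (hpd _)]
    have := hp0 (‖x‖ ^ 2)
    have := hd0 (‖x‖ ^ 2)
    positivity
  · intro x hx
    rw [diverg_smul_id (hpd _)]
    have h1 : 1 ≤ ‖x‖ ^ 2 := by nlinarith
    have h2 : 0 ≤ (‖x‖ ^ 2 - 1) / √((‖x‖ ^ 2 - 1) ^ 2 + η ^ 2) :=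
      div_nonneg (by linarith) (Real.sqrt_nonneg _)
    have h3 := mul_nonneg (Nat.cast_nonneg (α := ℝ) n) (hp0 (‖x‖ ^ 2))
    nlinarith
  · intro x hx
    rw [norm_smul, Real.norm_of_nonneg (hp0 _)]
    have hx0 := norm_nonneg x
    have h1 : p (‖x‖ ^ 2) ≤ (R + 2) * (max (‖x‖ - 1) 0 + η) := by
      have h2 := hle (‖x‖ ^ 2)
      simp only [hp]
      rcases le_total 1 ‖x‖ with h | h
      · rw [max_eq_left (by linarith)]
        rw [abs_of_nonneg (by nlinarith)] at h2
        nlinarith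
      · rw [max_eq_right (by linarith)]
        rw [abs_of_nonpos (by nlinarith)] at h2
        nlinarith
    calc p (‖x‖ ^ 2) * ‖x‖ ≤ (R + 2) * (max (‖x‖ - 1) 0 + η) * (R + 1) := by
          gcongr
      _ = _ := by ring

lemma norm_le_sum_abs {n : ℕ} (z : Euc n) : ‖z‖ ≤ ∑ i, |z i| := by
  have h : z = ∑ i, z i • EuclideanSpace.single i (1 : ℝ) := by
    ext j
    simp [Finset.sum_apply, Pi.single_apply]
  calc ‖z‖ = ‖∑ i, z i • EuclideanSpace.single i (1 : ℝ)‖ := by rw [← h]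
    _ ≤ ∑ i, ‖z i • EuclideanSpace.single i (1 : ℝ)‖ := norm_sum_le _ _
    _ = ∑ i, |z i| := by simp [norm_smul]

lemma norm_combination_le {n : ℕ} {x k : Euc n} {T : Fin n → Euc n} {σ γ : Fin n → ℝ}
    {M s η : ℝ} (hT : ∀ i, ‖T i‖ ≤ 1) (hTσ : ∀ i, T i i = σ i) (hγ : ∀ i, |σ i - x i| ≤ γ i)
    (hγM : ∀ i, γ i ≤ M) (hM : 0 ≤ M) (hs : 0 ≤ s) (hη : 0 ≤ η)
    (hk : ‖k‖ ≤ max (‖x‖ - 1) 0 + η) :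
    ‖s • k + ∑ i, (1 + s * M - s * γ i) • T i‖ ≤ n * (1 + s * M + s ^ 2 / 2) + s * η := by
  set Φ := s • k + ∑ i, (1 + s * M - s * γ i) • T i with hΦ
  rcases eq_or_ne Φ 0 with h0 | h0
  · rw [h0, norm_zero]; positivity
  have hN : 0 < ‖Φ‖ := norm_pos_iff.2 h0
  set ν := ‖Φ‖⁻¹ • Φ with hν
  have hν1 : ‖ν‖ = 1 := by rw [hν, norm_smul, norm_inv, norm_norm, inv_mul_cancel₀ hN.ne']
  have h1 : ‖Φ‖ = inner ℝ Φ ν := by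
    rw [hν, inner_smul_right, real_inner_self_eq_norm_sq]
    field_simp
  have h2 : inner ℝ Φ ν = s * inner ℝ k ν + ∑ i, (1 + s * M - s * γ i) * inner ℝ (T i) ν := by
    conv_lhs => rw [hΦ]
    rw [inner_add_left, sum_inner, real_inner_smul_left]
    simp only [real_inner_smul_left]
  have h3 : inner ℝ k ν ≤ (∑ i, |x i - ν i|) + η := by
    have a1 : inner ℝ k ν ≤ ‖k‖ := by
      have := real_inner_le_norm k ν
      rwa [hν1, mul_one] at this
    have a2 : max (‖x‖ - 1) 0 ≤ ‖x - ν‖ := by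
      refine max_le ?_ (norm_nonneg _)
      have := norm_sub_norm_le x ν
      rwa [hν1] at this
    have a3 := norm_le_sum_abs (x - ν)
    simp only [PiLp.sub_apply] at a3
    linarith
  have h4 : ∀ i, s * |x i - ν i| + (1 + s * M - s * γ i) * inner ℝ (T i) ν
      ≤ 1 + s * M + s ^ 2 / 2 := by
    intro i
    have b1 : inner ℝ (T i) ν ≤ 1 := by
      have := real_inner_le_norm (T i) ν
      rw [hν1, mul_one] at this
      exact this.trans (hT i)
    have b2 : |σ i - ν i| ^ 2 ≤ 2 * (1 - inner ℝ (T i) ν) := by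
      have c1 := PiLp.norm_apply_le (T i - ν) i
      rw [PiLp.sub_apply, hTσ, Real.norm_eq_abs] at c1
      have c2 := norm_sub_sq_real (T i) ν
      rw [hν1] at c2
      have c3 : ‖T i‖ ^ 2 ≤ 1 := pow_le_one₀ (norm_nonneg _) (hT i)
      have c4 := pow_le_pow_left₀ (abs_nonneg _) c1 2
      linarith
    have b3 : |x i - ν i| ≤ γ i + |σ i - ν i| := by
      have := abs_sub_le (x i) (σ i) (ν i)
      rw [abs_sub_comm (x i) (σ i)] at this
      linarith [hγ i]
    have b4 := mul_le_mul_of_nonneg_left b3 hs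
    have b5 := mul_le_mul_of_nonneg_left b1 (mul_nonneg hs (sub_nonneg.2 (hγM i)))
    nlinarith [sq_nonneg (s - |σ i - ν i|)]
  rw [h1, h2]
  calc s * inner ℝ k ν + ∑ i, (1 + s * M - s * γ i) * inner ℝ (T i) ν
      ≤ s * ((∑ i, |x i - ν i|) + η) + ∑ i, (1 + s * M - s * γ i) * inner ℝ (T i) ν := by gcongr
    _ = (∑ i, (s * |x i - ν i| + (1 + s * M - s * γ i) * inner ℝ (T i) ν)) + s * η := by
        rw [Finset.sum_add_distrib, ← Finset.mul_sum]; ring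
    _ ≤ (∑ _i : Fin n, (1 + s * M + s ^ 2 / 2)) + s * η := by
        exact add_le_add_left (Finset.sum_le_sum fun i _ => h4 i) _
    _ = _ := by rw [Finset.sum_const, Finset.card_univ, Fintype.card_fin, nsmul_eq_mul]

lemma abs_sub_one_le {z s : ℝ} (hz : 0 ≤ z) (hs : 0 < s) :
    |z - 1| ≤ (√z - 1) ^ 2 * (1 + 1 / s) + s := by
  have h1 : z - 1 = (√z - 1) ^ 2 + 2 * (√z - 1) := by
    nlinarith [Real.sq_sqrt hz]
  set y := √z - 1
  have h2 : 2 * |y| ≤ y ^ 2 / s + s := by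
    rw [← sub_nonneg]
    have : y ^ 2 / s + s - 2 * |y| = (|y| - s) ^ 2 / s := by
      field_simp
      rw [← sq_abs y]; ring
    rw [this]; positivity
  calc |z - 1| ≤ |y ^ 2| + |2 * y| := by rw [h1]; exact abs_add_le _ _
    _ = y ^ 2 + 2 * |y| := by rw [abs_of_nonneg (sq_nonneg y), abs_mul]; norm_num
    _ ≤ y ^ 2 + (y ^ 2 / s + s) := by linarith
    _ = _ := by ring

lemma direction_estimate {m : ℕ} (i : Fin (m + 1)) {E : Set (Euc (m + 1))} (hc : Convex ℝ E)
    (ho : IsOpen E) (hb : IsBounded E) (hv : volume.real E = om (m + 1))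
    (hbar : ∫ x in E, x i = 0) {P s : ℝ} (hs : 0 < s) (hs1 : s ≤ 1)
    (hsm : (6 + om (m + 1)) * s ≤ om (m + 1) / 2)
    (hP : ∀ φ, IsAdm φ → ∫ x in E, diverg (m + 1) φ x ≤ P)
    (hP' : P ≤ (m + 1) * om (m + 1) + s ^ 2) :
    ∃ σ : ℝ → ℝ, ContDiff ℝ 1 σ ∧ (∀ t, |σ t| < 1) ∧
      (∫ x in E, |deriv σ (x i) - 1| ≤ (6 + om (m + 1)) * s) ∧
      (∀ x ∈ E, |x i| ≤ 2 ^ (m + 4)) ∧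
      (∫ x in E, |σ (x i) - x i| ≤ (1 + 2 ^ (2 * m + 6) * (6 + om (m + 1))) * s) ∧
      ∀ (w : ℝ → ℝ) (W : ℝ), ContDiff ℝ 1 w → (∀ x ∈ E, 0 ≤ w (x i) ∧ w (x i) ≤ W) →
        ∃ T : Euc (m + 1) → Euc (m + 1), ContDiff ℝ 1 T ∧ (∀ x, ‖T x‖ ≤ 1) ∧
          (∀ x, T x i = σ (x i)) ∧
          (∫ x in E, ((m + 1) * w (x i) + deriv w (x i) * σ (x i))) - s ^ 2 * (W + 1)
            ≤ ∫ x in E, diverg (m + 1) (fun x => w (x i) • T x) x := by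
  have hom := om_pos (m + 1)
  have hε : 0 < s ^ 2 := by positivity
  obtain ⟨σ, hσC, hσ1, hσ', hσε, hT⟩ := exists_direction_field i (isoIneq m) hc ho hb hv hε
  have hσ'c : Continuous (deriv σ) := hσC.continuous_deriv (by norm_num)
  have hσc := hσC.continuous
  have hi : Continuous fun x : Euc (m + 1) => x i := by fun_prop
  have hyc : Continuous fun x : Euc (m + 1) => (√(deriv σ (x i)) - 1) ^ 2 :=
    ((Real.continuous_sqrt.comp (hσ'c.comp hi)).sub continuous_const).pow 2
  have hyi : IntegrableOn (fun x : Euc (m + 1) => (√(deriv σ (x i)) - 1) ^ 2) E :=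
    isOpen_bounded_integrableOn hb hyc
  have hX : ∫ x in E, (√(deriv σ (x i)) - 1) ^ 2 ≤ 3 * s ^ 2 := by
    obtain ⟨T, hTC, hT1, hTσ, hTi⟩ := hT (fun _ => 1) 1 contDiff_const fun x _ => by norm_num
    obtain ⟨R, hR, hER⟩ := exists_pos_subset_ball hb
    obtain ⟨φ, hφ, hφe⟩ := exists_cutoff_field ho hR one_pos hER hTC fun x _ => hT1 x
    have h1 := hP φ hφ
    rw [hφe] at h1
    simp only [one_smul, one_mul, deriv_const, zero_mul, add_zero] at hTi
    rw [integral_add (isOpen_bounded_integrableOn hb continuous_const) hyi] at hTi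
    simp only [integral_const, measureReal_restrict_apply_univ, hv, smul_eq_mul] at hTi
    linarith
  have hQ : ∫ x in E, |deriv σ (x i) - 1| ≤ (6 + om (m + 1)) * s := by
    have h1 : ∫ x in E, |deriv σ (x i) - 1|
        ≤ ∫ x in E, ((√(deriv σ (x i)) - 1) ^ 2 * (1 + 1 / s) + s) := by
      refine integral_mono (isOpen_bounded_integrableOn hb
        ((hσ'c.comp hi).sub continuous_const).abs)
        (isOpen_bounded_integrableOn hb ((hyc.mul continuous_const).add continuous_const)) fun x => ?_
      exact abs_sub_one_le (hσ' _) hs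
    rw [integral_add (hyi.mul_const _) (isOpen_bounded_integrableOn hb continuous_const), integral_mul_const] at h1
    simp only [integral_const, measureReal_restrict_apply_univ, hv, smul_eq_mul] at h1
    have h2 : (∫ x in E, (√(deriv σ (x i)) - 1) ^ 2) * (1 + 1 / s) ≤ 3 * s ^ 2 * (1 + 1 / s) := by
      gcongr
    have h3 : 3 * s ^ 2 * (1 + 1 / s) = 3 * s ^ 2 + 3 * s := by field_simp
    nlinarith
  obtain ⟨hL, hg⟩ := profile_estimate i hc ho hb hv hbar hσC hσ1 hσ' hσε hQ hsm
  refine ⟨σ, hσC, hσ1, hQ, hL, hg.trans (by nlinarith), fun w W hw hwW => ?_⟩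
  obtain ⟨T, hTC, hT1, hTσ, hTi⟩ := hT w W hw hwW
  refine ⟨T, hTC, hT1, hTσ, le_trans ?_ hTi⟩
  have hwc := hw.continuous
  have hw'c : Continuous (deriv w) := hw.continuous_deriv (by norm_num)
  have hd : Continuous fun x : Euc (m + 1) => deriv w (x i) * σ (x i) :=
    (hw'c.comp hi).mul (hσc.comp hi)
  have hw1 : Continuous fun x : Euc (m + 1) => w (x i) := hwc.comp hi
  gcongr ?_ - _
  refine setIntegral_mono_on (isOpen_bounded_integrableOn hb
    ((continuous_const.mul hw1).add hd)) (isOpen_bounded_integrableOn hb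
    ((hw1.mul (continuous_const.add hyc)).add hd)) ho.measurableSet fun x hx => ?_
  have := mul_nonneg (hwW x hx).1 (sq_nonneg (√(deriv σ (x i)) - 1))
  linarith

lemma smoothed_abs {g : ℝ → ℝ} (hg : ContDiff ℝ 1 g) {η : ℝ} (hη : 0 < η) :
    ∃ γ : ℝ → ℝ, ContDiff ℝ 1 γ ∧ (∀ t, |g t| ≤ γ t) ∧ (∀ t, γ t ≤ |g t| + η) ∧
      ∀ t, |deriv γ t| ≤ |deriv g t| := by
  have hq : ∀ t, 0 < g t ^ 2 + η ^ 2 := fun t => by positivity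
  have habs : ∀ t, |g t| ≤ √(g t ^ 2 + η ^ 2) := fun t => Real.abs_le_sqrt (by nlinarith)
  refine ⟨fun t => √(g t ^ 2 + η ^ 2), ContDiff.sqrt ((hg.pow 2).add contDiff_const)
    fun t => (hq t).ne', habs, fun t => ?_, fun t => ?_⟩
  · apply Real.sqrt_le_iff.2
    refine ⟨by positivity, ?_⟩
    nlinarith [sq_abs (g t), mul_nonneg (abs_nonneg (g t)) hη.le]
  · have h1 := (hg.differentiable (by norm_num) t).hasDerivAt
    have h2 := ((h1.pow 2).add_const (η ^ 2)).sqrt (hq t).ne'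
    have h3 : deriv (fun t => √(g t ^ 2 + η ^ 2)) t = _ := h2.deriv
    have h0 := Real.sqrt_pos.2 (hq t)
    rw [h3]
    simp only [Pi.pow_apply]
    have h4 : ((2 : ℕ) : ℝ) * g t ^ (2 - 1) * deriv g t / (2 * √(g t ^ 2 + η ^ 2))
        = g t / √(g t ^ 2 + η ^ 2) * deriv g t := by
      field_simp
      norm_num
      ring
    rw [h4, abs_mul, abs_div, abs_of_pos h0]
    exact mul_le_of_le_one_left (abs_nonneg _) ((div_le_one h0).2 (habs t))

lemma weighted_direction_estimate {m : ℕ} (i : Fin (m + 1)) {E : Set (Euc (m + 1))}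
    (hb : IsBounded E) (hv : volume.real E = om (m + 1))
    {σ γ : ℝ → ℝ} (hσ : ContDiff ℝ 1 σ) (hσ1 : ∀ t, |σ t| < 1) (hγ : ContDiff ℝ 1 γ) {s M G H : ℝ}
    (hs : 0 < s) (hγle : ∀ t, γ t ≤ |σ t - t| + s)
    (hγ' : ∀ t, |deriv γ t| ≤ |deriv (fun t => σ t - t) t|)
    (hH : ∫ x in E, |deriv σ (x i) - 1| ≤ H) (hG : ∫ x in E, |σ (x i) - x i| ≤ G) :
    (m + 1) * (1 + s * M) * om (m + 1) - s * ((m + 1) * (G + s * om (m + 1)) + H)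
      ≤ ∫ x in E, ((m + 1) * (1 + s * M - s * γ (x i))
        + deriv (fun t => 1 + s * M - s * γ t) (x i) * σ (x i)) := by
  have hi : Continuous fun x : Euc (m + 1) => x i := by fun_prop
  have hσ'c : Continuous (deriv σ) := hσ.continuous_deriv (by norm_num)
  have hγ'c : Continuous (deriv γ) := hγ.continuous_deriv (by norm_num)
  have hd : ∀ t, deriv (fun t => 1 + s * M - s * γ t) t = - (s * deriv γ t) := fun t => by
    have h := (hγ.differentiable (by norm_num) t).hasDerivAt
    exact ((h.const_mul s).const_sub (1 + s * M)).deriv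
  have hd2 : ∀ t, deriv (fun t => σ t - t) t = deriv σ t - 1 := fun t => by
    have h := (hσ.differentiable (by norm_num) t).hasDerivAt
    exact (h.sub (hasDerivAt_id t)).deriv
  simp only [hd]
  simp only [hd2] at hγ'
  have c1 : Continuous fun x : Euc (m + 1) => |deriv σ (x i) - 1| :=
    ((hσ'c.comp hi).sub continuous_const).abs
  have c2 : Continuous fun x : Euc (m + 1) => |σ (x i) - x i| :=
    ((hσ.continuous.comp hi).sub hi).abs
  have c3 : Continuous fun x : Euc (m + 1) => γ (x i) := hγ.continuous.comp hi
  have c4 : Continuous fun x : Euc (m + 1) => deriv γ (x i) := hγ'c.comp hi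
  have c5 : Continuous fun x : Euc (m + 1) => σ (x i) := hσ.continuous.comp hi
  have int {F : Euc (m + 1) → ℝ} (hF : Continuous F) : IntegrableOn F E :=
    isOpen_bounded_integrableOn hb hF
  have key : ∫ x in E, ((((m + 1) * (1 + s * M) - s * (m + 1) * s) - s * (m + 1) * |σ (x i) - x i|)
        - s * |deriv σ (x i) - 1|)
      ≤ ∫ x in E, ((m + 1) * (1 + s * M - s * γ (x i)) + -(s * deriv γ (x i)) * σ (x i)) := by
    refine integral_mono (int (by fun_prop)) (int (by fun_prop)) fun x => ?_
    have h1 : deriv γ (x i) * σ (x i) ≤ |deriv σ (x i) - 1| :=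
      calc deriv γ (x i) * σ (x i) ≤ |deriv γ (x i)| * |σ (x i)| := by
            rw [← abs_mul]; exact le_abs_self _
        _ ≤ |deriv γ (x i)| := mul_le_of_le_one_right (abs_nonneg _) (hσ1 _).le
        _ ≤ _ := hγ' _
    have h2 := mul_le_mul_of_nonneg_left h1 hs.le
    have h3 := mul_le_mul_of_nonneg_left (hγle (x i)) (by positivity : 0 ≤ s * (m + 1 : ℝ))
    simp only
    linarith
  rw [integral_sub (int (by fun_prop)) (int (by fun_prop)),
    integral_sub (int (by fun_prop)) (int (by fun_prop)), integral_const_mul, integral_const_mul] at key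
  simp only [integral_const, measureReal_restrict_apply_univ, hv, smul_eq_mul] at key
  refine le_trans ?_ key
  have h1 := mul_le_mul_of_nonneg_left hH hs.le
  have h2 := mul_le_mul_of_nonneg_left hG (by positivity : 0 ≤ s * (m + 1 : ℝ))
  linarith

lemma excess_bound (m : ℕ) : ∃ C s₀ : ℝ, 0 < C ∧ 0 < s₀ ∧ ∀ (E : Set (Euc (m + 1))), Convex ℝ E →
    IsOpen E → IsBounded E → volume.real E = om (m + 1) → (∀ i, ∫ x in E, x i = 0) →
    ∀ P s : ℝ, 0 < s → s ≤ s₀ → (∀ φ, IsAdm φ → ∫ x in E, diverg (m + 1) φ x ≤ P) →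
      P ≤ (m + 1) * om (m + 1) + s ^ 2 → volume.real (E \ ball 0 1) ≤ C * s := by
  have hom := om_pos (m + 1)
  set ω := om (m + 1) with hω
  set n : ℝ := (m + 1 : ℝ) with hn
  have hn0 : 0 < n := by positivity
  set R : ℝ := n * 2 ^ (m + 4) + 1 with hR
  have hR0 : 0 < R := by positivity
  set A : ℝ := (R + 1) * (R + 2) with hA
  have hA0 : 0 < A := by positivity
  set M := R + 3 with hM
  have hM0 : 0 < M := by positivity
  set G : ℝ := 1 + 2 ^ (2 * m + 6) * (6 + ω) with hG
  have hG0 : 0 < G := by positivity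
  set C : ℝ := A * (n * (1 + M) + (n / 2 + 1) * (n * ω + 1)
    + n * (n * (G + ω) + (6 + ω) + (2 + M))) with hC
  refine ⟨C, min 1 (ω / 2 / (6 + ω)), by positivity, by positivity, ?_⟩
  intro E hc ho hb hv hbar P s hs hs0 hP hP'
  have hs1 : s ≤ 1 := hs0.trans (min_le_left _ _)
  have hsm : (6 + ω) * s ≤ ω / 2 := by
    rw [mul_comm]
    exact (le_div_iff₀ (by positivity)).1 (hs0.trans (min_le_right _ _))
  choose σ hσC hσ1 hQ hL hg hT using fun i =>
    direction_estimate i hc ho hb hv (hbar i) hs hs1 hsm hP hP'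
  have hER : E ⊆ ball 0 R := by
    intro x hx
    rw [mem_ball_zero_iff]
    calc ‖x‖ ≤ ∑ i, |x i| := norm_le_sum_abs x
      _ ≤ ∑ _i : Fin (m + 1), (2 : ℝ) ^ (m + 4) := Finset.sum_le_sum fun i _ => hL i x hx
      _ = n * 2 ^ (m + 4) := by simp [hn]
      _ < R := by rw [hR]; linarith
  choose γ hγC hγ1 hγ2 hγ3 using fun i =>
    smoothed_abs (g := fun t => σ i t - t) ((hσC i).sub contDiff_id) hs
  have hγM : ∀ i t, |t| ≤ R + 1 → γ i t ≤ M := fun i t ht => by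
    have h1 := abs_sub (σ i t) t
    have h2 := hγ2 i t
    have h3 := (hσ1 i t).le
    linarith
  have hxR : ∀ x : Euc (m + 1), ‖x‖ ≤ R + 1 → ∀ i, |x i| ≤ R + 1 := fun x hx i =>
    (PiLp.norm_apply_le x i).trans hx
  have hEx : ∀ x ∈ E, ‖x‖ ≤ R + 1 := fun x hx => by
    have := mem_ball_zero_iff.1 (hER hx)
    linarith
  have hwC : ∀ i, ContDiff ℝ 1 fun t => 1 + s * M - s * γ i t := fun i =>
    contDiff_const.sub (contDiff_const.mul (hγC i))
  choose T hTC hT1 hTσ hTi using fun i => hT i (fun t => 1 + s * M - s * γ i t) (1 + s * M) (hwC i)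
    fun x hx => by
      have h1 := hγM i (x i) (hxR x (hEx x hx) i)
      have h2 := (abs_nonneg _).trans (hγ1 i (x i))
      exact ⟨by nlinarith, by nlinarith⟩
  obtain ⟨K, hKC, hK0, hK1, hKn⟩ := exists_radial_field (m + 1) hR0 hs
  set Ψ : Fin (m + 1) → Euc (m + 1) → Euc (m + 1) :=
    fun i x => (1 + s * M - s * γ i (x i)) • T i x with hΨ
  have hΨC : ∀ i, ContDiff ℝ 1 (Ψ i) := fun i =>
    ((hwC i).comp (by fun_prop : ContDiff ℝ 1 fun x : Euc (m + 1) => x i)).smul (hTC i)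
  have hkC : ContDiff ℝ 1 fun x => (s / A) • K x := hKC.const_smul _
  have hSC : ContDiff ℝ 1 fun x => ∑ i, Ψ i x := ContDiff.sum fun i _ => hΨC i
  set N : ℝ := n * (1 + s * M + s ^ 2 / 2) + s * s with hN
  have hN0 : 0 < N := by positivity
  obtain ⟨φ, hφ, hφe⟩ := exists_cutoff_field ho hR0 hN0 hER (hkC.add hSC) (fun x hx => by
    have h1 := norm_combination_le (x := x) (k := A⁻¹ • K x) (T := fun i => T i x)
      (σ := fun i => σ i (x i)) (γ := fun i => γ i (x i)) (M := M) (s := s) (η := s)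
      (fun i => hT1 i x) (fun i => hTσ i x) (fun i => hγ1 i (x i))
      (fun i => hγM i _ (hxR x hx i)) hM0.le hs.le hs.le (by
        rw [norm_smul, norm_inv, Real.norm_of_nonneg hA0.le, inv_mul_le_iff₀ hA0]
        exact hKn x hx)
    rw [smul_smul, ← div_eq_mul_inv] at h1
    refine h1.trans (le_of_eq ?_)
    rw [hN, hn]; push_cast; ring)
  have hup : ∫ x in E, diverg (m + 1) (fun x => (s / A) • K x + ∑ i, Ψ i x) x
      ≤ N * (n * ω + s ^ 2) := by
    have h1 := (hP φ hφ).trans hP'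
    rwa [hφe, inv_mul_le_iff₀ hN0] at h1
  have int {F : Euc (m + 1) → ℝ} (hF : Continuous F) : IntegrableOn F E :=
    isOpen_bounded_integrableOn hb hF
  have hsplit : ∫ x in E, diverg (m + 1) (fun x => (s / A) • K x + ∑ i, Ψ i x) x
      = s / A * (∫ x in E, diverg (m + 1) K x) + ∑ i, ∫ x in E, diverg (m + 1) (Ψ i) x := by
    rw [← integral_const_mul, ← integral_finsetSum _ fun i _ => int (continuous_diverg (hΨC i)),
      ← integral_add ((int (continuous_diverg hKC)).const_mul _)
        (integrable_finsetSum _ fun i _ => int (continuous_diverg (hΨC i)))]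
    congr 1
    ext x
    have d : ∀ {φ : Euc (m + 1) → Euc (m + 1)}, ContDiff ℝ 1 φ → DifferentiableAt ℝ φ x :=
      fun h => h.differentiable (by norm_num) x
    rw [diverg_add (d hkC) (d hSC), diverg_const_smul (d hKC), diverg_sum _ fun i _ => d (hΨC i)]
  have hK : volume.real (E \ ball 0 1) ≤ ∫ x in E, diverg (m + 1) K x := by
    have hms : MeasurableSet (E \ ball 0 1) := ho.measurableSet.diff measurableSet_ball
    calc volume.real (E \ ball 0 1) = ∫ x in E \ ball 0 1, (1 : ℝ) := by simp
      _ ≤ ∫ x in E \ ball 0 1, diverg (m + 1) K x := by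
          refine setIntegral_mono_on ?_ ?_ hms fun x hx => hK1 x ?_
          · exact (int continuous_const).mono_set Set.sdiff_subset
          · exact (int (continuous_diverg hKC)).mono_set Set.sdiff_subset
          · simpa using hx.2
      _ ≤ _ := setIntegral_mono_set (int (continuous_diverg hKC))
          (Filter.Eventually.of_forall hK0) (Filter.Eventually.of_forall Set.sdiff_subset)
  have hlow : ∀ i, n * (1 + s * M) * ω - s * (n * (G * s + s * ω) + (6 + ω) * s)
      - s ^ 2 * (1 + s * M + 1) ≤ ∫ x in E, diverg (m + 1) (Ψ i) x := fun i => by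
    have h1 := weighted_direction_estimate i hb hv (hσC i) (hσ1 i) (hγC i) (M := M) hs
      (hγ2 i) (hγ3 i) (hQ i) (hg i)
    have h2 := hTi i
    linarith
  have hsum := Finset.sum_le_sum fun i (_ : i ∈ Finset.univ) => hlow i
  rw [Finset.sum_const, Finset.card_univ, Fintype.card_fin, nsmul_eq_mul] at hsum
  push_cast at hsum
  rw [← hn] at hsum
  set V := volume.real (E \ ball 0 1)
  have hKV : s / A * V ≤ s / A * ∫ x in E, diverg (m + 1) K x := by gcongr
  have hfin : s / A * V ≤ s ^ 2 * (C / A) := by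
    have e1 : C / A = n * (1 + M) + (n / 2 + 1) * (n * ω + 1)
        + n * (n * (G + ω) + (6 + ω) + (2 + M)) := by
      rw [hC]; field_simp
    have e2 : s / A * V ≤ N * (n * ω + s ^ 2) - n * (n * (1 + s * M) * ω
        - s * (n * (G * s + s * ω) + (6 + ω) * s) - s ^ 2 * (1 + s * M + 1)) := by
      linarith
    refine e2.trans ?_
    have e3 : N * (n * ω + s ^ 2) - n * (n * (1 + s * M) * ω
        - s * (n * (G * s + s * ω) + (6 + ω) * s) - s ^ 2 * (1 + s * M + 1))
        = s ^ 2 * (n * (1 + s * M) + (n / 2 + 1) * (n * ω + s ^ 2)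
          + n * (n * (G + ω) + (6 + ω) + (2 + s * M))) := by
      rw [hN]; ring
    rw [e1, e3]
    have e4 : s * M ≤ M := mul_le_of_le_one_left hM0.le hs1
    have e5 : s ^ 2 ≤ 1 := pow_le_one₀ hs.le hs1
    gcongr
  have : s / A * V ≤ s / A * (C * s) := hfin.trans (le_of_eq (by field_simp))
  exact le_of_mul_le_mul_left this (by positivity)

section perimeter
variable {n : ℕ}

lemma deGiorgiPer_le {E : Set (Euc n)} {B : ℝ}
    (h : ∀ φ, IsAdm φ → ∫ x in E, diverg n φ x ≤ B) : deGiorgiPer n E ≤ B := by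
  refine csSup_le ⟨∫ x in E, diverg n (fun _ => 0) x, fun _ => 0, contDiff_const,
    HasCompactSupport.zero, by simp, rfl⟩ ?_
  rintro r ⟨φ, h1, h2, h3, rfl⟩
  exact h φ ⟨h1, h2, h3⟩

lemma le_deGiorgiPer {E : Set (Euc n)} (hc : Convex ℝ E) (ho : IsOpen E) (hb : IsBounded E)
    (hne : E.Nonempty) {φ : Euc n → Euc n} (hφ : IsAdm φ) :
    ∫ x in E, diverg n φ x ≤ deGiorgiPer n E := by
  obtain ⟨x₀, hx₀⟩ := hne
  obtain ⟨r, hr, hrE⟩ := Metric.isOpen_iff.1 ho x₀ hx₀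
  have hF : affPre 1 (-x₀) (affPre 1 x₀ E) = E := by
    ext y
    simp [affPre]
  refine le_csSup ⟨n * volume.real (affPre 1 x₀ E) / r, ?_⟩
    ⟨φ, hφ.contDiff, hφ.compact, hφ.bound, rfl⟩
  rintro _ ⟨ψ, h1, h2, h3, rfl⟩
  have ho' : IsOpen (affPre 1 x₀ E) := isOpen_affPre ho
  obtain ⟨χ, hχ, hχe⟩ := exists_scaled_field one_pos (-x₀) ho'.measurableSet
    (⟨h1, h2, h3⟩ : IsAdm ψ)
  rw [hF, one_pow, div_one, one_mul] at hχe
  rw [← hχe]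
  refine flux_le (convex_affPre hc) (isBounded_affPre one_pos hb) ho' hr ?_ hχ
  rw [← closure_ball _ hr.ne']
  refine closure_mono fun y hy => hrE ?_
  simpa using hy

lemma interior_ae_eq {E : Set (Euc n)} (hc : Convex ℝ E) : (interior E : Set (Euc n)) =ᵐ[volume] E :=
  interior_ae_eq_of_null_frontier (hc.addHaar_frontier volume)

lemma deGiorgiPer_interior {E : Set (Euc n)} (hc : Convex ℝ E) :
    deGiorgiPer n (interior E) = deGiorgiPer n E := by
  unfold deGiorgiPer
  simp only [setIntegral_congr_set (interior_ae_eq hc)]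

lemma deGiorgiPer_ball_pos (hn : n ≠ 0) {a : ℝ} (ha : 0 < a) :
    0 < deGiorgiPer n (ball 0 a) := by
  have hv := volume_ball_eq n 0 ha
  have h0 := om_pos n
  have hn' : (0 : ℝ) < n := by positivity
  have hp : 0 < n * volume.real (ball (0 : Euc n) a) / a := by rw [hv]; positivity
  obtain ⟨φ, hφ, h⟩ := (isoIneq n).scaled (convex_ball 0 a) isOpen_ball isBounded_ball ha hv
    (half_pos hp)
  have := le_deGiorgiPer (convex_ball 0 a) isOpen_ball isBounded_ball ⟨0, mem_ball_self ha⟩ hφ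
  linarith

lemma deGiorgiPer_ball_le {a : ℝ} (ha : 0 < a) :
    deGiorgiPer n (ball 0 a) ≤ n * om n * (a ^ n / a) := by
  refine deGiorgiPer_le fun φ hφ => ?_
  have h := flux_le (convex_ball 0 a) isBounded_ball isOpen_ball ha
    (closure_ball (0 : Euc n) ha.ne').ge hφ
  rw [volume_ball_eq n 0 ha] at h
  refine h.trans (le_of_eq ?_)
  ring

end perimeter

section asymmetry
variable {n : ℕ} {E : Set (Euc n)}

lemma matchRad_interior (hc : Convex ℝ E) : matchRad n (interior E) = matchRad n E := by
  unfold matchRad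
  rw [measure_congr (interior_ae_eq hc)]

lemma deficit_interior (hc : Convex ℝ E) : deficit n (interior E) = deficit n E := by
  unfold deficit
  rw [matchRad_interior hc, deGiorgiPer_interior hc]

lemma barAsym_interior (hc : Convex ℝ E) : barAsym n (interior E) = barAsym n E := by
  have h : ∀ B : Set (Euc n), volume (interior E ∆ B) = volume (E ∆ B) := fun B =>
    measure_congr ((interior_ae_eq hc).symmDiff (ae_eq_refl B))
  unfold barAsym barycenter
  rw [matchRad_interior hc, measure_congr (interior_ae_eq hc),
    setIntegral_congr_set (interior_ae_eq hc), h]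

lemma volume_real_pos (ho : IsOpen E) (hb : IsBounded E) (hne : E.Nonempty) :
    0 < volume.real E :=
  ENNReal.toReal_pos (ho.measure_pos volume hne).ne' hb.measure_lt_top.ne

lemma matchRad_pos (hv : 0 < volume.real E) : 0 < matchRad n E :=
  Real.rpow_pos_of_pos (div_pos hv (om_pos n)) _

lemma volume_eq_matchRad (hn : n ≠ 0) : volume.real E = om n * matchRad n E ^ n := by
  have h0 := om_pos n
  have h : matchRad n E ^ n = volume.real E / om n := by
    unfold matchRad
    rw [one_div, Real.rpow_inv_natCast_pow (div_nonneg ENNReal.toReal_nonneg ENNReal.toReal_nonneg) hn]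
    rfl
  rw [h]; field_simp

lemma barAsym_eq (hn : n ≠ 0) (ho : IsOpen E) (hb : IsBounded E) (hne : E.Nonempty) :
    barAsym n E
      = 2 / om n * volume.real (affPre (matchRad n E) (barycenter n E) E \ ball 0 1) := by
  have hv := volume_real_pos ho hb hne
  have ha := matchRad_pos hv
  have hva := volume_eq_matchRad (E := E) hn
  have h0 := om_pos n
  set a := matchRad n E
  set b := barycenter n E with hbdef
  have hvb := volume_ball_eq n b ha
  have hmB : MeasurableSet (ball b a) := measurableSet_ball
  have hfE : volume E ≠ ∞ := hb.measure_lt_top.ne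
  have hfB : volume (ball b a) ≠ ∞ := measure_ball_lt_top.ne
  have h1 : affPre a b (E \ ball b a) = affPre a b E \ ball 0 1 := by
    ext y
    have : b + a • y ∈ ball b a ↔ y ∈ ball (0 : Euc n) 1 := by
      rw [mem_ball, dist_eq_norm, add_sub_cancel_left, norm_smul, Real.norm_of_nonneg ha.le,
        mem_ball_zero_iff]
      constructor <;> intro h <;> nlinarith
    change (b + a • y ∈ E ∧ b + a • y ∉ ball b a) ↔ (b + a • y ∈ E ∧ y ∉ ball (0 : Euc n) 1)
    rw [this]
  have h2 := volume_affPre ha (b := b) (ho.measurableSet.diff hmB)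
  rw [h1] at h2
  have h3 : volume.real (E ∆ ball b a)
      = volume.real (E \ ball b a) + volume.real (ball b a \ E) := by
    rw [Set.symmDiff_def, measureReal_union disjoint_sdiff_sdiff (hmB.diff ho.measurableSet)
      (measure_ne_top_of_subset Set.sdiff_subset hfE)
      (measure_ne_top_of_subset Set.sdiff_subset hfB)]
  have h4 := measureReal_sdiff_add_inter (μ := volume) (s := E) hmB hfE
  have h5 := measureReal_sdiff_add_inter (μ := volume) (s := ball b a) ho.measurableSet hfB
  rw [Set.inter_comm] at h5
  have h6 : volume.real (ball b a \ E) = volume.real (E \ ball b a) := by linarith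
  change volume.real (E ∆ ball b a) / volume.real E = _
  rw [h2, h3, h6, hva]
  field_simp
  ring

lemma integral_affPre_barycenter {a : ℝ} (ha : 0 < a) (hE : MeasurableSet E) (hb : IsBounded E)
    (hv : 0 < volume.real E) (i : Fin n) :
    ∫ y in affPre a (barycenter n E) E, y i = 0 := by
  set b := barycenter n E with hbdef
  have h1 := setIntegral_affPre ha (b := b) hE (fun x => a⁻¹ * (x i - b i))
  have h2 : ∀ y : Euc n, a⁻¹ * ((b + a • y) i - b i) = y i := fun y => by
    simp [ha.ne']
  simp only [h2] at h1
  have hintg : IntegrableOn (fun x : Euc n => x) E := by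
    have hcl : IsCompact (closure E) := hb.isCompact_closure
    exact (continuous_id.continuousOn.integrableOn_compact hcl).mono_set subset_closure
  have h3 : b i = (volume.real E)⁻¹ * ∫ x in E, x i := by
    have h4 := (EuclideanSpace.proj (𝕜 := ℝ) i).integral_comp_comm hintg
    simp only [PiLp.proj_apply] at h4
    rw [h4, hbdef]
    rfl
  rw [h1, integral_const_mul, integral_sub (isOpen_bounded_integrableOn hb (by fun_prop))
    (isOpen_bounded_integrableOn hb continuous_const)]
  simp only [integral_const, measureReal_restrict_apply_univ, smul_eq_mul]
  rw [h3]
  field_simp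
  simp

end asymmetry

lemma le_mul_sqrt_of_forall {V C s₀ W e : ℝ} (hC : 0 ≤ C) (hs₀ : 0 < s₀) (hW : 0 ≤ W) (hV : V ≤ W)
    (h : ∀ s, 0 < s → s ≤ s₀ → e ≤ s ^ 2 → V ≤ C * s) : V ≤ (C + W / s₀) * √e := by
  have h0 := Real.sqrt_nonneg e
  rcases lt_or_ge (√e) s₀ with hlt | hge
  · have h1 : V ≤ C * √e := by
      refine le_of_forall_pos_le_add fun δ hδ => ?_
      set s := min s₀ (√e + δ / (C + 1)) with hs
      have hd : 0 < δ / (C + 1) := by positivity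
      have hes : √e < s := lt_min hlt (by linarith)
      have h2 := h s (h0.trans_lt hes) (min_le_left _ _) ((Real.sqrt_lt' (h0.trans_lt hes)).1 hes).le
      have h3 : C * s ≤ C * (√e + δ / (C + 1)) := by gcongr; exact min_le_right _ _
      have h4 : C * (δ / (C + 1)) ≤ δ := by
        rw [mul_div_assoc', div_le_iff₀ (by positivity)]
        nlinarith
      linarith
    have : 0 ≤ W / s₀ * √e := by positivity
    linarith
  · have h1 : W / s₀ * s₀ ≤ W / s₀ * √e := by gcongr
    rw [div_mul_cancel₀ _ hs₀.ne'] at h1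
    have : 0 ≤ C * √e := by positivity
    linarith

/-- **Fuglede's barycentric quantitative isoperimetric inequality for convex sets.**
For every `n ≥ 2` there is `γ = γ(n) > 0` such that every bounded convex set `E ⊆ ℝⁿ` with
nonempty interior satisfies `λ₀(E) ≤ γ √(δ(E))`, where `δ` is the classical (De Giorgi)
isoperimetric deficit. -/
theorem barycentric_quantitative_isoperimetric_local
    (n : ℕ) (hn : 2 ≤ n) :
    ∃ γ : ℝ, 0 < γ ∧ ∀ E : Set (EuclideanSpace ℝ (Fin n)),
      Convex ℝ E → IsBounded E → (interior E).Nonempty →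
      barAsym n E ≤ γ * Real.sqrt (deficit n E) := by
  obtain ⟨m, rfl⟩ : ∃ m, n = m + 1 := ⟨n - 1, by omega⟩
  obtain ⟨C, s₀, hC, hs₀, hmain⟩ := excess_bound m
  have hω := om_pos (m + 1)
  set ω := om (m + 1) with hωdef
  have hm : (m + 1 : ℕ) ≠ 0 := Nat.succ_ne_zero m
  refine ⟨2 / ω * ((C + ω / s₀) * √((m + 1) * ω)), by positivity, fun E₀ hc₀ hb₀ hne => ?_⟩
  rw [← barAsym_interior hc₀, ← deficit_interior hc₀]
  have hc : Convex ℝ (interior E₀) := hc₀.interior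
  have ho : IsOpen (interior E₀) := isOpen_interior
  have hb : IsBounded (interior E₀) := hb₀.subset interior_subset
  generalize interior E₀ = E at hc ho hb hne
  have hv := volume_real_pos ho hb hne
  have ha := matchRad_pos hv
  have hva := volume_eq_matchRad (E := E) hm
  rw [barAsym_eq hm ho hb hne, mul_assoc]
  have hbar := integral_affPre_barycenter ha ho.measurableSet hb hv
  unfold deficit
  set a := matchRad (m + 1) E
  set b := barycenter (m + 1) E
  set F := affPre a b E with hF
  have hFv : volume.real F = ω := by
    rw [hF, volume_affPre ha ho.measurableSet, hva, ← hωdef]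
    field_simp
  have hFb : IsBounded F := isBounded_affPre ha hb
  have hk : 0 < a ^ (m + 1) / a := by positivity
  set k := a ^ (m + 1) / a
  set p := deGiorgiPer (m + 1) E
  have hp : ∀ φ, IsAdm φ → ∫ x in F, diverg (m + 1) φ x ≤ p / k := fun φ hφ => by
    obtain ⟨ψ, hψ, he⟩ := exists_scaled_field ha b ho.measurableSet hφ
    rw [le_div_iff₀ hk, mul_comm, ← he]
    exact le_deGiorgiPer hc ho hb hne hψ
  have hp0 : 0 ≤ p := by
    have h := le_deGiorgiPer hc ho hb hne (φ := fun _ => 0)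
      ⟨contDiff_const, HasCompactSupport.zero, by simp⟩
    simpa [diverg] using h
  have hV := le_mul_sqrt_of_forall (V := volume.real (F \ ball 0 1)) (e := p / k - (m + 1) * ω)
    hC.le hs₀ hω.le (hFv ▸ measureReal_mono Set.sdiff_subset hFb.measure_lt_top.ne)
    fun s hs hs1 hes => hmain F (convex_affPre hc) (isOpen_affPre ho) hFb hFv hbar (p / k) s hs hs1
      hp (by linarith)
  have hq := deGiorgiPer_ball_pos hm ha
  have hq' := deGiorgiPer_ball_le (n := m + 1) ha
  set q := deGiorgiPer (m + 1) (ball 0 a)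
  push_cast at hq'
  have hdef : p / k - (m + 1) * ω ≤ (m + 1) * ω * ((p - q) / q) := by
    have h1 : p / ((m + 1) * ω * k) ≤ p / q := by gcongr
    rw [sub_div, div_self hq.ne', mul_sub, mul_one]
    have h2 : p / k = (m + 1) * ω * (p / ((m + 1) * ω * k)) := by field_simp
    rw [h2]
    gcongr
  refine mul_le_mul_of_nonneg_left (hV.trans ?_) (by positivity)
  rw [mul_assoc, ← Real.sqrt_mul (by positivity)]
  gcongr
end
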